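/- arXiv:1512.02730 — 2 statements merged into one kernel-verified Lean document; each statement's English description precedes it below -/
import Mathlib

section
/- Let R and B be two disjoint finite sets of points in the plane with R ∪ B in general position, let k ≥ 2 be an integer with |B| ≥ 1 and k(|B|−1) < |R| ≤ k|B|, and let b ∈ B be a vertex of the convex hull of R ∪ B. Then there exists a plane bichromatic tree T on R ∪ B whose maximum vertex degree is at most k + 1, in which the degree of b equals |R| − k(|B|−1), and in which every vertex of R has degree at most 3. (This is the correctness specification of procedure proc1.) -/
open scoped Classical

noncomputable section

/-- The plane. -/
abbrev Pt : Type := ℝ × ℝ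

/-- A set of points is in general position if no three of its points are collinear. -/
def GenPos (P : Set Pt) : Prop :=
  ∀ p ∈ P, ∀ q ∈ P, ∀ r ∈ P, p ≠ q → p ≠ r → q ≠ r →
    ¬ Collinear ℝ ({p, q, r} : Set Pt)

/-- Degree of a vertex in a simple graph. -/
def deg {V : Type*} (G : SimpleGraph V) (v : V) : ℕ := (G.neighborSet v).ncard

/-- `G` is a plane bichromatic spanning tree on `R ∪ B`: a spanning tree of the
geometric complete bipartite graph `K(R,B)` (every edge joins a point of `R` and a
point of `B`), drawn with straight-line segments, no two of which cross (any point
lying on two distinct closed edges is a common endpoint of both). -/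
def PlaneBichromTree (R B : Finset Pt) (G : SimpleGraph {x : Pt // x ∈ R ∪ B}) : Prop :=
  G.IsTree ∧
  (∀ u v : {x : Pt // x ∈ R ∪ B}, G.Adj u v →
      ((u.1 ∈ R ∧ v.1 ∈ B) ∨ (u.1 ∈ B ∧ v.1 ∈ R))) ∧
  (∀ u v x y : {x : Pt // x ∈ R ∪ B}, G.Adj u v → G.Adj x y →
      s(u, v) ≠ s(x, y) →
      ∀ p : Pt, p ∈ segment ℝ u.1 v.1 → p ∈ segment ℝ x.1 y.1 →
        (p = u.1 ∨ p = v.1) ∧ (p = x.1 ∨ p = y.1))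

namespace PBT


/-- Orientation determinant. -/
def D (a b c : Pt) : ℝ := (b.1 - a.1) * (c.2 - a.2) - (b.2 - a.2) * (c.1 - a.1)

/-- General position through determinants. -/
def GP (Ω : Set Pt) : Prop :=
  ∀ p ∈ Ω, ∀ q ∈ Ω, ∀ r ∈ Ω, p ≠ q → p ≠ r → q ≠ r → D p q r ≠ 0

lemma D_cyc (a b c : Pt) : D b c a = D a b c := by unfold D; ring
lemma D_swap (a b c : Pt) : D b a c = - D a b c := by unfold D; ring
lemma D_swap' (a b c : Pt) : D a c b = - D a b c := by unfold D; ring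
lemma D_self (a b : Pt) : D a b a = 0 := by unfold D; ring
lemma D_self' (a b : Pt) : D a b b = 0 := by unfold D; ring
lemma D_self'' (a b : Pt) : D a a b = 0 := by unfold D; ring

lemma line3 {a c p q r : Pt} (hac : a ≠ c) (hp : D a c p = 0) (hq : D a c q = 0)
    (hr : D a c r = 0) : D p q r = 0 := by
  by_cases h1 : c.1 - a.1 = 0
  · have h2 : c.2 - a.2 ≠ 0 := by
      intro h2
      apply hac
      ext <;> linarith
    unfold D at *
    rw [h1] at hp hq hr
    have hp' : p.1 = a.1 := by
      have : (c.2 - a.2) * (p.1 - a.1) = 0 := by linarith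
      rcases mul_eq_zero.1 this with h | h
      · exact absurd h h2
      · linarith
    have hq' : q.1 = a.1 := by
      have : (c.2 - a.2) * (q.1 - a.1) = 0 := by linarith
      rcases mul_eq_zero.1 this with h | h
      · exact absurd h h2
      · linarith
    have hr' : r.1 = a.1 := by
      have : (c.2 - a.2) * (r.1 - a.1) = 0 := by linarith
      rcases mul_eq_zero.1 this with h | h
      · exact absurd h h2
      · linarith
    rw [hp', hq', hr']; ring
  · have key : (c.1 - a.1) * D p q r = 0 := by
      have e : (c.1 - a.1) * D p q r
          = (q.1 - p.1) * (D a c r - D a c p) - (r.1 - p.1) * (D a c q - D a c p) := by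
        unfold D; ring
      rw [e, hp, hq, hr]; ring
    rcases mul_eq_zero.1 key with h | h
    · exact absurd h h1
    · exact h

lemma D_seg {a c p q z : Pt} {s t : ℝ} (hst : s + t = 1) (hz : s • p + t • q = z) :
    D a c z = s * D a c p + t * D a c q := by
  have h1 : z.1 = s * p.1 + t * q.1 := by rw [← hz]; simp
  have h2 : z.2 = s * p.2 + t * q.2 := by rw [← hz]; simp
  have hs : s = 1 - t := by linarith
  subst hs
  unfold D
  rw [h1, h2]; ring

lemma seg_collinear {p q z : Pt} (hz : z ∈ segment ℝ p q) : D p q z = 0 := by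
  obtain ⟨s, t, hs, ht, hst, h⟩ := hz
  rw [D_seg hst h, D_self, D_self']; ring

/-- Two edges do not cross. -/
def NC (e f : Pt × Pt) : Prop :=
  ∀ z : Pt, z ∈ segment ℝ e.1 e.2 → z ∈ segment ℝ f.1 f.2 →
    (z = e.1 ∨ z = e.2) ∧ (z = f.1 ∨ z = f.2)

lemma NC.symm {e f : Pt × Pt} (h : NC e f) : NC f e := fun z h1 h2 => (h z h2 h1).symm

lemma vertex_end {Ω : Set Pt} (hΩ : GP Ω) {p q z : Pt} (hp : p ∈ Ω) (hq : q ∈ Ω) (hz : z ∈ Ω)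
    (hpq : p ≠ q) (h : z ∈ segment ℝ p q) : z = p ∨ z = q := by
  by_contra hcon
  push Not at hcon
  exact hΩ p hp q hq z hz hpq (Ne.symm hcon.1) (Ne.symm hcon.2) (seg_collinear h)

lemma seg_zero {a c p q z : Pt} (hz : z ∈ segment ℝ p q) (hp : D a c p ≤ 0) (hq : D a c q ≤ 0) :
    D a c z ≤ 0 ∧ (D a c z = 0 → z = p ∨ z = q ∨ (D a c p = 0 ∧ D a c q = 0)) := by
  obtain ⟨s, t, hs, ht, hst, h⟩ := hz
  have e := D_seg (a := a) (c := c) hst h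
  have h1 : s * D a c p ≤ 0 := mul_nonpos_of_nonneg_of_nonpos hs hp
  have h2 : t * D a c q ≤ 0 := mul_nonpos_of_nonneg_of_nonpos ht hq
  refine ⟨by linarith, fun h0 => ?_⟩
  have h3 : s * D a c p = 0 := by linarith
  have h4 : t * D a c q = 0 := by linarith
  rcases mul_eq_zero.1 h3 with h5 | h5
  · right; left
    subst h5
    have : t = 1 := by linarith
    subst this
    rw [← h]; simp
  · rcases mul_eq_zero.1 h4 with h6 | h6
    · left
      subst h6
      have : s = 1 := by linarith
      subst this
      rw [← h]; simp
    · right; right; exact ⟨h5, h6⟩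

lemma seg_zero' {a c p q z : Pt} (hz : z ∈ segment ℝ p q) (hp : 0 ≤ D a c p) (hq : 0 ≤ D a c q) :
    0 ≤ D a c z ∧ (D a c z = 0 → z = p ∨ z = q ∨ (D a c p = 0 ∧ D a c q = 0)) := by
  have := seg_zero (a := c) (c := a) hz (by rw [D_swap]; linarith) (by rw [D_swap]; linarith)
  rw [D_swap a c z, D_swap a c p, D_swap a c q] at this
  refine ⟨by linarith [this.1], fun h => ?_⟩
  have h2 := this.2 (by rw [h]; simp)
  simpa using h2

variable {red : Pt → Prop} {Ω : Set Pt} {k : ℕ}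

lemma NC_weak (hΩ : GP Ω) {a c : Pt} (hac : a ≠ c) {e f : Pt × Pt}
    (he1 : e.1 ∈ Ω) (he2 : e.2 ∈ Ω) (hf1 : f.1 ∈ Ω) (hf2 : f.2 ∈ Ω)
    (re1 : red e.1) (re2 : ¬ red e.2) (rf1 : red f.1) (rf2 : ¬ red f.2)
    (ge1 : D a c e.1 ≤ 0) (ge2 : D a c e.2 ≤ 0) (gf1 : 0 ≤ D a c f.1) (gf2 : 0 ≤ D a c f.2)
    (hef : e ≠ f) : NC e f := by
  intro z hze hzf
  have hene : e.1 ≠ e.2 := fun h => re2 (h ▸ re1)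
  have hfne : f.1 ≠ f.2 := fun h => rf2 (h ▸ rf1)
  obtain ⟨h1, h2⟩ := seg_zero hze ge1 ge2
  obtain ⟨h3, h4⟩ := seg_zero' hzf gf1 gf2
  have h0 : D a c z = 0 := le_antisymm h1 h3
  have hv : z ∈ Ω → (z = e.1 ∨ z = e.2) ∧ (z = f.1 ∨ z = f.2) := fun hz =>
    ⟨vertex_end hΩ he1 he2 hz hene hze, vertex_end hΩ hf1 hf2 hz hfne hzf⟩
  rcases h2 h0 with h | h | ⟨h5, h6⟩
  · exact hv (h ▸ he1)
  · exact hv (h ▸ he2)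
  rcases h4 h0 with h | h | ⟨h7, h8⟩
  · exact hv (h ▸ hf1)
  · exact hv (h ▸ hf2)
  exfalso
  have a1 : f.1 = e.1 := by
    by_contra hne
    exact hΩ e.1 he1 e.2 he2 f.1 hf1 hene (Ne.symm hne) (fun h => re2 (h ▸ rf1)) (line3 hac h5 h6 h7)
  have a2 : f.2 = e.2 := by
    by_contra hne
    exact hΩ e.1 he1 e.2 he2 f.2 hf2 hene (fun h => rf2 (h ▸ re1)) (Ne.symm hne) (line3 hac h5 h6 h8)
  exact hef (Prod.ext a1.symm a2.symm)

/-- Weak separation by a line. -/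
def Sep (A C : Finset Pt) : Prop :=
  ∃ a c : Pt, a ≠ c ∧ (∀ p ∈ A, D a c p ≤ 0) ∧ (∀ p ∈ C, 0 ≤ D a c p)

lemma Sep.symm {A C : Finset Pt} (h : Sep A C) : Sep C A := by
  obtain ⟨a, c, hac, h1, h2⟩ := h
  refine ⟨c, a, hac.symm, fun p hp => ?_, fun p hp => ?_⟩
  · rw [D_swap]; linarith [h2 p hp]
  · rw [D_swap]; linarith [h1 p hp]

lemma Sep.mono {A C A' C' : Finset Pt} (h : Sep A C) (hA : A' ⊆ A) (hC : C' ⊆ C) : Sep A' C' := by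
  obtain ⟨a, c, hac, h1, h2⟩ := h
  exact ⟨a, c, hac, fun p hp => h1 p (hA hp), fun p hp => h2 p (hC hp)⟩

/-- Plane bichromatic tree (connected plane graph), as a set of (red, blue) pairs. -/
structure Tree (red : Pt → Prop) (E : Finset (Pt × Pt)) (V : Finset Pt) : Prop where
  col : ∀ e ∈ E, red e.1 ∧ ¬ red e.2 ∧ e.1 ∈ V ∧ e.2 ∈ V
  nc : ∀ e ∈ E, ∀ f ∈ E, e ≠ f → NC e f
  conn : ∀ p ∈ V, ∀ q ∈ V, Relation.EqvGen (fun a c => (a, c) ∈ E) p q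

/-- No crossing between two edge sets. -/
def X (E F : Finset (Pt × Pt)) : Prop := ∀ e ∈ E, ∀ f ∈ F, e ≠ f → NC e f

lemma X.symm {E F : Finset (Pt × Pt)} (h : X E F) : X F E :=
  fun e he f hf hne => (h f hf e he hne.symm).symm

lemma X.union_left {E F G : Finset (Pt × Pt)} (h1 : X E G) (h2 : X F G) : X (E ∪ F) G := by
  intro e he f hf hne
  rcases Finset.mem_union.1 he with h | h
  · exact h1 e h f hf hne
  · exact h2 e h f hf hne

lemma X.union_right {E F G : Finset (Pt × Pt)} (h1 : X G E) (h2 : X G F) : X G (E ∪ F) :=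
  (X.union_left h1.symm h2.symm).symm

lemma X_of_Sep (hΩ : GP Ω) {E F : Finset (Pt × Pt)} {V W : Finset Pt} (hE : Tree red E V)
    (hF : Tree red F W) (hV : (V : Set Pt) ⊆ Ω) (hW : (W : Set Pt) ⊆ Ω) (h : Sep V W) : X E F := by
  obtain ⟨a, c, hac, h1, h2⟩ := h
  intro e he f hf hne
  obtain ⟨c1, c2, c3, c4⟩ := hE.col e he
  obtain ⟨d1, d2, d3, d4⟩ := hF.col f hf
  exact NC_weak hΩ hac (hV c3) (hV c4) (hW d3) (hW d4) c1 c2 d1 d2 (h1 _ c3) (h1 _ c4)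
    (h2 _ d3) (h2 _ d4) hne

lemma eqv_mono {E F : Finset (Pt × Pt)} (h : E ⊆ F) {p q : Pt}
    (hp : Relation.EqvGen (fun a c => (a, c) ∈ E) p q) :
    Relation.EqvGen (fun a c => (a, c) ∈ F) p q :=
  Relation.EqvGen.mono (fun _ _ hh => h hh) _ _ hp

lemma Tree.join {E F : Finset (Pt × Pt)} {V W : Finset Pt} (hE : Tree red E V)
    (hF : Tree red F W) {v : Pt} (hv : v ∈ V) (hw : v ∈ W) (hX : X E F) :
    Tree red (E ∪ F) (V ∪ W) := by
  refine ⟨?_, ?_, ?_⟩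
  · intro e he
    rcases Finset.mem_union.1 he with h | h
    · obtain ⟨c1, c2, c3, c4⟩ := hE.col e h
      exact ⟨c1, c2, Finset.mem_union_left _ c3, Finset.mem_union_left _ c4⟩
    · obtain ⟨c1, c2, c3, c4⟩ := hF.col e h
      exact ⟨c1, c2, Finset.mem_union_right _ c3, Finset.mem_union_right _ c4⟩
  · intro e he f hf hne
    rcases Finset.mem_union.1 he with h | h <;> rcases Finset.mem_union.1 hf with h' | h'
    · exact hE.nc e h f h' hne
    · exact hX e h f h' hne
    · exact (hX f h' e h hne.symm).symm
    · exact hF.nc e h f h' hne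
  · have key : ∀ p ∈ V ∪ W, Relation.EqvGen (fun a c => (a, c) ∈ E ∪ F) p v := by
      intro p hp
      rcases Finset.mem_union.1 hp with h | h
      · exact eqv_mono Finset.subset_union_left (hE.conn p h v hv)
      · exact eqv_mono Finset.subset_union_right (hF.conn p h v hw)
    intro p hp q hq
    exact Relation.EqvGen.trans _ _ _ (key p hp) (Relation.EqvGen.symm _ _ (key q hq))

lemma Tree.single {r q : Pt} (hr : red r) (hq : ¬ red q) : Tree red {(r, q)} {r, q} := by
  refine ⟨?_, ?_, ?_⟩
  · intro e he
    rw [Finset.mem_singleton] at he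
    subst he
    simp [hr, hq]
  · intro e he f hf hne
    rw [Finset.mem_singleton] at he hf
    exact absurd (he.trans hf.symm) hne
  · have h : Relation.EqvGen (fun a c => (a, c) ∈ ({(r, q)} : Finset (Pt × Pt))) r q :=
      Relation.EqvGen.rel _ _ (by simp)
    intro a ha c hc
    simp only [Finset.mem_insert, Finset.mem_singleton] at ha hc
    rcases ha with rfl | rfl <;> rcases hc with rfl | rfl
    · exact Relation.EqvGen.refl _
    · exact h
    · exact Relation.EqvGen.symm _ _ h
    · exact Relation.EqvGen.refl _

/-- Two edges sharing the vertex `s` never cross. -/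
lemma Sep_share {s x y : Pt} (h : s ≠ x) : Sep {s, x} {s, y} := by
  rcases le_total 0 (D s x y) with h0 | h0
  · refine ⟨s, x, h, ?_, ?_⟩ <;> intro p hp <;>
      simp only [Finset.mem_insert, Finset.mem_singleton] at hp <;> rcases hp with rfl | rfl
    · rw [D_self]
    · rw [D_self']
    · rw [D_self]
    · exact h0
  · refine ⟨x, s, h.symm, ?_, ?_⟩ <;> intro p hp <;>
      simp only [Finset.mem_insert, Finset.mem_singleton] at hp <;> rcases hp with rfl | rfl
    · rw [D_self']
    · rw [D_self]
    · rw [D_self']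
    · rw [D_swap]; linarith

def bd (E : Finset (Pt × Pt)) (q : Pt) : ℕ := (E.filter (fun e => e.2 = q)).card
def rd (E : Finset (Pt × Pt)) (r : Pt) : ℕ := (E.filter (fun e => e.1 = r)).card

lemma bd_union (E F : Finset (Pt × Pt)) (q : Pt) : bd (E ∪ F) q ≤ bd E q + bd F q := by
  unfold bd; rw [Finset.filter_union]; exact Finset.card_union_le _ _
lemma rd_union (E F : Finset (Pt × Pt)) (q : Pt) : rd (E ∪ F) q ≤ rd E q + rd F q := by
  unfold rd; rw [Finset.filter_union]; exact Finset.card_union_le _ _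

lemma Tree.bd_zero {E : Finset (Pt × Pt)} {V : Finset Pt} (h : Tree red E V) {q : Pt}
    (hq : q ∉ V) : bd E q = 0 := by
  unfold bd
  rw [Finset.card_eq_zero, Finset.filter_eq_empty_iff]
  intro e he h2
  exact hq (h2 ▸ (h.col e he).2.2.2)
lemma Tree.rd_zero {E : Finset (Pt × Pt)} {V : Finset Pt} (h : Tree red E V) {q : Pt}
    (hq : q ∉ V) : rd E q = 0 := by
  unfold rd
  rw [Finset.card_eq_zero, Finset.filter_eq_empty_iff]
  intro e he h2
  exact hq (h2 ▸ (h.col e he).2.2.1)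

lemma bd_single_le (r q p : Pt) : bd {(r, q)} p ≤ 1 := by
  unfold bd; exact (Finset.card_filter_le _ _).trans (by simp)
lemma rd_single_le (r q p : Pt) : rd {(r, q)} p ≤ 1 := by
  unfold rd; exact (Finset.card_filter_le _ _).trans (by simp)
lemma bd_single_ne {r q p : Pt} (h : p ≠ q) : bd {(r, q)} p = 0 := by
  unfold bd; rw [Finset.card_eq_zero, Finset.filter_eq_empty_iff]
  intro e he h2
  rw [Finset.mem_singleton] at he
  subst he
  exact h h2.symm
lemma rd_single_ne {r q p : Pt} (h : p ≠ r) : rd {(r, q)} p = 0 := by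
  unfold rd; rw [Finset.card_eq_zero, Finset.filter_eq_empty_iff]
  intro e he h2
  rw [Finset.mem_singleton] at he
  subst he
  exact h h2.symm

/-- Weights. -/
def wt (red : Pt → Prop) (k : ℕ) (p : Pt) : ℤ := if red p then 1 else -(k : ℤ)
def w (red : Pt → Prop) (k : ℕ) (S : Finset Pt) : ℤ := ∑ p ∈ S, wt red k p

lemma wt_le_one (p : Pt) : wt red k p ≤ 1 := by unfold wt; split_ifs <;> omega
lemma w_insert {S : Finset Pt} {p : Pt} (h : p ∉ S) :
    w red k (insert p S) = wt red k p + w red k S := Finset.sum_insert h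
lemma w_union {S T : Finset Pt} (h : Disjoint S T) :
    w red k (S ∪ T) = w red k S + w red k T := Finset.sum_union h
lemma w_erase {S : Finset Pt} {p : Pt} (h : p ∈ S) :
    w red k (S.erase p) = w red k S - wt red k p := Finset.sum_erase_eq_sub h
lemma w_sdiff {S T : Finset Pt} (h : T ⊆ S) :
    w red k (S \ T) = w red k S - w red k T := by
  have := Finset.sum_sdiff (f := wt red k) h
  unfold w; linarith
lemma wt_red {p : Pt} (h : red p) : wt red k p = 1 := by simp [wt, h]
lemma wt_blue {p : Pt} (h : ¬ red p) : wt red k p = -(k : ℤ) := by simp [wt, h]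


/-- `r` can be weakly separated from `S` by a line through `r`. -/
def Ext (r : Pt) (S : Finset Pt) : Prop :=
  ∃ a c : Pt, a ≠ c ∧ D a c r = 0 ∧ ∀ p ∈ S, 0 ≤ D a c p

lemma Ext.mono {r : Pt} {S T : Finset Pt} (h : Ext r S) (hT : T ⊆ S) : Ext r T := by
  obtain ⟨a, c, h1, h2, h3⟩ := h
  exact ⟨a, c, h1, h2, fun p hp => h3 p (hT hp)⟩

/-- The angular order of `S` around `r` is a strict total order. -/
structure Ord (r : Pt) (S : Finset Pt) : Prop where
  tot : ∀ p ∈ S, ∀ q ∈ S, p ≠ q → 0 < D r p q ∨ 0 < D r q p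
  tr : ∀ p ∈ S, ∀ q ∈ S, ∀ t ∈ S, 0 < D r p q → 0 < D r q t → 0 < D r p t

lemma Ord.mono {r : Pt} {S T : Finset Pt} (h : Ord r S) (hT : T ⊆ S) : Ord r T :=
  ⟨fun p hp q hq => h.tot p (hT hp) q (hT hq),
   fun p hp q hq t ht => h.tr p (hT hp) q (hT hq) t (hT ht)⟩

lemma Ord_of_Ext (hΩ : GP Ω) {r : Pt} {S : Finset Pt} (hrS : r ∉ S)
    (hS : (↑(insert r S) : Set Pt) ⊆ Ω) (h : Ext r S) : Ord r S := by
  obtain ⟨a, c, hac, hr, hp⟩ := h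
  have hr' : r ∈ Ω := hS (by simp)
  have hS' : ∀ p ∈ S, p ∈ Ω := fun p hp => hS (by simp [hp])
  have hne : ∀ p ∈ S, r ≠ p := fun p hp h => hrS (h ▸ hp)
  have tot : ∀ p ∈ S, ∀ q ∈ S, p ≠ q → 0 < D r p q ∨ 0 < D r q p := by
    intro p hp q hq hpq
    have := hΩ r hr' p (hS' p hp) q (hS' q hq) (hne p hp) (hne q hq) hpq
    rw [D_swap' r p q]
    rcases lt_or_gt_of_ne this with h | h
    · right; linarith
    · left; exact h
  refine ⟨tot, ?_⟩
  intro p hpS q hqS t htS h1 h2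
  have id : D a c q * D r p t = D a c p * D r q t + D a c t * D r p q := by
    have : D a c r * D p q t - D a c p * D r q t + D a c q * D r p t - D a c t * D r p q = 0 := by
      unfold D; ring
    rw [hr] at this; linarith
  have gp := hp p hpS
  have gq := hp q hqS
  have gt := hp t htS
  have hpos : 0 < D a c p * D r q t + D a c t * D r p q := by
    rcases gp.eq_or_lt with e1 | e1
    · rcases gt.eq_or_lt with e2 | e2
      · exfalso
        have h0 := line3 hac hr e1.symm e2.symm
        have hpt : p = t := by
          by_contra hpt
          exact hΩ r hr' p (hS' p hpS) t (hS' t htS) (hne p hpS) (hne t htS) hpt h0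
        subst hpt
        rw [D_swap' r p q] at h2; linarith
      · rw [← e1]; have := mul_pos e2 h1; linarith
    · have := mul_pos e1 h2
      have := mul_nonneg gt h1.le
      linarith
  rw [← id] at hpos
  by_contra hcon
  have := mul_nonpos_of_nonneg_of_nonpos gq (not_lt.1 hcon)
  linarith

lemma Ord.exists_min {r : Pt} : ∀ {S : Finset Pt}, Ord r S → S.Nonempty →
    ∃ m ∈ S, ∀ q ∈ S, q ≠ m → 0 < D r m q := by
  intro S
  induction S using Finset.induction_on with
  | empty => intro _ h; exact absurd h (by simp)
  | insert x T hx ih =>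
    intro h _
    by_cases hT : T.Nonempty
    · obtain ⟨m, hm, hm2⟩ := ih (h.mono (Finset.subset_insert _ _)) hT
      have hxm : x ≠ m := fun h => hx (h ▸ hm)
      rcases h.tot x (by simp) m (by simp [hm]) hxm with h1 | h1
      · refine ⟨x, by simp, ?_⟩
        intro q hq hqx
        have hqT : q ∈ T := by
          rcases Finset.mem_insert.1 hq with h | h
          · exact absurd h hqx
          · exact h
        by_cases hqm : q = m
        · subst hqm; exact h1
        · exact h.tr x (by simp) m (by simp [hm]) q hq h1 (hm2 q hqT hqm)
      · refine ⟨m, by simp [hm], ?_⟩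
        intro q hq hqm
        rcases Finset.mem_insert.1 hq with h | h
        · subst h; exact h1
        · exact hm2 q h hqm
    · rw [Finset.not_nonempty_iff_eq_empty] at hT
      subst hT
      refine ⟨x, by simp, ?_⟩
      intro q hq hqx
      simp at hq
      exact absurd hq hqx

/-- Initial segment in the angular order around `r`. -/
def Lower (r : Pt) (S A : Finset Pt) : Prop :=
  A ⊆ S ∧ ∀ p ∈ A, ∀ q ∈ S, q ∉ A → 0 < D r p q

lemma Lower.exists_max {r : Pt} {S : Finset Pt} (Q : Finset Pt → Prop)
    (h : ∃ A, Lower r S A ∧ Q A) :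
    ∃ A, Lower r S A ∧ Q A ∧ ∀ A', Lower r S A' → Q A' → A'.card ≤ A.card := by
  obtain ⟨A0, hA0, hQ0⟩ := h
  obtain ⟨A, hA, hmax⟩ := Finset.exists_max_image
    (S.powerset.filter (fun A => Lower r S A ∧ Q A)) Finset.card
    ⟨A0, by simp [hA0, hQ0, hA0.1]⟩
  simp only [Finset.mem_filter, Finset.mem_powerset] at hA hmax
  exact ⟨A, hA.2.1, hA.2.2, fun A' h1 h2 => hmax A' ⟨h1.1, h1, h2⟩⟩

lemma Lower.insert_min {r : Pt} {S A : Finset Pt} (hA : Lower r S A) {m : Pt} (hm : m ∈ S)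
    (hmin : ∀ q ∈ S \ A, q ≠ m → 0 < D r m q) : Lower r S (insert m A) := by
  refine ⟨Finset.insert_subset hm hA.1, ?_⟩
  intro p hp q hq hqA
  simp only [Finset.mem_insert, not_or] at hqA
  rcases Finset.mem_insert.1 hp with h | h
  · subst h; exact hmin q (by simp [hq, hqA.2]) hqA.1
  · exact hA.2 p h q hq hqA.2

lemma split {b : Pt} {S : Finset Pt} (hO : Ord b S) {j : ℤ} (hj : 0 ≤ j) (hjw : j < w red k S) :
    ∃ L ρ, Lower b S L ∧ ρ ∈ S ∧ ρ ∉ L ∧ red ρ ∧ w red k L = j ∧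
      (∀ q ∈ S, q ∉ L → q ≠ ρ → 0 < D b ρ q) := by
  obtain ⟨A, hA, hQ, hmax⟩ := Lower.exists_max (r := b) (S := S) (fun A => w red k A ≤ j)
    ⟨∅, ⟨by simp, by simp⟩, by simpa [w] using hj⟩
  have hne : (S \ A).Nonempty := by
    rw [Finset.sdiff_nonempty]
    intro hsub
    have : A = S := Finset.Subset.antisymm hA.1 hsub
    subst this
    omega
  obtain ⟨m, hm, hmin⟩ := (hO.mono (Finset.sdiff_subset (s := S) (t := A))).exists_min hne
  rw [Finset.mem_sdiff] at hm
  have hL := hA.insert_min hm.1 hmin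
  have hnQ : ¬ (w red k (insert m A) ≤ j) := by
    intro h
    have := hmax _ hL h
    rw [Finset.card_insert_of_notMem hm.2] at this
    omega
  rw [w_insert hm.2] at hnQ
  have hred : red m := by
    by_contra hb
    rw [wt_blue hb] at hnQ
    omega
  rw [wt_red hred] at hnQ
  exact ⟨A, m, hA, hm.1, hm.2, hred, by omega,
    fun q hq hqA hqm => hmin q (by simp [hq, hqA]) hqm⟩

/-- Solution rooted at the blue point `b`. -/
structure Sol (red : Pt → Prop) (k : ℕ) (S : Finset Pt) (b : Pt) (E : Finset (Pt × Pt)) : Prop where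
  tree : Tree red E (insert b S)
  blue : ∀ q, ¬ red q → q ≠ b → bd E q ≤ k + 1
  root : (bd E b : ℤ) ≤ w red k S
  reds : ∀ r, red r → rd E r ≤ 3

/-- Induction hypothesis. -/
def IH (red : Pt → Prop) (k : ℕ) (Ω : Set Pt) (n : ℕ) : Prop :=
  ∀ (S : Finset Pt) (b : Pt), S.card < n → b ∉ S → ¬ red b → (↑(insert b S) : Set Pt) ⊆ Ω →
    Ext b S → 1 ≤ w red k S → ∃ E, Sol red k S b E

/-- Information about the union of two trees sharing the single vertex `v`. -/
structure Jn (red : Pt → Prop) (E F : Finset (Pt × Pt)) (V W : Finset Pt) (v : Pt) : Prop where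
  tree : Tree red (E ∪ F) (V ∪ W)
  bmax : ∀ q, q ≠ v → ∀ c, bd E q ≤ c → bd F q ≤ c → bd (E ∪ F) q ≤ c
  rmax : ∀ q, q ≠ v → ∀ c, rd E q ≤ c → rd F q ≤ c → rd (E ∪ F) q ≤ c

lemma jn {E F : Finset (Pt × Pt)} {V W : Finset Pt} {v : Pt} (hE : Tree red E V)
    (hF : Tree red F W) (hX : X E F) (hv : v ∈ V) (hw : v ∈ W)
    (hVW : ∀ x ∈ V, x ∈ W → x = v) : Jn red E F V W v := by
  refine ⟨hE.join hF hv hw hX, ?_, ?_⟩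
  · intro q hq c h1 h2
    have h3 := bd_union E F q
    by_cases hqV : q ∈ V
    · have : q ∉ W := fun h => hq (hVW q hqV h)
      rw [hF.bd_zero this] at h3; omega
    · rw [hE.bd_zero hqV] at h3; omega
  · intro q hq c h1 h2
    have h3 := rd_union E F q
    by_cases hqV : q ∈ V
    · have : q ∉ W := fun h => hq (hVW q hqV h)
      rw [hF.rd_zero this] at h3; omega
    · rw [hE.rd_zero hqV] at h3; omega

lemma Sol_w2 (hΩ : GP Ω) {n : ℕ} (ih : IH red k Ω n) {S : Finset Pt} {b : Pt} (hn : S.card = n)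
    (hbS : b ∉ S) (hb : ¬ red b) (hS : (↑(insert b S) : Set Pt) ⊆ Ω) (hE : Ext b S)
    (hw : 2 ≤ w red k S) : ∃ E, Sol red k S b E := by
  obtain ⟨L, ρ, hL, hρS, hρL, hρ, hwL, hmin⟩ :=
    split (red := red) (k := k) (Ord_of_Ext hΩ hbS hS hE) (j := 1) (by norm_num) (by omega)
  have hLS := hL.1
  have hwR := w_sdiff (red := red) (k := k) hLS
  have hc1 : L.card < n := by
    rw [← hn]; exact Finset.card_lt_card ⟨hLS, fun h => hρL (h hρS)⟩
  have hLne : L.Nonempty := by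
    rw [Finset.nonempty_iff_ne_empty]; rintro rfl; simp [w] at hwL
  have hc2 : (S \ L).card < n := by
    rw [Finset.card_sdiff_of_subset hLS]
    have := hLne.card_pos
    omega
  have sub1 : insert b L ⊆ insert b S := Finset.insert_subset_insert _ hLS
  have sub2 : insert b (S \ L) ⊆ insert b S := Finset.insert_subset_insert _ Finset.sdiff_subset
  have hs1 : (↑(insert b L) : Set Pt) ⊆ Ω := (Finset.coe_subset.2 sub1).trans hS
  have hs2 : (↑(insert b (S \ L)) : Set Pt) ⊆ Ω := (Finset.coe_subset.2 sub2).trans hS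
  obtain ⟨E1, h1⟩ := ih L b hc1 (fun h => hbS (hLS h)) hb hs1 (hE.mono hLS) (by omega)
  obtain ⟨E2, h2⟩ := ih (S \ L) b hc2 (fun h => hbS (Finset.sdiff_subset h)) hb hs2
    (hE.mono Finset.sdiff_subset) (by omega)
  have hsep : Sep (insert b L) (insert b (S \ L)) := by
    refine ⟨b, ρ, fun h => hbS (h ▸ hρS), ?_, ?_⟩
    · intro p hp
      rcases Finset.mem_insert.1 hp with rfl | h
      · rw [D_self]
      · rw [D_swap']; linarith [hL.2 p h ρ hρS hρL]
    · intro p hp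
      rcases Finset.mem_insert.1 hp with rfl | h
      · rw [D_self]
      · rw [Finset.mem_sdiff] at h
        by_cases hpρ : p = ρ
        · subst hpρ; rw [D_self']
        · exact (hmin p h.1 h.2 hpρ).le
  have J := jn (v := b) h1.tree h2.tree (X_of_Sep hΩ h1.tree h2.tree hs1 hs2 hsep) (by simp)
    (by simp) (by
      intro x hx hx2
      rcases Finset.mem_insert.1 hx with rfl | h
      · rfl
      · rcases Finset.mem_insert.1 hx2 with rfl | h'
        · rfl
        · exact absurd h (Finset.mem_sdiff.1 h').2)
  refine ⟨E1 ∪ E2, ?_, ?_, ?_, ?_⟩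
  · have : insert b L ∪ insert b (S \ L) = insert b S := by
      ext x; simp only [Finset.mem_union, Finset.mem_insert, Finset.mem_sdiff]
      have := @hLS x
      tauto
    rw [← this]; exact J.tree
  · intro q hq hqb
    exact J.bmax q hqb _ (h1.blue q hq hqb) (h2.blue q hq hqb)
  · have := bd_union E1 E2 b
    have := h1.root
    have := h2.root
    omega
  · intro r hr
    exact J.rmax r (fun h => hb (h ▸ hr)) _ (h1.reds r hr) (h2.reds r hr)

/-- A red `s` hung onto a weight-zero set `Λ` through the blue point `y` of `Λ`. -/
lemma hang (hΩ : GP Ω) (hk : 1 ≤ k) {n : ℕ} (ih : IH red k Ω n) {Λ : Finset Pt} {s y : Pt}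
    (hc : Λ.card ≤ n) (hs : red s) (hyΛ : y ∈ Λ) (hy : ¬ red y) (hsΛ : s ∉ Λ)
    (hsub : (↑(insert s Λ) : Set Pt) ⊆ Ω) (hw : w red k Λ = 0) (hsep : Sep Λ {s, y}) :
    ∃ E, Tree red E Λ ∧ Tree red (E ∪ {(s, y)}) (insert s Λ) ∧
      (∀ q, ¬ red q → bd (E ∪ {(s, y)}) q ≤ k + 1) ∧
      (∀ r, red r → rd (E ∪ {(s, y)}) r ≤ 3) ∧ rd (E ∪ {(s, y)}) s ≤ 1 := by
  have hins : insert y (Λ.erase y) = Λ := Finset.insert_erase hyΛ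
  have hsubΛ : (↑Λ : Set Pt) ⊆ Ω := by
    refine Set.Subset.trans ?_ hsub
    simp
  have hsy : s ≠ y := fun h => hsΛ (h ▸ hyΛ)
  have hsub2 : (↑({s, y} : Finset Pt) : Set Pt) ⊆ Ω := by
    refine Set.Subset.trans ?_ hsub
    intro x hx
    simp at hx ⊢
    rcases hx with rfl | rfl
    · simp
    · right; exact hyΛ
  have hext : Ext y (Λ.erase y) := by
    obtain ⟨a, c, hac, h1, h2⟩ := hsep.symm
    refine ⟨a, c, hac, ?_, fun p hp => h2 p (Finset.mem_of_mem_erase hp)⟩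
    exact le_antisymm (h1 y (by simp)) (h2 y hyΛ)
  have hwe := w_erase (red := red) (k := k) hyΛ
  rw [wt_blue hy, hw] at hwe
  obtain ⟨E, hE⟩ := ih (Λ.erase y) y
    (lt_of_lt_of_le (Finset.card_erase_lt_of_mem hyΛ) hc) (by simp) hy
    (by rw [hins]; exact hsubΛ) hext (by omega)
  have hT := hE.tree
  rw [hins] at hT
  have hT2 := Tree.single (red := red) hs hy
  have J := jn (v := y) hT hT2 (X_of_Sep hΩ hT hT2 hsubΛ hsub2 hsep) hyΛ (by simp) (by
    intro x hx hx2
    simp only [Finset.mem_insert, Finset.mem_singleton] at hx2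
    rcases hx2 with rfl | rfl
    · exact absurd hx hsΛ
    · rfl)
  refine ⟨E, hT, ?_, ?_, ?_, ?_⟩
  · have : Λ ∪ {s, y} = insert s Λ := by
      ext x; simp only [Finset.mem_union, Finset.mem_insert, Finset.mem_singleton]
      constructor
      · rintro (h | h | rfl)
        · exact Or.inr h
        · exact Or.inl h
        · exact Or.inr hyΛ
      · tauto
    rw [← this]; exact J.tree
  · intro q hq
    by_cases hqy : q = y
    · subst hqy
      have h1 := bd_union E {(s, q)} q
      have h2 := hE.root
      have h3 := bd_single_le s q q
      omega
    · exact J.bmax q hqy _ (hE.blue q hq hqy) ((bd_single_le s y q).trans (by omega))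
  · intro r hr
    exact J.rmax r (fun h => hy (h ▸ hr)) _ (hE.reds r hr) ((rd_single_le s y r).trans (by omega))
  · have h1 := rd_union E {(s, y)} s
    have h2 := hT.rd_zero hsΛ
    have h3 := rd_single_le s y s
    omega

/-- Join two trees at a red vertex `s`. -/
lemma joinRed {E F : Finset (Pt × Pt)} {V W : Finset Pt} {s : Pt} (hs : red s)
    (hE : Tree red E V) (hF : Tree red F W) (hX : X E F) (hv : s ∈ V) (hw : s ∈ W)
    (hVW : ∀ x ∈ V, x ∈ W → x = s)
    (bE : ∀ q, ¬ red q → bd E q ≤ k + 1) (bF : ∀ q, ¬ red q → bd F q ≤ k + 1)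
    (rE : ∀ r, red r → rd E r ≤ 3) (rF : ∀ r, red r → rd F r ≤ 3)
    (h3 : rd E s + rd F s ≤ 3) :
    Tree red (E ∪ F) (V ∪ W) ∧ (∀ q, ¬ red q → bd (E ∪ F) q ≤ k + 1) ∧
      (∀ r, red r → rd (E ∪ F) r ≤ 3) ∧ rd (E ∪ F) s ≤ rd E s + rd F s := by
  have J := jn hE hF hX hv hw hVW
  refine ⟨J.tree, ?_, ?_, rd_union E F s⟩
  · intro q hq
    exact J.bmax q (fun h => hq (h ▸ hs)) _ (bE q hq) (bF q hq)
  · intro r hr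
    by_cases h : r = s
    · subst h; exact (rd_union E F r).trans h3
    · exact J.rmax r h _ (rE r hr) (rF r hr)

lemma P2 (hΩ : GP Ω) (hk : 1 ≤ k) {n : ℕ} (ih : IH red k Ω n) {S : Finset Pt} {r : Pt}
    (hc : S.card ≤ n) (hrS : r ∉ S) (hr : red r)
    (hsub : (↑(insert r S) : Set Pt) ⊆ Ω) (hE : Ext r S) (hw : w red k S = 0) :
    ∃ E, Tree red E (insert r S) ∧ (∀ q, ¬ red q → bd E q ≤ k + 1) ∧
      (∀ q, red q → rd E q ≤ 3) ∧ rd E r ≤ 2 := by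
  have hO := Ord_of_Ext hΩ hrS hsub hE
  have hrΩ : r ∈ Ω := hsub (by simp)
  have hSΩ : ∀ p ∈ S, p ∈ Ω := fun p hp => hsub (by simp [hp])
  have hsubT : ∀ T ⊆ S, (↑(insert r T) : Set Pt) ⊆ Ω := fun T hT =>
    (Finset.coe_subset.2 (Finset.insert_subset_insert _ hT)).trans hsub
  have hsubT' : ∀ T ⊆ S, (↑T : Set Pt) ⊆ Ω := fun T hT =>
    Set.Subset.trans (by simp) (hsubT T hT)
  by_cases hS0 : S.Nonempty
  swap
  · rw [Finset.not_nonempty_iff_eq_empty] at hS0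
    subst hS0
    refine ⟨∅, ⟨by simp, by simp, ?_⟩, by simp [bd], by simp [rd], by simp [rd]⟩
    intro p hp q hq
    simp at hp hq
    subst hp; subst hq
    exact Relation.EqvGen.refl _
  by_cases hlow : ∃ A, Lower r S A ∧ 0 < w red k A
  swap
  · -- the first point is blue
    push Not at hlow
    obtain ⟨y, hyS, hmin⟩ := hO.exists_min hS0
    have hL : Lower r S {y} := by
      refine ⟨by simpa using hyS, ?_⟩
      intro p hp q hq hqy
      simp at hp hqy
      subst hp; exact hmin q hq hqy
    have hy : ¬ red y := by
      intro h
      have := hlow _ hL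
      rw [w, Finset.sum_singleton, wt_red h] at this
      omega
    have hsep : Sep S {r, y} := by
      refine Sep.symm ⟨r, y, fun h => hrS (h ▸ hyS), ?_, ?_⟩
      · intro p hp
        simp only [Finset.mem_insert, Finset.mem_singleton] at hp
        rcases hp with rfl | rfl
        · rw [D_self]
        · rw [D_self']
      · intro p hp
        by_cases h : p = y
        · subst h; rw [D_self']
        · exact (hmin p hp h).le
    obtain ⟨E, h1, h2, h3, h4, h5⟩ := hang hΩ hk ih hc hr hyS hy hrS hsub hw hsep
    exact ⟨_, h2, h3, h4, by omega⟩
  obtain ⟨A, hA, hQ, hmax⟩ := Lower.exists_max (r := r) (S := S) (fun A => 0 < w red k A) hlow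
  have hne : (S \ A).Nonempty := by
    rw [Finset.sdiff_nonempty]
    intro hs
    have : A = S := Finset.Subset.antisymm hA.1 hs
    subst this
    omega
  obtain ⟨m, hm, hmin⟩ := (hO.mono (Finset.sdiff_subset (s := S) (t := A))).exists_min hne
  rw [Finset.mem_sdiff] at hm
  have hL := hA.insert_min hm.1 hmin
  have hnQ : ∀ A', Lower r S A' → A.card < A'.card → w red k A' ≤ 0 := by
    intro A' h1 h2
    by_contra h3
    have := hmax A' h1 (not_le.1 h3)
    omega
  have hw1 := hnQ _ hL (by rw [Finset.card_insert_of_notMem hm.2]; omega)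
  have hwi := w_insert (red := red) (k := k) hm.2
  have hmb : ¬ red m := by
    intro h
    rw [wt_red h] at hwi
    omega
  rw [wt_blue hmb] at hwi
  set R := S \ insert m A with hR
  have hwR : w red k R = k - w red k A := by
    rw [hR, w_sdiff hL.1]; omega
  have hRS : R ⊆ S := Finset.sdiff_subset
  have hRm : ∀ p ∈ R, p ∈ S ∧ p ≠ m ∧ p ∉ A := by
    intro p hp
    simpa [hR] using hp
  have hrm : r ≠ m := fun h => hrS (h ▸ hm.1)
  have hposR : ∀ p ∈ R, 0 < D r m p := by
    intro p hp
    obtain ⟨h1, h2, h3⟩ := hRm p hp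
    exact hmin p (by simp [h1, h3]) h2
  have hnegA : ∀ p ∈ A, D r m p < 0 := by
    intro p hp
    have := hA.2 p hp m hm.1 hm.2
    rw [D_swap' r p m]; linarith
  have hmA : insert m A ⊆ S := hL.1
  have hmR : insert m R ⊆ S := Finset.insert_subset hm.1 hRS
  have hunion : insert m A ∪ R = S := by
    rw [hR]; exact Finset.union_sdiff_of_subset hmA
  have hcA : A.card < n := by
    refine lt_of_lt_of_le (Finset.card_lt_card ⟨hA.1, fun h => hm.2 (h hm.1)⟩) hc
  -- separation facts from the line r m
  have hsepAR : Sep (insert m A) (insert m R) := by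
    refine ⟨r, m, hrm, ?_, ?_⟩
    · intro p hp
      rcases Finset.mem_insert.1 hp with rfl | h
      · rw [D_self']
      · exact (hnegA p h).le
    · intro p hp
      rcases Finset.mem_insert.1 hp with rfl | h
      · rw [D_self']
      · exact (hposR p h).le
  have hsepA : Sep (insert m A) {r, m} := by
    refine ⟨r, m, hrm, ?_, ?_⟩
    · intro p hp
      rcases Finset.mem_insert.1 hp with rfl | h
      · rw [D_self']
      · exact (hnegA p h).le
    · intro p hp
      simp only [Finset.mem_insert, Finset.mem_singleton] at hp
      rcases hp with rfl | rfl
      · rw [D_self]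
      · rw [D_self']
  have hsepR : Sep {r, m} (insert m R) := by
    refine ⟨r, m, hrm, ?_, ?_⟩
    · intro p hp
      simp only [Finset.mem_insert, Finset.mem_singleton] at hp
      rcases hp with rfl | rfl
      · rw [D_self]
      · rw [D_self']
    · intro p hp
      rcases Finset.mem_insert.1 hp with rfl | h
      · rw [D_self']
      · exact (hposR p h).le
  have hT2 := Tree.single (red := red) hr hmb
  have hsubrm : (↑({r, m} : Finset Pt) : Set Pt) ⊆ Ω := by
    intro x hx
    simp at hx
    rcases hx with rfl | rfl
    · exact hrΩ
    · exact hSΩ _ hm.1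
  by_cases hR0 : w red k R = 0
  · -- hang `insert m A`, and `R` if nonempty
    obtain ⟨E1, h11, h12, h13, h14, h15⟩ := hang hΩ hk ih (Λ := insert m A) (s := r) (y := m)
      ((Finset.card_le_card hmA).trans hc) hr (by simp) hmb (fun h => hrS (hmA h))
      (hsubT _ hmA) (by omega) hsepA
    by_cases hRne : R.Nonempty
    swap
    · rw [Finset.not_nonempty_iff_eq_empty] at hRne
      rw [hRne, Finset.union_empty] at hunion
      rw [hunion] at h12
      exact ⟨_, h12, h13, h14, by omega⟩
    obtain ⟨y, hyR, hymin⟩ := (hO.mono hRS).exists_min hRne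
    obtain ⟨hyS, hym, hyA⟩ := hRm y hyR
    have hL2 : Lower r S (insert y (insert m A)) := by
      refine hL.insert_min hyS ?_
      intro q hq hqy
      exact hymin q hq hqy
    have hyi : y ∉ insert m A := by simp [hym, hyA]
    have hyb : ¬ red y := by
      intro h
      have := hnQ _ hL2 (by
        rw [Finset.card_insert_of_notMem hyi, Finset.card_insert_of_notMem hm.2]; omega)
      rw [w_insert hyi, wt_red h] at this
      omega
    have hry : r ≠ y := fun h => hrS (h ▸ hyS)
    have hsepy : Sep R {r, y} := by
      refine Sep.symm ⟨r, y, hry, ?_, ?_⟩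
      · intro p hp
        simp only [Finset.mem_insert, Finset.mem_singleton] at hp
        rcases hp with rfl | rfl
        · rw [D_self]
        · rw [D_self']
      · intro p hp
        by_cases h : p = y
        · subst h; rw [D_self']
        · exact (hymin p hp h).le
    obtain ⟨E2, h21, h22, h23, h24, h25⟩ := hang hΩ hk ih (Λ := R) (s := r) (y := y)
      ((Finset.card_le_card hRS).trans hc) hr hyR hyb (fun h => hrS (hRS h))
      (hsubT _ hRS) hR0 hsepy
    have hX : X (E1 ∪ {(r, m)}) (E2 ∪ {(r, y)}) := by
      refine X_of_Sep hΩ h12 h22 (hsubT _ hmA) (hsubT _ hRS) ⟨r, m, hrm, ?_, ?_⟩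
      · intro p hp
        simp only [Finset.mem_insert] at hp
        rcases hp with rfl | rfl | h
        · rw [D_self]
        · rw [D_self']
        · exact (hnegA p h).le
      · intro p hp
        rcases Finset.mem_insert.1 hp with rfl | h
        · rw [D_self]
        · exact (hposR p h).le
    obtain ⟨t1, t2, t3, t4⟩ := joinRed (k := k) hr h12 h22 hX (by simp) (by simp) (by
      intro x hx hx2
      rcases Finset.mem_insert.1 hx with rfl | h
      · rfl
      · rcases Finset.mem_insert.1 hx2 with rfl | h'
        · rfl
        · exact absurd h (Finset.mem_sdiff.1 h').2) h13 h23 h14 h24 (by omega)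
    refine ⟨_, ?_, t2, t3, by omega⟩
    have : insert r (insert m A) ∪ insert r R = insert r S := by
      rw [← hunion]; ext x; simp only [Finset.mem_union, Finset.mem_insert]; tauto
    rw [← this]; exact t1
  · -- both sides at `m`
    have hRpos : 1 ≤ w red k R := by omega
    obtain ⟨E1, h1⟩ := ih A m hcA hm.2 hmb (hsubT' _ hmA) (by
      refine ⟨m, r, hrm.symm, by rw [D_self], ?_⟩
      intro p hp
      rw [D_swap]; linarith [hnegA p hp]) (by omega)
    have hmnR : m ∉ R := fun h => (hRm m h).2.1 rfl
    obtain ⟨E2, h2⟩ := ih R m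
      (lt_of_lt_of_le (Finset.card_lt_card ⟨hRS, fun h => hmnR (h hm.1)⟩) hc) hmnR hmb
      (hsubT' _ hmR) ⟨r, m, hrm, by rw [D_self'], fun p hp => (hposR p hp).le⟩ hRpos
    have J := jn (v := m) h1.tree h2.tree
      (X_of_Sep hΩ h1.tree h2.tree (hsubT' _ hmA) (hsubT' _ hmR) hsepAR) (by simp) (by simp) (by
      intro x hx hx2
      rcases Finset.mem_insert.1 hx with rfl | h
      · rfl
      · rcases Finset.mem_insert.1 hx2 with rfl | h'
        · rfl
        · exact absurd h (hRm x h').2.2)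
    have hU : insert m A ∪ insert m R = S := by
      rw [← hunion]; ext x; simp only [Finset.mem_union, Finset.mem_insert]; tauto
    have hTJ := J.tree
    rw [hU] at hTJ
    have J2 := jn (v := m) hTJ hT2 (X.union_left
      (X_of_Sep hΩ h1.tree hT2 (hsubT' _ hmA) hsubrm hsepA)
      (X_of_Sep hΩ hT2 h2.tree hsubrm (hsubT' _ hmR) hsepR).symm) hm.1 (by simp) (by
      intro x hx hx2
      simp only [Finset.mem_insert, Finset.mem_singleton] at hx2
      rcases hx2 with rfl | rfl
      · exact absurd hx hrS
      · rfl)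
    refine ⟨E1 ∪ E2 ∪ {(r, m)}, ?_, ?_, ?_, ?_⟩
    · have : S ∪ {r, m} = insert r S := by
        ext x; simp only [Finset.mem_union, Finset.mem_insert, Finset.mem_singleton]
        constructor
        · rintro (h | h | rfl)
          · exact Or.inr h
          · exact Or.inl h
          · exact Or.inr hm.1
        · tauto
      rw [← this]; exact J2.tree
    · intro q hq
      by_cases hqm : q = m
      · subst hqm
        have a1 := bd_union (E1 ∪ E2) {(r, q)} q
        have a2 := bd_union E1 E2 q
        have a3 := bd_single_le r q q
        have a4 := h1.root
        have a5 := h2.root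
        omega
      · exact J2.bmax q hqm _ (J.bmax q hqm _ (h1.blue q hq hqm) (h2.blue q hq hqm))
          ((bd_single_le r m q).trans (by omega))
    · intro q hq
      have hqm : q ≠ m := fun h => hmb (h ▸ hq)
      exact J2.rmax q hqm _ (J.rmax q hqm _ (h1.reds q hq) (h2.reds q hq))
        ((rd_single_le r m q).trans (by omega))
    · have a1 := rd_union (E1 ∪ E2) {(r, m)} r
      have a2 := hTJ.rd_zero hrS
      have a3 := rd_single_le r m r
      omega

/-- `r` is visible: a line through `r` weakly separates `S` from `b`. -/
def Vis (S : Finset Pt) (b r : Pt) : Prop :=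
  ∃ a c : Pt, a ≠ c ∧ D a c r = 0 ∧ (∀ p ∈ S, 0 ≤ D a c p) ∧ D a c b ≤ 0

lemma vis_sol (hΩ : GP Ω) (hk : 1 ≤ k) {n : ℕ} (ih : IH red k Ω n) {S : Finset Pt} {b r : Pt}
    (hc : S.card ≤ n) (hbS : b ∉ S) (hb : ¬ red b) (hS : (↑(insert b S) : Set Pt) ⊆ Ω)
    (hw : w red k S = 1) (hrS : r ∈ S) (hr : red r) (hV : Vis S b r) :
    ∃ E, Sol red k S b E := by
  obtain ⟨a, c, hac, h0, h1, h2⟩ := hV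
  have hins : insert r (S.erase r) = S := Finset.insert_erase hrS
  have hSΩ : (↑S : Set Pt) ⊆ Ω := Set.Subset.trans (by simp) hS
  have hbΩ : b ∈ Ω := hS (by simp)
  obtain ⟨E, hT, hbl, hre, hr2⟩ := P2 hΩ hk ih (S := S.erase r) (r := r)
    ((Finset.card_erase_le).trans hc) (by simp) hr (by rw [hins]; exact hSΩ)
    ⟨a, c, hac, h0, fun p hp => h1 p (Finset.mem_of_mem_erase hp)⟩
    (by rw [w_erase hrS, wt_red hr]; omega)
  rw [hins] at hT
  have hT2 := Tree.single (red := red) hr hb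
  have hsep : Sep {r, b} S := by
    refine ⟨a, c, hac, ?_, h1⟩
    intro p hp
    simp only [Finset.mem_insert, Finset.mem_singleton] at hp
    rcases hp with rfl | rfl
    · exact h0.le
    · exact h2
  have hsub2 : (↑({r, b} : Finset Pt) : Set Pt) ⊆ Ω := by
    intro x hx
    simp at hx
    rcases hx with rfl | rfl
    · exact hSΩ hrS
    · exact hbΩ
  have hX := (X_of_Sep hΩ hT2 hT hsub2 hSΩ hsep).symm
  obtain ⟨t1, t2, t3, t4⟩ := joinRed (k := k) hr hT hT2 hX hrS (by simp) (by
      intro x hx hx2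
      simp only [Finset.mem_insert, Finset.mem_singleton] at hx2
      rcases hx2 with rfl | rfl
      · rfl
      · exact absurd hx hbS) hbl
      (fun q _ => (bd_single_le r b q).trans (by omega)) hre
      (fun q _ => (rd_single_le r b q).trans (by omega))
      (by have := rd_single_le r b r; omega)
  refine ⟨_, ?_, fun q hq _ => t2 q hq, ?_, t3⟩
  · have : S ∪ {r, b} = insert b S := by
      ext x; simp only [Finset.mem_union, Finset.mem_insert, Finset.mem_singleton]
      constructor
      · rintro (h | rfl | h)
        · exact Or.inr h
        · exact Or.inr hrS
        · exact Or.inl h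
      · tauto
    rw [← this]; exact t1
  · have a1 := bd_union E {(r, b)} b
    have a2 := hT.bd_zero hbS
    have a3 := bd_single_le r b b
    omega

/-- Final assembly at a red point `s` of degree three. -/
lemma fin_sol (hΩ : GP Ω) (hk : 1 ≤ k) {n : ℕ} (ih : IH red k Ω n) {S A C : Finset Pt}
    {b s x y : Pt}
    (hc : S.card ≤ n) (hbS : b ∉ S) (hb : ¬ red b) (hS : (↑(insert b S) : Set Pt) ⊆ Ω)
    (hs : red s) (hsA : s ∉ A) (hsC : s ∉ C) (hAC : ∀ p ∈ A, p ∉ C)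
    (hU : insert s (A ∪ C) = S) (hwA : w red k A = 0) (hwC : w red k C = 0)
    (hwS : w red k S = 1)
    (hx : x ∈ A) (hxb : ¬ red x) (hy : y ∈ C) (hyb : ¬ red y)
    (s1 : Sep A C) (s2 : Sep A {s, x}) (s3 : Sep A {s, y}) (s4 : Sep A {s, b})
    (s5 : Sep C {s, x}) (s6 : Sep C {s, y}) (s7 : Sep C {s, b}) :
    ∃ E, Sol red k S b E := by
  have hAS : A ⊆ S := by rw [← hU]; intro p hp; simp [hp]
  have hCS : C ⊆ S := by rw [← hU]; intro p hp; simp [hp]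
  have hsS : s ∈ S := by rw [← hU]; simp
  have hSΩ : (↑S : Set Pt) ⊆ Ω := Set.Subset.trans (by simp) hS
  have hbΩ : b ∈ Ω := hS (by simp)
  have hAΩ : (↑A : Set Pt) ⊆ Ω := (Finset.coe_subset.2 hAS).trans hSΩ
  have hCΩ : (↑C : Set Pt) ⊆ Ω := (Finset.coe_subset.2 hCS).trans hSΩ
  have hpair : ∀ z ∈ Ω, (↑({s, z} : Finset Pt) : Set Pt) ⊆ Ω := by
    intro z hz t ht
    simp at ht
    rcases ht with rfl | rfl
    · exact hSΩ hsS
    · exact hz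
  have hsAΩ : (↑(insert s A) : Set Pt) ⊆ Ω :=
    (Finset.coe_subset.2 (Finset.insert_subset hsS hAS)).trans hSΩ
  have hsCΩ : (↑(insert s C) : Set Pt) ⊆ Ω :=
    (Finset.coe_subset.2 (Finset.insert_subset hsS hCS)).trans hSΩ
  have hsx : s ≠ x := fun h => hsA (h ▸ hx)
  have hsy : s ≠ y := fun h => hsC (h ▸ hy)
  have hsb : s ≠ b := fun h => hbS (h ▸ hsS)
  obtain ⟨E1, h11, h12, h13, h14, h15⟩ := hang hΩ hk ih
    ((Finset.card_le_card hAS).trans hc) hs hx hxb hsA hsAΩ hwA s2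
  obtain ⟨E2, h21, h22, h23, h24, h25⟩ := hang hΩ hk ih
    ((Finset.card_le_card hCS).trans hc) hs hy hyb hsC hsCΩ hwC s6
  have Tx := Tree.single (red := red) hs hxb
  have Ty := Tree.single (red := red) hs hyb
  have Tb := Tree.single (red := red) hs hb
  have px := hpair x (hAΩ hx)
  have py := hpair y (hCΩ hy)
  have pb := hpair b hbΩ
  have X1 : X (E1 ∪ {(s, x)}) (E2 ∪ {(s, y)}) := by
    refine X.union_left (X.union_right ?_ ?_) (X.union_right ?_ ?_)
    · exact X_of_Sep hΩ h11 h21 hAΩ hCΩ s1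
    · exact X_of_Sep hΩ h11 Ty hAΩ py s3
    · exact (X_of_Sep hΩ h21 Tx hCΩ px s5).symm
    · exact X_of_Sep hΩ Tx Ty px py (Sep_share hsx)
  obtain ⟨t1, t2, t3, t4⟩ := joinRed (k := k) hs h12 h22 X1 (by simp) (by simp) (by
      intro x hx hx2
      rcases Finset.mem_insert.1 hx with rfl | h
      · rfl
      · rcases Finset.mem_insert.1 hx2 with rfl | h'
        · rfl
        · exact absurd h' (hAC x h)) h13 h23 h14 h24 (by omega)
  have hU2 : insert s A ∪ insert s C = S := by
    rw [← hU]; ext x; simp only [Finset.mem_union, Finset.mem_insert]; tauto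
  rw [hU2] at t1
  have X2 : X (E1 ∪ {(s, x)} ∪ (E2 ∪ {(s, y)})) {(s, b)} := by
    refine X.union_left (X.union_left ?_ ?_) (X.union_left ?_ ?_)
    · exact X_of_Sep hΩ h11 Tb hAΩ pb s4
    · exact X_of_Sep hΩ Tx Tb px pb (Sep_share hsx)
    · exact X_of_Sep hΩ h21 Tb hCΩ pb s7
    · exact X_of_Sep hΩ Ty Tb py pb (Sep_share hsy)
  obtain ⟨u1, u2, u3, u4⟩ := joinRed (k := k) hs t1 Tb X2 hsS (by simp) (by
      intro x hx hx2
      simp only [Finset.mem_insert, Finset.mem_singleton] at hx2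
      rcases hx2 with rfl | rfl
      · rfl
      · exact absurd hx hbS) t2
      (fun q _ => (bd_single_le s b q).trans (by omega)) t3
      (fun q _ => (rd_single_le s b q).trans (by omega))
      (by have := rd_single_le s b s; omega)
  refine ⟨_, ?_, fun q hq _ => u2 q hq, ?_, u3⟩
  · have : S ∪ {s, b} = insert b S := by
      ext x; simp only [Finset.mem_union, Finset.mem_insert, Finset.mem_singleton]
      constructor
      · rintro (h | rfl | h)
        · exact Or.inr h
        · exact Or.inr hsS
        · exact Or.inl h
      · tauto
    rw [← this]; exact u1
  · have a1 := bd_union (E1 ∪ {(s, x)} ∪ (E2 ∪ {(s, y)})) {(s, b)} b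
    have a2 := t1.bd_zero hbS
    have a3 := bd_single_le s b b
    omega

/-- Signed orientation. -/
def T (σ : ℝ) (a b c : Pt) : ℝ := σ * D a b c

lemma T_neg (σ : ℝ) (a b c : Pt) : T (-σ) a b c = - T σ a b c := by unfold T; ring
/-- Cyclic rotations. -/
lemma T_c (σ : ℝ) (a b c : Pt) : T σ a b c = T σ b c a := by unfold T D; ring
lemma T_c2 (σ : ℝ) (a b c : Pt) : T σ a b c = T σ c a b := by unfold T D; ring
/-- Transpositions. -/
lemma T_12 (σ : ℝ) (a b c : Pt) : T σ a b c = - T σ b a c := by unfold T D; ring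
lemma T_23 (σ : ℝ) (a b c : Pt) : T σ a b c = - T σ a c b := by unfold T D; ring
lemma T_13 (σ : ℝ) (a b c : Pt) : T σ a b c = - T σ c b a := by unfold T D; ring
lemma T_aab (σ : ℝ) (a b : Pt) : T σ a a b = 0 := by unfold T D; ring
lemma T_aba (σ : ℝ) (a b : Pt) : T σ a b a = 0 := by unfold T D; ring
lemma T_abb (σ : ℝ) (a b : Pt) : T σ a b b = 0 := by unfold T D; ring
/-- Grassmann-Plücker relation. -/
lemma T_pl (σ : ℝ) (o p q r s : Pt) :
    T σ o p q * T σ o r s = T σ o p r * T σ o q s - T σ o p s * T σ o q r := by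
  unfold T D; ring

lemma Sep_T {σ : ℝ} (hσ : σ = 1 ∨ σ = -1) {A C : Finset Pt} {a c : Pt} (hac : a ≠ c)
    (h1 : ∀ p ∈ A, T σ a c p ≤ 0) (h2 : ∀ p ∈ C, 0 ≤ T σ a c p) : Sep A C := by
  rcases hσ with rfl | rfl
  · exact ⟨a, c, hac, fun p hp => by simpa [T] using h1 p hp, fun p hp => by simpa [T] using h2 p hp⟩
  · refine Sep.symm ⟨a, c, hac, fun p hp => ?_, fun p hp => ?_⟩
    · have := h2 p hp
      unfold T at this; linarith
    · have := h1 p hp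
      unfold T at this; linarith

/-- The configuration of the weight-one case. -/
structure Cfg (red : Pt → Prop) (k : ℕ) (Ω : Set Pt) (σ : ℝ) (S L P : Finset Pt) (b ρ : Pt) :
    Prop where
  sg : σ = 1 ∨ σ = -1
  hU : insert ρ (L ∪ P) = S
  ρL : ρ ∉ L
  ρP : ρ ∉ P
  LP : ∀ p ∈ L, p ∉ P
  lρ : ∀ p ∈ L, 0 < T σ b p ρ
  ρq : ∀ q ∈ P, 0 < T σ b ρ q
  lq : ∀ p ∈ L, ∀ q ∈ P, 0 < T σ b p q
  tot : ∀ p ∈ S, ∀ q ∈ S, p ≠ q → 0 < T σ b p q ∨ 0 < T σ b q p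
  tr : ∀ p ∈ S, ∀ q ∈ S, ∀ t ∈ S, 0 < T σ b p q → 0 < T σ b q t → 0 < T σ b p t
  hbS : b ∉ S
  hb : ¬ red b
  hS : (↑(insert b S) : Set Pt) ⊆ Ω
  wL : w red k L = 0
  wP : w red k P = 0
  wS : w red k S = 1
  ρr : red ρ

lemma Cfg.mirror {σ : ℝ} {S L P : Finset Pt} {b ρ : Pt} (h : Cfg red k Ω σ S L P b ρ) :
    Cfg red k Ω (-σ) S P L b ρ where
  sg := by rcases h.sg with h | h <;> simp [h]
  hU := by rw [Finset.union_comm]; exact h.hU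
  ρL := h.ρP
  ρP := h.ρL
  LP := fun p hp hq => h.LP p hq hp
  lρ := fun p hp => by rw [T_neg, ← T_23]; exact h.ρq p hp
  ρq := fun p hp => by rw [T_neg, ← T_23]; exact h.lρ p hp
  lq := fun p hp q hq => by rw [T_neg, ← T_23]; exact h.lq q hq p hp
  tot := fun p hp q hq hpq => by
    rw [T_neg, T_neg, ← T_23, ← T_23]; exact h.tot q hq p hp hpq.symm
  tr := fun p hp q hq t ht h1 h2 => by
    rw [T_neg, ← T_23] at *
    exact h.tr t ht q hq p hp h2 h1
  hbS := h.hbS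
  hb := h.hb
  hS := h.hS
  wL := h.wP
  wP := h.wL
  wS := h.wS
  ρr := h.ρr

section
variable {σ : ℝ} {S L P : Finset Pt} {b ρ : Pt}

lemma Cfg.ρS (h : Cfg red k Ω σ S L P b ρ) : ρ ∈ S := by rw [← h.hU]; simp
lemma Cfg.LS (h : Cfg red k Ω σ S L P b ρ) {p : Pt} (hp : p ∈ L) : p ∈ S := by
  rw [← h.hU]; simp [hp]
lemma Cfg.PS (h : Cfg red k Ω σ S L P b ρ) {p : Pt} (hp : p ∈ P) : p ∈ S := by
  rw [← h.hU]; simp [hp]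
lemma Cfg.KLS (h : Cfg red k Ω σ S L P b ρ) {p : Pt} (hp : p ∈ insert ρ L) : p ∈ S := by
  rcases Finset.mem_insert.1 hp with rfl | h'
  · exact h.ρS
  · exact h.LS h'
lemma Cfg.KPS (h : Cfg red k Ω σ S L P b ρ) {p : Pt} (hp : p ∈ insert ρ P) : p ∈ S :=
  h.mirror.KLS hp
lemma Cfg.neb (h : Cfg red k Ω σ S L P b ρ) {p : Pt} (hp : p ∈ S) : b ≠ p :=
  fun e => h.hbS (e ▸ hp)
lemma Cfg.mΩ (h : Cfg red k Ω σ S L P b ρ) {p : Pt} (hp : p ∈ S) : p ∈ Ω := h.hS (by simp [hp])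
lemma Cfg.nz (hΩ : GP Ω) (h : Cfg red k Ω σ S L P b ρ) {p q r : Pt} (hp : p ∈ S) (hq : q ∈ S)
    (hr : r ∈ S) (h1 : p ≠ q) (h2 : p ≠ r) (h3 : q ≠ r) : T σ p q r ≠ 0 := by
  have := hΩ p (h.mΩ hp) q (h.mΩ hq) r (h.mΩ hr) h1 h2 h3
  unfold T
  rcases h.sg with e | e <;> simp [e, this]
/-- A point of `L ∪ {ρ}` is not after `ρ`. -/
lemma Cfg.KLρ (h : Cfg red k Ω σ S L P b ρ) {p : Pt} (hp : p ∈ insert ρ L) : T σ b ρ p ≤ 0 := by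
  rcases Finset.mem_insert.1 hp with rfl | h'
  · rw [T_abb]
  · rw [T_23]; linarith [h.lρ p h']
lemma Cfg.KPρ (h : Cfg red k Ω σ S L P b ρ) {p : Pt} (hp : p ∈ insert ρ P) : 0 ≤ T σ b ρ p := by
  rcases Finset.mem_insert.1 hp with rfl | h'
  · rw [T_abb]
  · exact (h.ρq p h').le

/-- A valid pair of blue points. -/
structure Valid (red : Pt → Prop) (σ : ℝ) (L P : Finset Pt) (b ρ x y : Pt) : Prop where
  xL : x ∈ L
  yP : y ∈ P
  xb : ¬ red x
  yb : ¬ red y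
  V1 : ∀ p ∈ insert ρ L, 0 < T σ b x p → T σ x y p < 0
  V2 : ∀ p ∈ insert ρ P, 0 < T σ b p y → T σ x y p < 0
  V3 : ∀ p ∈ insert ρ L, ∀ p' ∈ insert ρ L, 0 < T σ b p x → 0 < T σ b x p' → T σ p x p' < 0
  V4 : ∀ p ∈ insert ρ P, ∀ p' ∈ insert ρ P, 0 < T σ b p y → 0 < T σ b y p' → T σ p y p' < 0

lemma Valid.mirror {x y : Pt} (h : Valid red σ L P b ρ x y) : Valid red (-σ) P L b ρ y x where
  xL := h.yP
  yP := h.xL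
  xb := h.yb
  yb := h.xb
  V1 := fun p hp h1 => by
    rw [T_neg, ← T_23] at h1
    rw [T_neg, ← T_12]; exact h.V2 p hp h1
  V2 := fun p hp h1 => by
    rw [T_neg, ← T_23] at h1
    rw [T_neg, ← T_12]; exact h.V1 p hp h1
  V3 := fun p hp p' hp' h1 h2 => by
    rw [T_neg, ← T_23] at h1 h2
    rw [T_neg, ← T_13]; exact h.V4 p' hp' p hp h2 h1
  V4 := fun p hp p' hp' h1 h2 => by
    rw [T_neg, ← T_23] at h1 h2
    rw [T_neg, ← T_13]; exact h.V3 p' hp' p hp h2 h1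

/-- The extremal point `u` seen from `x`. -/
structure ExtU (σ : ℝ) (L : Finset Pt) (b ρ x u : Pt) : Prop where
  uK : u ∈ insert ρ L
  aft : 0 < T σ b x u
  ext : ∀ p ∈ insert ρ L, 0 ≤ T σ x p u

lemma exU (h : Cfg red k Ω σ S L P b ρ) {x y : Pt} (hV : Valid red σ L P b ρ x y) :
    ∃ u, ExtU σ L b ρ x u := by
  obtain ⟨u, hu, hmin⟩ := Finset.exists_min_image
    ((insert ρ L).filter (fun p => 0 < T σ b x p)) (fun p => (- T σ x y p) / T σ b x p)
    ⟨ρ, by simp [h.lρ x hV.xL]⟩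
  simp only [Finset.mem_filter] at hu hmin
  refine ⟨u, hu.1, hu.2, ?_⟩
  intro p hp
  by_cases hpx : p = x
  · subst hpx; rw [T_aab]
  rcases h.tot p (h.KLS hp) x (h.LS hV.xL) hpx with h1 | h1
  · have := hV.V3 p hp u hu.1 h1 hu.2
    rw [T_12]; linarith
  · have h2 := hmin p ⟨hp, h1⟩
    rw [div_le_div_iff₀ hu.2 h1] at h2
    have h3 := T_pl σ x p u y b
    have h4 : 0 < T σ x y b := by rw [T_c2]; exact h.lq x hV.xL y hV.yP
    rw [T_23 σ x p y, T_23 σ x u y, T_c2 σ x p b, T_c2 σ x u b] at h3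
    by_contra hcon
    have := mul_neg_of_neg_of_pos (not_le.1 hcon) h4
    linarith

/-- The key inequality. -/
lemma keyT {x y u v : Pt} (hv : T σ x y v < 0) (hb : 0 < T σ x y b) (huv : 0 < T σ b u v)
    (h : T σ x y v ≤ T σ x y u) (hvy : 0 < T σ b v y) : 0 < T σ v y u := by
  have id : (- T σ x y v + T σ x y b) * T σ v y u
      = - T σ x y v * T σ b u v + (T σ x y u - T σ x y v) * T σ b v y := by
    unfold T D; ring
  have h1 : 0 < - T σ x y v * T σ b u v := mul_pos (by linarith) huv
  have h2 : 0 ≤ (T σ x y u - T σ x y v) * T σ b v y := mul_nonneg (by linarith) hvy.le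
  by_contra hcon
  have := mul_nonpos_of_nonneg_of_nonpos (show 0 ≤ - T σ x y v + T σ x y b by linarith)
    (not_lt.1 hcon)
  linarith

/-- Termination measure. -/
def meas (σ : ℝ) (L P : Finset Pt) (b x y : Pt) : ℕ :=
  (L.filter (fun p => 0 < T σ b x p)).card + (P.filter (fun p => 0 < T σ b p y)).card

lemma meas_mirror (σ : ℝ) (L P : Finset Pt) (b x y : Pt) :
    meas (-σ) P L b y x = meas σ L P b x y := by
  unfold meas
  rw [add_comm]
  simp only [T_neg, ← T_23]

lemma stepL (hΩ : GP Ω) (hk : 1 ≤ k) {n : ℕ} (ih : IH red k Ω n) (hn : S.card ≤ n)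
    (h : Cfg red k Ω σ S L P b ρ) {x y u v : Pt} (hV : Valid red σ L P b ρ x y)
    (hu : ExtU σ L b ρ x u) (hv : ExtU (-σ) P b ρ y v) (huL : u ∈ L)
    (huv : T σ x y v ≤ T σ x y u) :
    (∃ E, Sol red k S b E) ∨
    ∃ x' y', Valid red σ L P b ρ x' y' ∧ meas σ L P b x' y' < meas σ L P b x y := by
  have hxS := h.LS hV.xL
  have hyS := h.PS hV.yP
  have huS := h.LS huL
  have hvb : 0 < T σ b v y := by have := hv.aft; rwa [T_neg, ← T_23] at this
  have hvext : ∀ p ∈ insert ρ P, T σ v y p ≤ 0 := by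
    intro p hp
    have := hv.ext p hp
    rw [T_neg] at this
    rw [T_c]; linarith
  have huext : ∀ p ∈ insert ρ L, T σ x u p ≤ 0 := by
    intro p hp
    have := hu.ext p hp
    rw [T_23]; linarith
  have hbuv : 0 < T σ b u v := by
    rcases Finset.mem_insert.1 hv.uK with rfl | h'
    · exact h.lρ u huL
    · exact h.lq u huL v h'
  have hxyb : 0 < T σ x y b := by rw [T_c2]; exact h.lq x hV.xL y hV.yP
  have hvneg := hV.V2 v hv.uK hvb
  have huneg := hV.V1 u hu.uK hu.aft
  have hvyu : 0 < T σ v y u := keyT hvneg hxyb hbuv huv hvb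
  have hxuy : 0 < T σ x u y := by rw [T_23]; linarith
  have hxub : 0 < T σ x u b := by rw [T_c2]; exact hu.aft
  have hbuy : 0 < T σ b u y := h.lq u huL y hV.yP
  have hxu : x ≠ u := by rintro rfl; rw [T_aab] at hxub; exact lt_irrefl _ hxub
  have hvy : v ≠ y := by rintro rfl; rw [T_abb] at hvb; exact lt_irrefl _ hvb
  have hbρ : b ≠ ρ := h.neb h.ρS
  have hyu : y ≠ u := by rintro rfl; exact h.LP _ huL hV.yP
  by_cases hur : red u
  · left
    have huρ : u ≠ ρ := by rintro rfl; exact h.ρL huL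
    have hA : ∀ p ∈ insert ρ (L.erase u), p ∈ insert ρ L := by
      intro p hp
      simp only [Finset.mem_insert, Finset.mem_erase] at hp ⊢
      tauto
    have hKu : u ∈ insert ρ L := by simp [huL]
    have hKx : x ∈ insert ρ L := by simp [hV.xL]
    have hKP : ∀ p ∈ P, p ∈ insert ρ P := fun p hp => by simp [hp]
    have hρe : ρ ∉ L.erase u := fun hh => h.ρL (Finset.mem_of_mem_erase hh)
    refine fin_sol hΩ hk ih (A := insert ρ (L.erase u)) (C := P) (s := u) (x := x) (y := y) hn
      h.hbS h.hb h.hS hur (by simp [huρ]) (h.LP u huL) ?_ ?_ ?_ h.wP h.wS ?_ hV.xb hV.yP hV.yb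
      ?_ ?_ ?_ ?_ ?_ ?_ ?_
    · intro p hp
      rcases Finset.mem_insert.1 hp with rfl | h'
      · exact h.ρP
      · exact h.LP p (Finset.mem_of_mem_erase h')
    · rw [← h.hU]
      ext p
      simp only [Finset.mem_insert, Finset.mem_union, Finset.mem_erase]
      constructor
      · rintro (rfl | (h1 | h1) | h1)
        · exact Or.inr (Or.inl huL)
        · exact Or.inl h1
        · exact Or.inr (Or.inl h1.2)
        · exact Or.inr (Or.inr h1)
      · tauto
    · rw [w_insert hρe, w_erase huL, wt_red h.ρr, wt_red hur, h.wL]; rfl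
    · simp [hxu, hV.xL]
    · exact Sep_T h.sg hbρ (fun p hp => h.KLρ (hA p hp)) (fun p hp => h.KPρ (hKP p hp))
    · refine Sep_T h.sg hxu (fun p hp => huext p (hA p hp)) ?_
      intro p hp
      simp only [Finset.mem_insert, Finset.mem_singleton] at hp
      rcases hp with rfl | rfl
      · rw [T_abb]
      · rw [T_aba]
    · refine Sep_T h.sg hxu (fun p hp => huext p (hA p hp)) ?_
      intro p hp
      simp only [Finset.mem_insert, Finset.mem_singleton] at hp
      rcases hp with rfl | rfl
      · rw [T_abb]
      · exact hxuy.le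
    · refine Sep_T h.sg hxu (fun p hp => huext p (hA p hp)) ?_
      intro p hp
      simp only [Finset.mem_insert, Finset.mem_singleton] at hp
      rcases hp with rfl | rfl
      · rw [T_abb]
      · exact hxub.le
    · refine Sep.symm (Sep_T h.sg hbρ ?_ (fun p hp => h.KPρ (hKP p hp)))
      intro p hp
      simp only [Finset.mem_insert, Finset.mem_singleton] at hp
      rcases hp with rfl | rfl
      · exact h.KLρ hKu
      · exact h.KLρ hKx
    · refine Sep_T h.sg hvy (fun p hp => hvext p (hKP p hp)) ?_
      intro p hp
      simp only [Finset.mem_insert, Finset.mem_singleton] at hp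
      rcases hp with rfl | rfl
      · exact hvyu.le
      · rw [T_abb]
    · refine Sep.symm (Sep_T h.sg hbρ ?_ (fun p hp => h.KPρ (hKP p hp)))
      intro p hp
      simp only [Finset.mem_insert, Finset.mem_singleton] at hp
      rcases hp with rfl | rfl
      · exact h.KLρ hKu
      · rw [T_aba]
  · right
    refine ⟨u, y, ⟨huL, hV.yP, hur, hV.yb, ?_, ?_, ?_, hV.V4⟩, ?_⟩
    · intro p hp hup
      have e := T_pl σ u y p b x
      have a1 : 0 < T σ u b x := by rw [T_c2]; exact hxub
      have a2 : 0 < T σ u y b := by rw [T_c2]; exact hbuy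
      have a3 : T σ u p x ≤ 0 := by rw [T_c2]; exact huext p hp
      have a4 : 0 < T σ u y x := by rw [T_c2]; exact hxuy
      have a5 : 0 < T σ u p b := by rw [T_c2]; exact hup
      by_contra hcon
      have m1 := mul_nonneg (not_lt.1 hcon) a1.le
      have m2 := mul_nonpos_of_nonneg_of_nonpos a2.le a3
      have m3 := mul_pos a4 a5
      linarith
    · intro p hp hpy
      have e := T_pl σ y p u b v
      have a1 : 0 < T σ y b v := by rw [T_c]; exact hvb
      have a2 : T σ y p b < 0 := by rw [T_13, T_12]; rw [T_12, T_13, T_23] at hpy; linarith [T_12 σ b p y, T_13 σ y p b, hpy]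
      have a3 : 0 < T σ y u v := by rw [T_c2]; exact hvyu
      have a4 : T σ y p v ≤ 0 := by rw [T_c2]; exact hvext p hp
      have a5 : T σ y u b < 0 := by rw [T_13]; linarith
      by_contra hcon
      have hcon' : 0 ≤ T σ y p u := by rw [T_c2]; exact not_lt.1 hcon
      have m1 := mul_nonneg hcon' a1.le
      have m2 := mul_neg_of_neg_of_pos a2 a3
      have m3 := mul_nonneg_of_nonpos_of_nonpos a4 a5.le
      linarith
    · intro p hp p' hp' h1 h2
      have e := T_pl σ u p' p b x
      have a1 : 0 < T σ u b x := by rw [T_c2]; exact hxub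
      have a2 : 0 < T σ u p' b := by rw [T_c2]; exact h2
      have a3 : T σ u p x ≤ 0 := by rw [T_c2]; exact huext p hp
      have a4 : T σ u p' x ≤ 0 := by rw [T_c2]; exact huext p' hp'
      have a5 : T σ u p b < 0 := by rw [T_13]; linarith
      have hpu : p ≠ u := by rintro rfl; rw [T_abb] at h1; exact lt_irrefl _ h1
      have hpu' : u ≠ p' := by rintro rfl; rw [T_abb] at h2; exact lt_irrefl _ h2
      have hpp : p ≠ p' := by
        rintro rfl
        rw [T_23] at h2; linarith
      have hnz := h.nz hΩ (h.KLS hp) huS (h.KLS hp') hpu hpp hpu'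
      refine lt_of_le_of_ne ?_ hnz
      by_contra hcon
      have hcon' : 0 < T σ u p' p := by rw [T_c2]; exact not_le.1 hcon
      have m1 := mul_pos hcon' a1
      have m2 := mul_nonpos_of_nonneg_of_nonpos a2.le a3
      have m3 := mul_nonneg_of_nonpos_of_nonpos a4 a5.le
      linarith
    · unfold meas
      apply Nat.add_lt_add_right
      apply Finset.card_lt_card
      refine ⟨?_, ?_⟩
      · intro p hp
        simp only [Finset.mem_filter] at hp ⊢
        exact ⟨hp.1, h.tr x hxS u huS p (h.LS hp.1) hu.aft hp.2⟩
      · intro hsub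
        have := hsub (show u ∈ L.filter (fun p => 0 < T σ b x p) by simp [huL, hu.aft])
        simp only [Finset.mem_filter] at this
        rw [T_abb] at this
        exact lt_irrefl _ this.2

/-- If `v` is extremal and `u = ρ`, then `v` cannot be higher than `ρ`. -/
lemma contraR (h : Cfg red k Ω σ S L P b ρ) {x y v : Pt} (hV : Valid red σ L P b ρ x y)
    (hv : ExtU (-σ) P b ρ y v) (hvρ : v ≠ ρ) (hlt : T σ x y v ≤ T σ x y ρ) : False := by
  have hvb : 0 < T σ b v y := by have := hv.aft; rwa [T_neg, ← T_23] at this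
  have hxyb : 0 < T σ x y b := by rw [T_c2]; exact h.lq x hV.xL y hV.yP
  have hvP : v ∈ P := by
    rcases Finset.mem_insert.1 hv.uK with h' | h'
    · exact absurd h' hvρ
    · exact h'
  have := keyT (hV.V2 v hv.uK hvb) hxyb (h.ρq v hvP) hlt hvb
  have h2 := hv.ext ρ (by simp)
  rw [T_neg, ← T_12, T_c2] at h2
  rw [T_23] at this
  have e : T σ v y ρ = T σ y ρ v := T_c σ v y ρ
  have e2 := T_23 σ v ρ y
  linarith

lemma finρ (hΩ : GP Ω) (hk : 1 ≤ k) {n : ℕ} (ih : IH red k Ω n) (hn : S.card ≤ n)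
    (h : Cfg red k Ω σ S L P b ρ) {x y : Pt} (hV : Valid red σ L P b ρ x y)
    (hu : ExtU σ L b ρ x ρ) (hv : ExtU (-σ) P b ρ y ρ) : ∃ E, Sol red k S b E := by
  have hbρ : b ≠ ρ := h.neb h.ρS
  have hKL : ∀ p ∈ L, p ∈ insert ρ L := fun p hp => by simp [hp]
  have hKP : ∀ p ∈ P, p ∈ insert ρ P := fun p hp => by simp [hp]
  have hxρ : x ≠ ρ := by rintro rfl; exact h.ρL hV.xL
  have hyρ : y ≠ ρ := by rintro rfl; exact h.ρP hV.yP
  have hL0 : ∀ p ∈ L, T σ b ρ p ≤ 0 := fun p hp => h.KLρ (hKL p hp)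
  have hP0 : ∀ p ∈ P, 0 ≤ T σ b ρ p := fun p hp => h.KPρ (hKP p hp)
  refine fin_sol hΩ hk ih (A := L) (C := P) (s := ρ) (x := x) (y := y) hn
      h.hbS h.hb h.hS h.ρr h.ρL h.ρP h.LP h.hU h.wL h.wP h.wS hV.xL hV.xb hV.yP hV.yb
      ?_ ?_ ?_ ?_ ?_ ?_ ?_
  · exact Sep_T h.sg hbρ hL0 hP0
  · refine Sep_T h.sg hxρ (fun p hp => ?_) ?_
    · have := hu.ext p (hKL p hp)
      rw [T_23]; linarith
    · intro p hp
      simp only [Finset.mem_insert, Finset.mem_singleton] at hp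
      rcases hp with rfl | rfl
      · rw [T_abb]
      · rw [T_aba]
  · refine Sep_T h.sg hbρ hL0 ?_
    intro p hp
    simp only [Finset.mem_insert, Finset.mem_singleton] at hp
    rcases hp with rfl | rfl
    · rw [T_abb]
    · exact hP0 _ hV.yP
  · refine Sep_T h.sg hbρ hL0 ?_
    intro p hp
    simp only [Finset.mem_insert, Finset.mem_singleton] at hp
    rcases hp with rfl | rfl
    · rw [T_abb]
    · rw [T_aba]
  · refine Sep.symm (Sep_T h.sg hbρ ?_ hP0)
    intro p hp
    simp only [Finset.mem_insert, Finset.mem_singleton] at hp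
    rcases hp with rfl | rfl
    · rw [T_abb]
    · exact hL0 _ hV.xL
  · refine Sep.symm (Sep_T h.sg hyρ ?_ (fun p hp => ?_))
    · intro p hp
      simp only [Finset.mem_insert, Finset.mem_singleton] at hp
      rcases hp with rfl | rfl
      · rw [T_abb]
      · rw [T_aba]
    · have := hv.ext p (hKP p hp)
      rw [T_neg, ← T_23] at this; exact this
  · refine Sep.symm (Sep_T h.sg hbρ ?_ hP0)
    intro p hp
    simp only [Finset.mem_insert, Finset.mem_singleton] at hp
    rcases hp with rfl | rfl
    · rw [T_abb]
    · rw [T_aba]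

lemma valid_sol (hΩ : GP Ω) (hk : 1 ≤ k) {n : ℕ} (ih : IH red k Ω n) (hn : S.card ≤ n)
    (h : Cfg red k Ω σ S L P b ρ) : ∀ (N : ℕ) (x y : Pt), Valid red σ L P b ρ x y →
    meas σ L P b x y < N → ∃ E, Sol red k S b E := by
  intro N
  induction N with
  | zero => intro x y _ h0; omega
  | succ N ihN =>
    intro x y hV hN
    obtain ⟨u, hu⟩ := exU h hV
    obtain ⟨v, hv⟩ := exU h.mirror hV.mirror
    have hu' : ExtU (- -σ) L b ρ x u := by rw [neg_neg]; exact hu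
    have L1 : u ∈ L → T σ x y v ≤ T σ x y u → ∃ E, Sol red k S b E := by
      intro huL hle
      rcases stepL hΩ hk ih hn h hV hu hv huL hle with h1 | ⟨x', y', h1, h2⟩
      · exact h1
      · exact ihN x' y' h1 (by omega)
    have L2 : v ∈ P → T σ x y u ≤ T σ x y v → ∃ E, Sol red k S b E := by
      intro hvP hle
      rcases stepL hΩ hk ih hn h.mirror hV.mirror hv hu' hvP
        (by rw [T_neg, T_neg, ← T_12, ← T_12]; exact hle) with h1 | ⟨x', y', h1, h2⟩
      · exact h1
      · have h3 := h1.mirror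
        rw [neg_neg] at h3
        refine ihN y' x' h3 ?_
        have e1 := meas_mirror σ L P b x y
        have := meas_mirror (-σ) P L b x' y'
        rw [neg_neg] at this
        omega
    by_cases huρ : u = ρ
    · by_cases hvρ : v = ρ
      · subst huρ
        rw [hvρ] at hv
        exact finρ hΩ hk ih hn h hV hu hv
      · have hvP : v ∈ P := by
          rcases Finset.mem_insert.1 hv.uK with h' | h'
          · exact absurd h' hvρ
          · exact h'
        rcases le_total (T σ x y u) (T σ x y v) with hle | hle
        · exact L2 hvP hle
        · rw [huρ] at hle
          exact (contraR h hV hv hvρ hle).elim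
    · have huL : u ∈ L := by
        rcases Finset.mem_insert.1 hu.uK with h' | h'
        · exact absurd h' huρ
        · exact h'
      rcases le_total (T σ x y u) (T σ x y v) with hle | hle
      · by_cases hvρ : v = ρ
        · rw [hvρ] at hle
          exact (contraR h.mirror hV.mirror hu' huρ
            (by rw [T_neg, T_neg, ← T_12, ← T_12]; exact hle)).elim
        · have hvP : v ∈ P := by
            rcases Finset.mem_insert.1 hv.uK with h' | h'
            · exact absurd h' hvρ
            · exact h'
          exact L2 hvP hle
      · exact L1 huL hle
end

lemma T_one (a b c : Pt) : T 1 a b c = D a b c := by simp [T]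

lemma bridge {L P : Finset Pt} {b ρ : Pt} (hLn : L.Nonempty) (hPn : P.Nonempty)
    (lρ : ∀ p ∈ L, 0 < D b p ρ) (ρq : ∀ q ∈ P, 0 < D b ρ q) :
    ∃ x ∈ L, ∃ y ∈ P, (∀ p ∈ L, D x y p ≤ 0) ∧ (∀ p ∈ P, D x y p ≤ 0) := by
  obtain ⟨⟨x, y⟩, hxy, hmin⟩ := Finset.exists_min_image (L ×ˢ P)
    (fun z => D b z.1 z.2 / (D b ρ z.2 + D b z.1 ρ)) (hLn.product hPn)
  simp only [Finset.mem_product] at hxy hmin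
  have hx := lρ x hxy.1
  have hy := ρq y hxy.2
  refine ⟨x, hxy.1, y, hxy.2, ?_, ?_⟩
  · intro p hp
    have h1 := hmin (p, y) ⟨hp, hxy.2⟩
    rw [div_le_div_iff₀ (by linarith) (by linarith [lρ p hp])] at h1
    have id : D b p y * (D b ρ y + D b x ρ) - D b x y * (D b ρ y + D b p ρ)
        = - (D b ρ y * D x y p) := by unfold D; ring
    by_contra hcon
    have := mul_pos hy (not_le.1 hcon)
    linarith
  · intro p hp
    have h1 := hmin (x, p) ⟨hxy.1, hp⟩
    rw [div_le_div_iff₀ (by linarith) (by linarith [ρq p hp])] at h1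
    have id : D b x p * (D b ρ y + D b x ρ) - D b x y * (D b ρ p + D b x ρ)
        = - (D b x ρ * D x y p) := by unfold D; ring
    by_contra hcon
    have := mul_pos hx (not_le.1 hcon)
    linarith

lemma V3_of {σ : ℝ} {b x y p p' : Pt} (hb : 0 < T σ x y b) (h1 : T σ x y p < 0)
    (h2 : T σ x y p' < 0) (h3 : 0 < T σ b p x) (h4 : 0 < T σ b x p') : T σ p x p' < 0 := by
  have e := T_pl σ x p' p b y
  have a1 : T σ x b y < 0 := by rw [T_23]; linarith
  have a2 : 0 < T σ x p' b := by rw [T_c2]; exact h4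
  have a3 : 0 < T σ x p y := by rw [T_23]; linarith
  have a4 : 0 < T σ x p' y := by rw [T_23]; linarith
  have a5 : T σ x p b < 0 := by rw [T_13]; linarith
  by_contra hcon
  have hcon' : 0 ≤ T σ x p' p := by rw [T_c2]; exact not_lt.1 hcon
  have m1 := mul_nonpos_of_nonneg_of_nonpos hcon' a1.le
  have m2 := mul_pos a2 a3
  have m3 := mul_neg_of_pos_of_neg a4 a5
  linarith

lemma Sol_w1 (hΩ : GP Ω) (hk : 1 ≤ k) {n : ℕ} (ih : IH red k Ω n) {S : Finset Pt} {b : Pt}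
    (hn : S.card ≤ n)
    (hbS : b ∉ S) (hb : ¬ red b) (hS : (↑(insert b S) : Set Pt) ⊆ Ω) (hE : Ext b S)
    (hw : w red k S = 1) : ∃ E, Sol red k S b E := by
  have hO := Ord_of_Ext hΩ hbS hS hE
  obtain ⟨L, ρ, hL, hρS, hρL, hρ, hwL, hmin⟩ :=
    split (red := red) (k := k) hO (j := 0) (le_refl _) (by omega)
  set P := S \ insert ρ L with hP
  have hPm : ∀ p, p ∈ P ↔ p ∈ S ∧ p ≠ ρ ∧ p ∉ L := by
    intro p; simp [hP]
  have hiL : insert ρ L ⊆ S := Finset.insert_subset hρS hL.1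
  have hwP : w red k P = 0 := by
    rw [hP, w_sdiff hiL, w_insert hρL, wt_red hρ]; omega
  have hbρ : b ≠ ρ := fun h => hbS (h ▸ hρS)
  have hC : Cfg red k Ω 1 S L P b ρ := by
    refine ⟨Or.inl rfl, ?_, hρL, ?_, ?_, ?_, ?_, ?_, ?_, ?_, hbS, hb, hS, hwL, hwP, hw, hρ⟩
    · rw [← Finset.insert_union, hP]; exact Finset.union_sdiff_of_subset hiL
    · intro h; exact ((hPm ρ).1 h).2.1 rfl
    · intro p hp h; exact ((hPm p).1 h).2.2 hp
    · intro p hp; rw [T_one]; exact hL.2 p hp ρ hρS hρL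
    · intro q hq; rw [T_one]
      obtain ⟨h1, h2, h3⟩ := (hPm q).1 hq
      exact hmin q h1 h3 h2
    · intro p hp q hq; rw [T_one]
      obtain ⟨h1, h2, h3⟩ := (hPm q).1 hq
      exact hL.2 p hp q h1 h3
    · intro p hp q hq; rw [T_one, T_one]; exact hO.tot p hp q hq
    · intro p hp q hq t ht; rw [T_one, T_one, T_one]; exact hO.tr p hp q hq t ht
  have lρ : ∀ p ∈ L, 0 < D b p ρ := fun p hp => by rw [← T_one]; exact hC.lρ p hp
  have ρq : ∀ q ∈ P, 0 < D b ρ q := fun p hp => by rw [← T_one]; exact hC.ρq p hp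
  have hcases : ∀ p ∈ S, p = ρ ∨ p ∈ L ∨ p ∈ P := by
    intro p hp
    rw [hPm]
    by_cases h1 : p = ρ
    · exact Or.inl h1
    · by_cases h2 : p ∈ L
      · exact Or.inr (Or.inl h2)
      · exact Or.inr (Or.inr ⟨hp, h1, h2⟩)
  by_cases hLn : L.Nonempty
  swap
  · rw [Finset.not_nonempty_iff_eq_empty] at hLn
    refine vis_sol hΩ hk ih hn hbS hb hS hw hρS hρ ⟨b, ρ, hbρ, D_self' _ _, ?_, by rw [D_self]⟩
    intro p hp
    rcases hcases p hp with rfl | h | h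
    · rw [D_self']
    · rw [hLn] at h; exact absurd h (by simp)
    · exact (ρq p h).le
  by_cases hPn : P.Nonempty
  swap
  · rw [Finset.not_nonempty_iff_eq_empty] at hPn
    refine vis_sol hΩ hk ih hn hbS hb hS hw hρS hρ
      ⟨ρ, b, hbρ.symm, D_self _ _, ?_, by rw [D_self']⟩
    intro p hp
    rcases hcases p hp with rfl | h | h
    · rw [D_self]
    · have := lρ p h
      rw [D_cyc] at this; exact this.le
    · rw [hPn] at h; exact absurd h (by simp)
  obtain ⟨x, hx, y, hy, hxL, hyP⟩ := bridge hLn hPn lρ ρq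
  have hbxy : 0 < D b x y := by rw [← T_one]; exact hC.lq x hx y hy
  have hxy : x ≠ y := by rintro rfl; exact hC.LP _ hx hy
  have hxyb : D x y b = D b x y := by unfold D; ring
  by_cases hρ0 : 0 < D x y ρ
  · refine vis_sol hΩ hk ih hn hbS hb hS hw hρS hρ ⟨ρ, ρ + (x - y), ?_, D_self _ _, ?_, ?_⟩
    · intro h
      exact hxy (sub_eq_zero.1 (by simpa using h))
    · intro p hp
      have id : D ρ (ρ + (x - y)) p = D x y ρ - D x y p := by
        unfold D; simp only [Prod.fst_add, Prod.snd_add, Prod.fst_sub, Prod.snd_sub]; ring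
      rw [id]
      rcases hcases p hp with rfl | h | h
      · simp
      · linarith [hxL p h]
      · linarith [hyP p h]
    · have id : D ρ (ρ + (x - y)) b = - D b x ρ - D b ρ y := by
        unfold D; simp only [Prod.fst_add, Prod.snd_add, Prod.fst_sub, Prod.snd_sub]; ring
      rw [id]
      linarith [lρ x hx, ρq y hy]
  have hall : ∀ p ∈ S, 0 ≤ D y x p := by
    intro p hp
    rw [D_swap]
    rcases hcases p hp with rfl | h | h
    · linarith
    · linarith [hxL p h]
    · linarith [hyP p h]
  have hyxb : D y x b ≤ 0 := by rw [D_swap, hxyb]; linarith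
  by_cases hxr : red x
  · exact vis_sol hΩ hk ih hn hbS hb hS hw (hC.LS hx) hxr
      ⟨y, x, hxy.symm, D_self' _ _, hall, hyxb⟩
  by_cases hyr : red y
  · exact vis_sol hΩ hk ih hn hbS hb hS hw (hC.PS hy) hyr
      ⟨y, x, hxy.symm, D_self _ _, hall, hyxb⟩
  have hneg : ∀ p ∈ S, p ≠ x → p ≠ y → T 1 x y p < 0 := by
    intro p hp h1 h2
    have h3 := hC.nz hΩ (hC.LS hx) (hC.PS hy) hp hxy h1.symm h2.symm
    refine lt_of_le_of_ne ?_ h3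
    have := hall p hp
    rw [D_swap] at this
    rw [T_one]; linarith
  have hTb : 0 < T 1 x y b := by rw [T_one, hxyb]; exact hbxy
  have hKLne : ∀ p ∈ insert ρ L, p ≠ y := by
    rintro p hp rfl
    rcases Finset.mem_insert.1 hp with h | h
    · subst h; exact hC.ρP hy
    · exact hC.LP _ h hy
  have hKPne : ∀ p ∈ insert ρ P, p ≠ x := by
    rintro p hp rfl
    rcases Finset.mem_insert.1 hp with h | h
    · subst h; exact hC.ρL hx
    · exact hC.LP _ hx h
  have nex : ∀ p, 0 < T 1 b x p → p ≠ x := by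
    rintro p h rfl; rw [T_abb] at h; exact lt_irrefl _ h
  have nex' : ∀ p, 0 < T 1 b p x → p ≠ x := by
    rintro p h rfl; rw [T_abb] at h; exact lt_irrefl _ h
  have ney : ∀ p, 0 < T 1 b p y → p ≠ y := by
    rintro p h rfl; rw [T_abb] at h; exact lt_irrefl _ h
  have ney' : ∀ p, 0 < T 1 b y p → p ≠ y := by
    rintro p h rfl; rw [T_abb] at h; exact lt_irrefl _ h
  refine valid_sol hΩ hk ih hn hC _ x y ⟨hx, hy, hxr, hyr, ?_, ?_, ?_, ?_⟩ (Nat.lt_succ_self _)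
  · intro p hp h
    exact hneg p (hC.KLS hp) (nex p h) (hKLne p hp)
  · intro p hp h
    exact hneg p (hC.KPS hp) (hKPne p hp) (ney p h)
  · intro p hp p' hp' h1 h2
    exact V3_of hTb (hneg p (hC.KLS hp) (nex' p h1) (hKLne p hp))
      (hneg p' (hC.KLS hp') (nex p' h2) (hKLne p' hp')) h1 h2
  · intro p hp p' hp' h1 h2
    have := V3_of (σ := -1) (b := b) (x := y) (y := x) (p := p') (p' := p)
      (by rw [T_neg, ← T_12]; exact hTb)
      (by rw [T_neg, ← T_12]; exact hneg p' (hC.KPS hp') (hKPne p' hp') (ney' p' h2))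
      (by rw [T_neg, ← T_12]; exact hneg p (hC.KPS hp) (hKPne p hp) (ney p h1))
      (by rw [T_neg, ← T_23]; exact h2) (by rw [T_neg, ← T_23]; exact h1)
    rw [T_neg, ← T_13] at this
    exact this

theorem main (hΩ : GP Ω) (hk : 1 ≤ k) : ∀ n, IH red k Ω n := by
  intro n
  induction n with
  | zero => intro S b h; omega
  | succ n ih =>
    intro S b hc hbS hb hS hE hw
    rcases Nat.lt_succ_iff_lt_or_eq.1 hc with h | h
    · exact ih S b h hbS hb hS hE hw
    · rcases hw.eq_or_lt with h1 | h1
      · exact Sol_w1 hΩ hk ih h.le hbS hb hS hE h1.symm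
      · exact Sol_w2 hΩ ih h hbS hb hS hE h1

lemma collinear_of_D {p q r : Pt} (hpq : p ≠ q) (h : D p q r = 0) :
    Collinear ℝ ({p, q, r} : Set Pt) := by
  rw [collinear_iff_of_mem (p₀ := p) (by simp)]
  refine ⟨q - p, ?_⟩
  have hr : ∃ t : ℝ, r = t • (q - p) + p := by
    unfold D at h
    by_cases h1 : q.1 - p.1 = 0
    · have h2 : q.2 - p.2 ≠ 0 := by
        intro h2
        exact hpq (Prod.ext (by linarith) (by linarith))
      refine ⟨(r.2 - p.2) / (q.2 - p.2), Prod.ext ?_ ?_⟩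
      · simp only [Prod.fst_add, Prod.smul_fst, Prod.fst_sub, smul_eq_mul]
        rw [h1] at h ⊢
        have : (q.2 - p.2) * (r.1 - p.1) = 0 := by linarith
        rcases mul_eq_zero.1 this with h3 | h3
        · exact absurd h3 h2
        · linarith
      · simp only [Prod.snd_add, Prod.smul_snd, Prod.snd_sub, smul_eq_mul]
        rw [div_mul_cancel₀ _ h2]; ring
    · refine ⟨(r.1 - p.1) / (q.1 - p.1), Prod.ext ?_ ?_⟩
      · simp only [Prod.fst_add, Prod.smul_fst, Prod.fst_sub, smul_eq_mul]
        rw [div_mul_cancel₀ _ h1]; ring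
      · simp only [Prod.snd_add, Prod.smul_snd, Prod.snd_sub, smul_eq_mul]
        rw [div_mul_eq_mul_div, eq_comm, ← eq_sub_iff_add_eq, div_eq_iff h1]
        linarith
  intro z hz
  simp only [Set.mem_insert_iff, Set.mem_singleton_iff] at hz
  rcases hz with rfl | rfl | rfl
  · exact ⟨0, by simp⟩
  · exact ⟨1, by simp⟩
  · exact hr

lemma GP_of_GenPos {Q : Set Pt} (h : GenPos Q) : GP Q := by
  intro p hp q hq r hr h1 h2 h3 h0
  exact h p hp q hq r hr h1 h2 h3 (collinear_of_D h1 h0)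

lemma Ext_of_hull {V : Finset Pt} {b : Pt} (h : b ∉ convexHull ℝ ((↑V : Set Pt) \ {b})) :
    Ext b (V.erase b) := by
  by_cases hne : (V.erase b).Nonempty
  swap
  · rw [Finset.not_nonempty_iff_eq_empty] at hne
    rw [hne]
    refine ⟨b, b + (1, 0), ?_, D_self _ _, by simp⟩
    intro e
    have := congrArg Prod.fst e
    simp at this
  have hfin : ((↑V : Set Pt) \ {b}).Finite := V.finite_toSet.subset Set.sdiff_subset
  obtain ⟨f, u, h1, h2⟩ := geometric_hahn_banach_closed_point (convex_convexHull ℝ _)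
    (hfin.isClosed_convexHull ℝ) h
  have hf : ∀ p : Pt, f p = p.1 * f (1, 0) + p.2 * f (0, 1) := by
    intro p
    have : p = p.1 • ((1, 0) : Pt) + p.2 • ((0, 1) : Pt) := by ext <;> simp
    conv_lhs => rw [this]
    rw [map_add, map_smul, map_smul]; simp
  have hD : ∀ p : Pt, D b (b + (- f (0, 1), f (1, 0))) p = f b - f p := by
    intro p
    rw [hf b, hf p]
    unfold D
    simp only [Prod.fst_add, Prod.snd_add]; ring
  have hpos : ∀ p ∈ V.erase b, 0 < D b (b + (- f (0, 1), f (1, 0))) p := by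
    intro p hp
    rw [hD]
    rw [Finset.mem_erase] at hp
    have := h1 p (subset_convexHull ℝ _ ⟨hp.2, hp.1⟩)
    linarith
  refine ⟨b, b + (- f (0, 1), f (1, 0)), ?_, D_self _ _, fun p hp => (hpos p hp).le⟩
  intro e
  obtain ⟨p, hp⟩ := hne
  have := hpos p hp
  rw [← e, D_self''] at this
  exact lt_irrefl _ this

/-- The graph of an edge set. -/
def gr {red : Pt → Prop} {E : Finset (Pt × Pt)} {V : Finset Pt} (h : Tree red E V) :
    SimpleGraph {x : Pt // x ∈ V} where
  Adj u v := (u.1, v.1) ∈ E ∨ (v.1, u.1) ∈ E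
  symm := ⟨fun _ _ h => h.symm⟩
  loopless := ⟨fun u hu => by
    have h1 : (u.1, u.1) ∈ E := by tauto
    exact (h.col _ h1).2.1 (h.col _ h1).1⟩

lemma gr_conn {E : Finset (Pt × Pt)} {V : Finset Pt} (h : Tree red E V) (hV : V.Nonempty) :
    (gr h).Connected := by
  have key : ∀ p q, Relation.EqvGen (fun a c => (a, c) ∈ E) p q →
      p = q ∨ ∃ (hp : p ∈ V) (hq : q ∈ V), (gr h).Reachable ⟨p, hp⟩ ⟨q, hq⟩ := by
    intro p q hpq
    induction hpq with
    | rel x y hxy =>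
      obtain ⟨_, _, h3, h4⟩ := h.col _ hxy
      exact Or.inr ⟨h3, h4, SimpleGraph.Adj.reachable (Or.inl hxy)⟩
    | refl x => exact Or.inl rfl
    | symm x y _ ih =>
      rcases ih with rfl | ⟨h1, h2, h3⟩
      · exact Or.inl rfl
      · exact Or.inr ⟨h2, h1, h3.symm⟩
    | trans x y z _ _ ih1 ih2 =>
      rcases ih1 with rfl | ⟨h1, h2, h3⟩
      · exact ih2
      · rcases ih2 with rfl | ⟨h4, h5, h6⟩
        · exact Or.inr ⟨h1, h2, h3⟩
        · exact Or.inr ⟨h1, h5, h3.trans h6⟩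
  haveI : Nonempty {x : Pt // x ∈ V} := by
    obtain ⟨v, hv⟩ := hV
    exact ⟨⟨v, hv⟩⟩
  refine ⟨?_⟩
  intro u v
  rcases key u.1 v.1 (h.conn _ u.2 _ v.2) with e | ⟨_, _, h3⟩
  · rw [Subtype.ext e]
  · exact h3

lemma gr_deg_blue {E : Finset (Pt × Pt)} {V : Finset Pt} (h : Tree red E V)
    (v : {x : Pt // x ∈ V}) (hv : ¬ red v.1) : deg (gr h) v = bd E v.1 := by
  unfold deg bd
  rw [← Set.ncard_coe_finset, ← Set.ncard_image_of_injective (f := fun u => (u.1, v.1))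
    ((gr h).neighborSet v) (by
      intro a c hac
      simp only [Prod.mk.injEq] at hac
      exact Subtype.ext hac.1)]
  congr 1
  ext e
  simp only [Set.mem_image, SimpleGraph.mem_neighborSet, Finset.coe_filter, Set.mem_setOf_eq]
  constructor
  · rintro ⟨u, hu, rfl⟩
    rcases hu with hu | hu
    · exact absurd (h.col _ hu).1 hv
    · exact ⟨hu, rfl⟩
  · rintro ⟨h1, h2⟩
    refine ⟨⟨e.1, (h.col _ h1).2.2.1⟩, Or.inr ?_, ?_⟩
    · rw [← h2]; exact h1
    · rw [← h2]

lemma gr_deg_red {E : Finset (Pt × Pt)} {V : Finset Pt} (h : Tree red E V)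
    (v : {x : Pt // x ∈ V}) (hv : red v.1) : deg (gr h) v = rd E v.1 := by
  unfold deg rd
  rw [← Set.ncard_coe_finset, ← Set.ncard_image_of_injective (f := fun u => (v.1, u.1))
    ((gr h).neighborSet v) (by
      intro a c hac
      simp only [Prod.mk.injEq] at hac
      exact Subtype.ext hac.2)]
  congr 1
  ext e
  simp only [Set.mem_image, SimpleGraph.mem_neighborSet, Finset.coe_filter, Set.mem_setOf_eq]
  constructor
  · rintro ⟨u, hu, rfl⟩
    rcases hu with hu | hu
    · exact ⟨hu, rfl⟩
    · exact absurd hv (h.col _ hu).2.1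
  · rintro ⟨h1, h2⟩
    refine ⟨⟨e.2, (h.col _ h1).2.2.2⟩, Or.inl ?_, ?_⟩
    · rw [← h2]; exact h1
    · rw [← h2]

lemma gr_edges {E : Finset (Pt × Pt)} {V : Finset Pt} (h : Tree red E V) :
    Nat.card (gr h).edgeSet ≤ E.card := by
  rw [Nat.card_coe_set_eq,
    ← Set.ncard_image_of_injective _ (Sym2.map.injective (Subtype.val_injective))]
  have hsub : Sym2.map Subtype.val '' (gr h).edgeSet
      ⊆ (↑(E.image (fun e => s(e.1, e.2))) : Set (Sym2 Pt)) := by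
    rintro _ ⟨e, he, rfl⟩
    induction e using Sym2.ind with
    | _ u v =>
      rw [SimpleGraph.mem_edgeSet] at he
      simp only [Finset.coe_image, Set.mem_image, Finset.mem_coe, Sym2.map_mk]
      rcases he with he | he
      · exact ⟨_, he, rfl⟩
      · exact ⟨_, he, Sym2.eq_swap⟩
  refine (Set.ncard_le_ncard hsub (Finset.finite_toSet _)).trans ?_
  rw [Set.ncard_coe_finset]
  exact Finset.card_image_le

lemma gr_plane {E : Finset (Pt × Pt)} {V : Finset Pt} (h : Tree red E V)
    (u v x y : {x : Pt // x ∈ V}) (h1 : (gr h).Adj u v) (h2 : (gr h).Adj x y)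
    (hne : s(u, v) ≠ s(x, y)) (p : Pt) (hp1 : p ∈ segment ℝ u.1 v.1)
    (hp2 : p ∈ segment ℝ x.1 y.1) : (p = u.1 ∨ p = v.1) ∧ (p = x.1 ∨ p = y.1) := by
  have gen : ∀ u v x y : {x : Pt // x ∈ V}, (u.1, v.1) ∈ E → (x.1, y.1) ∈ E →
      s(u, v) ≠ s(x, y) → p ∈ segment ℝ u.1 v.1 → p ∈ segment ℝ x.1 y.1 →
      (p = u.1 ∨ p = v.1) ∧ (p = x.1 ∨ p = y.1) := by
    intro u v x y h1 h2 hne hp1 hp2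
    refine h.nc _ h1 _ h2 ?_ p hp1 hp2
    intro e
    simp only [Prod.mk.injEq] at e
    exact hne (by rw [Subtype.ext e.1, Subtype.ext e.2])
  rcases h1 with h1 | h1 <;> rcases h2 with h2 | h2
  · exact gen u v x y h1 h2 hne hp1 hp2
  · have := gen u v y x h1 h2 (by rw [Sym2.eq_swap (a := y)]; exact hne) hp1
      (by rw [segment_symm]; exact hp2)
    tauto
  · have := gen v u x y h1 h2 (by rw [Sym2.eq_swap (a := v)]; exact hne)
      (by rw [segment_symm]; exact hp1) hp2
    tauto
  · have := gen v u y x h1 h2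
      (by rw [Sym2.eq_swap (a := y), Sym2.eq_swap (a := v)]; exact hne)
      (by rw [segment_symm]; exact hp1) (by rw [segment_symm]; exact hp2)
    tauto

end PBT

/-- correctness of `proc1`. If `k(|B|-1) < |R| ≤ k|B|` with `k ≥ 2`,
`|B| ≥ 1`, `R ∪ B` in general position, and `b ∈ B` is a vertex of the convex hull of
`R ∪ B`, then there is a plane bichromatic tree on `R ∪ B` of maximum degree at most
`k + 1` in which `b` has degree exactly `|R| - k(|B|-1)` and every red vertex has
degree at most `3`. -/
theorem statement_10 (R B : Finset Pt) (hdisj : Disjoint R B)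
    (hgp : GenPos (↑(R ∪ B) : Set Pt)) (k : ℕ) (hk : 2 ≤ k) (hB : 1 ≤ B.card)
    (hlo : k * (B.card - 1) < R.card) (hhi : R.card ≤ k * B.card)
    (b : Pt) (hbB : b ∈ B)
    (hhull : b ∉ convexHull ℝ ((↑(R ∪ B) : Set Pt) \ {b})) :
    ∃ G : SimpleGraph {x : Pt // x ∈ R ∪ B},
      PlaneBichromTree R B G ∧ (∀ v, deg G v ≤ k + 1) ∧
      (deg G ⟨b, Finset.mem_union_right R hbB⟩ : ℤ)
        = (R.card : ℤ) - k * ((B.card : ℤ) - 1) ∧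
      ∀ v : {x : Pt // x ∈ R ∪ B}, v.1 ∈ R → deg G v ≤ 3 := by
  have hR : ∀ p ∈ B, p ∉ R := fun p hp hp' => Finset.disjoint_left.1 hdisj hp' hp
  have hbV : b ∈ R ∪ B := Finset.mem_union_right R hbB
  have hΩ := PBT.GP_of_GenPos hgp
  have hins : insert b ((R ∪ B).erase b) = R ∪ B := Finset.insert_erase hbV
  have hbr : ¬ (b ∈ R) := hR b hbB
  have hwR : PBT.w (fun p => p ∈ R) k R = R.card := by
    unfold PBT.w
    rw [Finset.sum_congr rfl (fun p hp => PBT.wt_red (red := fun p => p ∈ R) hp)]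
    simp
  have hwB : PBT.w (fun p => p ∈ R) k B = - (k * B.card) := by
    unfold PBT.w
    rw [Finset.sum_congr rfl (fun p hp => PBT.wt_blue (red := fun p => p ∈ R) (hR p hp))]
    simp [mul_comm]
  have hw : PBT.w (fun p => p ∈ R) k ((R ∪ B).erase b) = R.card - k * ((B.card : ℤ) - 1) := by
    rw [PBT.w_erase hbV, PBT.w_union hdisj, hwR, hwB,
      PBT.wt_blue (red := fun p => p ∈ R) hbr]
    ring
  have hlo' : (k : ℤ) * ((B.card : ℤ) - 1) < R.card := by
    have : ((k * (B.card - 1) : ℕ) : ℤ) < R.card := by exact_mod_cast hlo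
    rwa [Nat.cast_mul, Nat.cast_sub hB, Nat.cast_one] at this
  obtain ⟨E, hE⟩ := PBT.main (red := fun p => p ∈ R) (k := k) hΩ (by omega) _
    ((R ∪ B).erase b) b (Nat.lt_succ_self _) (by simp) hbr (by rw [hins])
    (PBT.Ext_of_hull hhull) (by rw [hw]; omega)
  have hT := hE.tree
  rw [hins] at hT
  have hroot := hE.root
  rw [hw] at hroot
  have hconn := PBT.gr_conn hT ⟨b, hbV⟩
  have hc1 := hconn.card_vert_le_card_edgeSet_add_one
  have hc2 := PBT.gr_edges hT
  have hcV : Nat.card {x : Pt // x ∈ R ∪ B} = R.card + B.card := by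
    rw [Nat.card_eq_fintype_card, Fintype.card_coe, Finset.card_union_of_disjoint hdisj]
  have hEsum : E.card = ∑ q ∈ B, PBT.bd E q := by
    unfold PBT.bd
    refine Finset.card_eq_sum_card_fiberwise ?_
    intro e he
    obtain ⟨_, h2, _, h4⟩ := hT.col e he
    rcases Finset.mem_union.1 h4 with h | h
    · exact absurd h h2
    · exact h
  rw [← Finset.add_sum_erase _ _ hbB] at hEsum
  have hsum : ∑ q ∈ B.erase b, PBT.bd E q ≤ (B.card - 1) * (k + 1) := by
    refine (Finset.sum_le_card_nsmul _ _ (k + 1) ?_).trans ?_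
    · intro q hq
      rw [Finset.mem_erase] at hq
      exact hE.blue q (hR q hq.2) hq.1
    · rw [Finset.card_erase_of_mem hbB, smul_eq_mul]
  have hsum' : ((∑ q ∈ B.erase b, PBT.bd E q : ℕ) : ℤ) ≤ ((B.card : ℤ) - 1) * (k + 1) := by
    have : ((∑ q ∈ B.erase b, PBT.bd E q : ℕ) : ℤ) ≤ (((B.card - 1) * (k + 1) : ℕ) : ℤ) := by
      exact_mod_cast hsum
    rwa [Nat.cast_mul, Nat.cast_sub hB, Nat.cast_one, Nat.cast_add, Nat.cast_one] at this
  have hexp : ((B.card : ℤ) - 1) * (k + 1) = k * ((B.card : ℤ) - 1) + B.card - 1 := by ring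
  have hhi' : (R.card : ℤ) ≤ k * ((B.card : ℤ) - 1) + k := by
    have : (R.card : ℤ) ≤ k * B.card := by exact_mod_cast hhi
    linarith
  rw [hcV] at hc1
  have hbdeg : (PBT.bd E b : ℤ) = R.card - k * ((B.card : ℤ) - 1) := by omega
  have hcard : Nat.card (PBT.gr hT).edgeSet + 1 = Nat.card {x : Pt // x ∈ R ∪ B} := by
    rw [hcV]; omega
  refine ⟨PBT.gr hT, ⟨SimpleGraph.isTree_iff_connected_and_card.2 ⟨hconn, hcard⟩, ?_, ?_⟩,
    ?_, ?_, ?_⟩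
  · intro u v huv
    rcases huv with h | h
    · obtain ⟨h1, h2, _, h4⟩ := hT.col _ h
      left
      exact ⟨h1, (Finset.mem_union.1 h4).resolve_left h2⟩
    · obtain ⟨h1, h2, _, h4⟩ := hT.col _ h
      right
      exact ⟨(Finset.mem_union.1 h4).resolve_left h2, h1⟩
  · intro u v x y h1 h2 h3 p hp1 hp2
    exact PBT.gr_plane hT u v x y h1 h2 h3 p hp1 hp2
  · intro v
    by_cases hv : v.1 ∈ R
    · rw [PBT.gr_deg_red hT v hv]
      have := hE.reds v.1 hv
      omega
    · rw [PBT.gr_deg_blue hT v hv]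
      by_cases hvb : v.1 = b
      · rw [hvb]; omega
      · exact hE.blue v.1 hv hvb
  · rw [PBT.gr_deg_blue hT _ hbr]
    exact hbdeg
  · intro v hv
    rw [PBT.gr_deg_red hT v hv]
    exact hE.reds v.1 hv
end
end

section
/- Let R and B be two disjoint finite sets of points in the plane with R ∪ B in general position, let k ≥ 2 be an integer with |B| ≥ 1 and |R| = k|B| + 1, and let r ∈ R be a vertex of the convex hull of R ∪ B. Then there exists a plane bichromatic tree T on R ∪ B whose maximum vertex degree is at most k + 1, in which the degree of r is 1 or 2, and in which every other vertex of R has degree at most 3. (This is the correctness specification of procedure proc2.) -/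
open scoped Classical

noncomputable section

/-! ### Proof material -/

/-- Orientation determinant. -/
def odet (a b c : Pt) : ℝ := (b.1 - a.1) * (c.2 - a.2) - (b.2 - a.2) * (c.1 - a.1)

/-- General position through determinants. -/
def GP (U : Set Pt) : Prop :=
  ∀ a ∈ U, ∀ b ∈ U, ∀ c ∈ U, a ≠ b → a ≠ c → b ≠ c → odet a b c ≠ 0

/-- Two edges do not cross. -/
def NC (e f : Pt × Pt) : Prop :=
  ∀ p : Pt, p ∈ segment ℝ e.1 e.2 → p ∈ segment ℝ f.1 f.2 →
    (p = e.1 ∨ p = e.2) ∧ (p = f.1 ∨ p = f.2)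

theorem NC.symm {e f : Pt × Pt} (h : NC e f) : NC f e := fun p h1 h2 => (h p h2 h1).symm

/-- Connected plane bichromatic graph on `S`. -/
structure Good (blue : Pt → Prop) (S : Finset Pt) (E : Finset (Pt × Pt)) : Prop where
  mem : ∀ e ∈ E, e.1 ∈ S ∧ e.2 ∈ S ∧ ¬ blue e.1 ∧ blue e.2
  conn : ∀ u ∈ S, ∀ v ∈ S, Relation.EqvGen (fun a b => (a, b) ∈ E) u v
  nc : ∀ e ∈ E, ∀ f ∈ E, e ≠ f → NC e f

/-- Degree of a vertex in an edge set. -/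
def dg (E : Finset (Pt × Pt)) (v : Pt) : ℕ := (E.filter (fun e => e.1 = v ∨ e.2 = v)).card

/-- Degree bound. -/
def cap (blue : Pt → Prop) (k : ℕ) (v : Pt) : ℕ := if blue v then k + 1 else 3

/-- Good graph with degree bounds. -/
def Tr (blue : Pt → Prop) (k : ℕ) (S : Finset Pt) (E : Finset (Pt × Pt)) : Prop :=
  Good blue S E ∧ ∀ v, dg E v ≤ cap blue k v

theorem dg_union (E F : Finset (Pt × Pt)) (v : Pt) : dg (E ∪ F) v ≤ dg E v + dg F v := by
  unfold dg
  rw [Finset.filter_union]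
  exact Finset.card_union_le _ _

theorem Good.dg_zero {blue S E} (h : Good blue S E) {v : Pt} (hv : v ∉ S) : dg E v = 0 := by
  unfold dg
  rw [Finset.card_eq_zero, Finset.filter_eq_empty_iff]
  rintro e he (rfl | rfl)
  · exact hv (h.mem e he).1
  · exact hv (h.mem e he).2.1

theorem Good.dg_union_right {blue S E F} (h : Good blue S E) {v : Pt} (hv : v ∉ S) :
    dg (E ∪ F) v ≤ dg F v := by
  have := dg_union E F v
  rw [h.dg_zero hv] at this; omega

theorem Good.dg_union_left {blue S E F} (h : Good blue S F) {v : Pt} (hv : v ∉ S) :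
    dg (E ∪ F) v ≤ dg E v := by
  have := dg_union E F v
  rw [h.dg_zero hv] at this; omega

theorem odet_seg (a b x y p : Pt) (hp : p ∈ segment ℝ x y) :
    ∃ s t : ℝ, 0 ≤ s ∧ 0 ≤ t ∧ s + t = 1 ∧ p = s • x + t • y ∧
      odet a b p = s * odet a b x + t * odet a b y := by
  obtain ⟨s, t, hs, ht, hst, rfl⟩ := hp
  refine ⟨s, t, hs, ht, hst, rfl, ?_⟩
  have : s = 1 - t := by linarith
  subst this
  simp [odet]; ring

theorem NC_of_sep {U : Set Pt} (hU : GP U) (ε : ℝ) (a b z : Pt) (e f : Pt × Pt)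
    (he1 : e.1 ∈ U) (he2 : e.2 ∈ U) (hz : z ∈ U) (hne : e.1 ≠ e.2) (hnf : f.1 ≠ f.2)
    (h1 : ε * odet a b e.1 ≤ 0) (h2 : ε * odet a b e.2 ≤ 0) (h0 : odet a b z = 0)
    (g1 : f.1 ≠ z → 0 < ε * odet a b f.1) (g2 : f.2 ≠ z → 0 < ε * odet a b f.2) : NC e f := by
  intro p hpe hpf
  obtain ⟨s, t, hs, ht, hst, -, hp⟩ := odet_seg a b _ _ p hpe
  obtain ⟨s', t', hs', ht', hst', hpp, hp'⟩ := odet_seg a b _ _ p hpf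
  have hle : ε * odet a b p ≤ 0 := by
    rw [hp]; nlinarith [mul_nonneg hs (neg_nonneg.2 h1), mul_nonneg ht (neg_nonneg.2 h2)]
  have hge : ε * odet a b p = s' * (ε * odet a b f.1) + t' * (ε * odet a b f.2) := by
    rw [hp']; ring
  have key : p = z ∧ (p = f.1 ∨ p = f.2) := by
    by_cases hf1 : f.1 = z
    · have hf2 : f.2 ≠ z := fun h => hnf (hf1.trans h.symm)
      have := g2 hf2
      rw [hf1, h0] at hge
      have ht0 : t' = 0 := by
        by_contra hne
        have : 0 < t' := lt_of_le_of_ne ht' (Ne.symm hne)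
        have := mul_pos this (g2 hf2)
        linarith [mul_zero ε]
      have hs1 : s' = 1 := by linarith
      have : p = f.1 := by rw [hpp, ht0, hs1]; simp
      exact ⟨this.trans hf1, Or.inl this⟩
    · by_cases hf2 : f.2 = z
      · have := g1 hf1
        rw [hf2, h0] at hge
        have ht0 : s' = 0 := by
          by_contra hne
          have : 0 < s' := lt_of_le_of_ne hs' (Ne.symm hne)
          have := mul_pos this (g1 hf1)
          linarith [mul_zero ε]
        have hs1 : t' = 1 := by linarith
        have : p = f.2 := by rw [hpp, ht0, hs1]; simp
        exact ⟨this.trans hf2, Or.inr this⟩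
      · exfalso
        have := g1 hf1
        have := g2 hf2
        rcases lt_or_eq_of_le hs' with h | h
        · nlinarith [mul_pos h (g1 hf1), mul_nonneg ht' (g2 hf2).le]
        · have : t' = 1 := by linarith
          rw [← h, this] at hge; linarith
  refine ⟨?_, key.2⟩
  by_contra hcon
  push Not at hcon
  obtain ⟨s, t, hs, ht, hst, -, hp⟩ := odet_seg e.1 e.2 _ _ p hpe
  have hzero : odet e.1 e.2 p = 0 := by
    rw [hp]; simp [odet]; right; ring
  rw [key.1] at hcon hzero
  exact hU _ he1 _ he2 _ hz hne hcon.1.symm hcon.2.symm hzero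

theorem Good.ncross {U : Set Pt} (hU : GP U) {blue S T E F} (hE : Good blue S E)
    (hF : Good blue T F) (hS : (S : Set Pt) ⊆ U) (ε : ℝ) (a b z : Pt)
    (hz : z ∈ U) (h0 : odet a b z = 0)
    (h1 : ∀ s ∈ S, ε * odet a b s ≤ 0) (h2 : ∀ s ∈ T, s ≠ z → 0 < ε * odet a b s) :
    ∀ e ∈ E, ∀ f ∈ F, NC e f := by
  intro e he f hf
  obtain ⟨m1, m2, m3, m4⟩ := hE.mem e he
  obtain ⟨n1, n2, n3, n4⟩ := hF.mem f hf
  exact NC_of_sep hU ε a b z e f (hS m1) (hS m2) hz (fun h => m3 (h ▸ m4)) (fun h => n3 (h ▸ n4))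
    (h1 _ m1) (h1 _ m2) h0 (h2 _ n1) (h2 _ n2)

theorem Good.union {blue S T E F} (hE : Good blue S E) (hF : Good blue T F) {z : Pt}
    (hzS : z ∈ S) (hzT : z ∈ T) (hnc : ∀ e ∈ E, ∀ f ∈ F, NC e f) :
    Good blue (S ∪ T) (E ∪ F) := by
  refine ⟨?_, ?_, ?_⟩
  · intro e he
    rcases Finset.mem_union.1 he with h | h
    · have := hE.mem e h
      exact ⟨Finset.mem_union_left _ this.1, Finset.mem_union_left _ this.2.1, this.2.2⟩
    · have := hF.mem e h
      exact ⟨Finset.mem_union_right _ this.1, Finset.mem_union_right _ this.2.1, this.2.2⟩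
  · have key : ∀ u ∈ S ∪ T, Relation.EqvGen (fun a b => (a, b) ∈ E ∪ F) u z := by
      intro u hu
      rcases Finset.mem_union.1 hu with h | h
      · exact (hE.conn u h z hzS).mono (fun _ _ h => Finset.mem_union_left _ h)
      · exact (hF.conn u h z hzT).mono (fun _ _ h => Finset.mem_union_right _ h)
    intro u hu v hv
    exact (key u hu).trans _ _ _ ((key v hv).symm _ _)
  · intro e he f hf hef
    rcases Finset.mem_union.1 he with h | h <;> rcases Finset.mem_union.1 hf with h' | h'
    · exact hE.nc e h f h' hef
    · exact hnc e h f h'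
    · exact (hnc f h' e h).symm
    · exact hF.nc e h f h' hef

theorem Tr.union {blue k S T E F} (hE : Tr blue k S E) (hF : Tr blue k T F) {z : Pt}
    (hzS : z ∈ S) (hzT : z ∈ T) (hnc : ∀ e ∈ E, ∀ f ∈ F, NC e f)
    (hd : ∀ v, v ∈ S → v ∈ T → dg E v + dg F v ≤ cap blue k v) :
    Tr blue k (S ∪ T) (E ∪ F) := by
  refine ⟨hE.1.union hF.1 hzS hzT hnc, ?_⟩
  intro v
  by_cases h1 : v ∈ S
  · by_cases h2 : v ∈ T
    · exact (dg_union _ _ _).trans (hd v h1 h2)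
    · exact (hF.1.dg_union_left h2).trans (hE.2 v)
  · exact (hE.1.dg_union_right h1).trans (hF.2 v)

/-- Gluing along a single vertex `z` with a weakly separating line. -/
theorem Tr.glue {U : Set Pt} (hU : GP U) {blue k S T E F} (hE : Tr blue k S E)
    (hF : Tr blue k T F) (hS : (S : Set Pt) ⊆ U) (ε : ℝ) (a b z : Pt)
    (hzS : z ∈ S) (hzT : z ∈ T) (h0 : odet a b z = 0)
    (h1 : ∀ s ∈ S, ε * odet a b s ≤ 0) (h2 : ∀ s ∈ T, s ≠ z → 0 < ε * odet a b s)
    (hd : dg E z + dg F z ≤ cap blue k z) :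
    Tr blue k (S ∪ T) (E ∪ F) ∧
      ∀ v, v ≠ z → ∀ m, dg E v ≤ m → dg F v ≤ m → dg (E ∪ F) v ≤ m := by
  have hdis : ∀ v, v ∈ S → v ∈ T → v = z := by
    intro v hv hv'
    by_contra hne
    linarith [h1 v hv, h2 v hv' hne]
  refine ⟨hE.union hF hzS hzT (hE.1.ncross hU hF.1 hS ε a b z (hS hzS) h0 h1 h2) ?_, ?_⟩
  · intro v hv hv'
    rw [hdis v hv hv']; exact hd
  · intro v hvz m hm hm'
    by_cases h : v ∈ S
    · have : v ∉ T := fun h' => hvz (hdis v h h')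
      exact (hF.1.dg_union_left this).trans hm
    · exact (hE.1.dg_union_right h).trans hm'

theorem Tr.edge (blue : Pt → Prop) (k : ℕ) {x q : Pt} (hx : ¬ blue x) (hq : blue q) :
    Tr blue k {x, q} {(x, q)} ∧ ∀ v, dg {(x, q)} v ≤ 1 := by
  have hd : ∀ v, dg {(x, q)} v ≤ 1 := by
    intro v
    unfold dg
    exact (Finset.card_filter_le _ _).trans (by simp)
  have hxq : x ≠ q := fun h => hx (h ▸ hq)
  have h1 : Relation.EqvGen (fun a b => (a, b) ∈ ({(x, q)} : Finset (Pt × Pt))) x q :=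
    .rel _ _ (by simp)
  refine ⟨⟨⟨?_, ?_, ?_⟩, ?_⟩, hd⟩
  · intro e he
    rw [Finset.mem_singleton] at he; subst he
    simp [hx, hq]
  · intro u hu v hv
    simp only [Finset.mem_insert, Finset.mem_singleton] at hu hv
    rcases hu with rfl | rfl <;> rcases hv with rfl | rfl
    · exact .refl _
    · exact h1
    · exact .symm _ _ h1
    · exact .refl _
  · intro e he f hf hef
    rw [Finset.mem_singleton] at he hf
    exact absurd (he.trans hf.symm) hef
  · intro v
    refine (hd v).trans ?_
    unfold cap; split_ifs <;> omega

theorem Tr.single (blue : Pt → Prop) (k : ℕ) (x : Pt) :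
    Tr blue k {x} ∅ ∧ ∀ v, dg ∅ v = 0 := by
  have hd : ∀ v, dg ∅ v = 0 := by intro v; simp [dg]
  refine ⟨⟨⟨by simp, ?_, by simp⟩, fun v => by rw [hd]; omega⟩, hd⟩
  intro u hu v hv
  rw [Finset.mem_singleton] at hu hv
  rw [hu, hv]; exact .refl _

/-- `r` is strictly extreme w.r.t. `S`. -/
def HExt (r : Pt) (S : Finset Pt) : Prop :=
  ∃ α β : ℝ, ∀ s ∈ S, s ≠ r → 0 < α * (s.1 - r.1) + β * (s.2 - r.2)

theorem HExt.mono {r : Pt} {S T : Finset Pt} (h : HExt r S) (hT : T ⊆ S) : HExt r T := by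
  obtain ⟨α, β, h⟩ := h
  exact ⟨α, β, fun s hs => h s (hT hs)⟩

theorem HExt.of_line {r q : Pt} {S : Finset Pt} (ε : ℝ)
    (h : ∀ s ∈ S, s ≠ r → 0 < ε * odet q r s) : HExt r S := by
  refine ⟨-ε * (r.2 - q.2), ε * (r.1 - q.1), fun s hs hne => ?_⟩
  have := h s hs hne
  unfold odet at this
  linarith

theorem odet_swap (a b c : Pt) : odet a c b = - odet a b c := by unfold odet; ring
theorem odet_swap' (a b c : Pt) : odet b a c = - odet a b c := by unfold odet; ring
theorem odet_rot (a b c : Pt) : odet b c a = odet a b c := by unfold odet; ring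
@[simp] theorem odet_self1 (a c : Pt) : odet a a c = 0 := by unfold odet; ring
@[simp] theorem odet_self2 (a c : Pt) : odet a c a = 0 := by unfold odet; ring
@[simp] theorem odet_self3 (a c : Pt) : odet a c c = 0 := by unfold odet; ring

/-- Angular sort around an extreme point. -/
theorem exists_sorted {U : Set Pt} (hU : GP U) (q : Pt) (hq : q ∈ U) (ε : ℝ) (hε : ε ≠ 0) :
    ∀ (S : Finset Pt), (S : Set Pt) ⊆ U → q ∉ S → HExt q S →
    ∃ l : List Pt, l.Nodup ∧ l.toFinset = S ∧ l.Pairwise (fun a b => 0 < ε * odet q a b) := by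
  intro S hS hqS ⟨α, β, hx⟩
  -- functional and key
  let g : Pt → ℝ := fun s => α * (s.1 - q.1) + β * (s.2 - q.2)
  let h : Pt → ℝ := fun s => ε * (α * (s.2 - q.2) - β * (s.1 - q.1))
  have hg : ∀ s ∈ S, 0 < g s := fun s hs => hx s hs (fun e => hqS (e ▸ hs))
  have hkey : ∀ a b : Pt, (α ^ 2 + β ^ 2) * (ε * odet q a b) = g a * h b - g b * h a := by
    intro a b; simp only [g, h, odet]; ring
  have hpos : ∀ s, 0 < g s → 0 < α ^ 2 + β ^ 2 := by
    intro s hs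
    by_contra hcon
    have h1 : α = 0 := by nlinarith [sq_nonneg α, sq_nonneg β]
    have h2 : β = 0 := by nlinarith [sq_nonneg α, sq_nonneg β]
    simp [g, h1, h2] at hs
  clear_value g h
  revert hS hqS hg
  clear hx
  induction S using Finset.strongInduction with
  | _ S ih =>
    intro hS hqS hg
    rcases S.eq_empty_or_nonempty with rfl | hne
    · exact ⟨[], by simp, by simp, by simp⟩
    obtain ⟨m, hm, hmin⟩ := Finset.exists_min_image S (fun s => h s / g s) hne
    obtain ⟨l, hl1, hl2, hl3⟩ := ih (S.erase m) (Finset.erase_ssubset hm)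
      (fun s hs => hS (Finset.mem_of_mem_erase hs)) (fun h => hqS (Finset.mem_of_mem_erase h))
      (fun s hs => hg s (Finset.mem_of_mem_erase hs))
    have hml : ∀ s, s ∈ l ↔ s ≠ m ∧ s ∈ S := by
      intro s; rw [← List.mem_toFinset, hl2, Finset.mem_erase]
    refine ⟨m :: l, ?_, ?_, ?_⟩
    · rw [List.nodup_cons]
      exact ⟨fun h => ((hml m).1 h).1 rfl, hl1⟩
    · rw [List.toFinset_cons, hl2, Finset.insert_erase hm]
    · rw [List.pairwise_cons]
      refine ⟨fun s hs => ?_, hl3⟩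
      obtain ⟨hsm, hsS⟩ := (hml s).1 hs
      have h1 := hmin s hsS
      have gs := hg s hsS
      have gm := hg m hm
      rw [div_le_div_iff₀ gm gs] at h1
      have h2 := hkey m s
      have hd : odet q m s ≠ 0 :=
        hU _ hq _ (hS hm) _ (hS hsS) (fun e => hqS (e ▸ hm)) (fun e => hqS (e ▸ hsS)) hsm.symm
      have h3 : 0 ≤ (α ^ 2 + β ^ 2) * (ε * odet q m s) := by rw [h2]; linarith
      have hne0 : ε * odet q m s ≠ 0 := mul_ne_zero hε hd
      rcases lt_or_gt_of_ne hne0 with hlt | hgt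
      · exfalso
        have := mul_neg_of_pos_of_neg (hpos m gm) hlt
        linarith
      · exact hgt

/-- Weight of a point. -/
def wt (blue : Pt → Prop) (k : ℕ) (p : Pt) : ℤ := if blue p then (k : ℤ) else -1

/-- Weight of a list. -/
def wl (blue : Pt → Prop) (k : ℕ) (l : List Pt) : ℤ := (l.map (wt blue k)).sum

/-- Weight of a finite set. -/
def ws (blue : Pt → Prop) (k : ℕ) (S : Finset Pt) : ℤ := ∑ p ∈ S, wt blue k p

theorem wt_blue {blue : Pt → Prop} {k : ℕ} {p : Pt} (h : blue p) : wt blue k p = k := by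
  simp [wt, h]
theorem wt_red {blue : Pt → Prop} {k : ℕ} {p : Pt} (h : ¬ blue p) : wt blue k p = -1 := by
  simp [wt, h]

@[simp] theorem wl_nil (blue : Pt → Prop) (k : ℕ) : wl blue k [] = 0 := by simp [wl]
@[simp] theorem wl_cons (blue : Pt → Prop) (k : ℕ) (p : Pt) (l : List Pt) :
    wl blue k (p :: l) = wt blue k p + wl blue k l := by simp [wl]
@[simp] theorem wl_append (blue : Pt → Prop) (k : ℕ) (l m : List Pt) :
    wl blue k (l ++ m) = wl blue k l + wl blue k m := by simp [wl]

theorem ws_toFinset (blue : Pt → Prop) (k : ℕ) {l : List Pt} (h : l.Nodup) :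
    ws blue k l.toFinset = wl blue k l := by
  unfold ws wl
  exact List.sum_toFinset _ h

theorem first_down (blue : Pt → Prop) (k : ℕ) : ∀ (l : List Pt) (h : ℤ), 0 ≤ h →
    h + wl blue k l < 0 → ∃ A x A', l = A ++ x :: A' ∧ ¬ blue x ∧ h + wl blue k A = 0 ∧
      ∀ A0 A1, A = A0 ++ A1 → 0 ≤ h + wl blue k A0 := by
  intro l
  induction l with
  | nil => intro h h0 h1; simp at h1; omega
  | cons p l ih =>
    intro h h0 h1
    rw [wl_cons] at h1
    by_cases hp : 0 ≤ h + wt blue k p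
    · obtain ⟨A, x, A', rfl, hx, hA, hpre⟩ := ih (h + wt blue k p) hp (by linarith)
      refine ⟨p :: A, x, A', rfl, hx, by rw [wl_cons]; linarith, ?_⟩
      intro A0 A1 hA0
      cases A0 with
      | nil => simpa using h0
      | cons y A0 =>
        simp only [List.cons_append, List.cons.injEq] at hA0
        obtain ⟨rfl, hA0⟩ := hA0
        have := hpre A0 A1 hA0
        rw [wl_cons]; linarith
    · have hr : ¬ blue p := by
        intro hb; rw [wt_blue hb] at hp; omega
      rw [wt_red hr] at hp
      refine ⟨[], p, l, rfl, hr, by simp; omega, ?_⟩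
      intro A0 A1 hA
      have : A0 = [] := by
        cases A0 with
        | nil => rfl
        | cons => simp at hA
      subst this; simpa using h0

theorem first_up (blue : Pt → Prop) (k : ℕ) : ∀ (l : List Pt) (h : ℤ), h ≤ 0 →
    0 < h + wl blue k l → ∃ A x A', l = A ++ x :: A' ∧ blue x ∧ h + wl blue k A ≤ 0 ∧
      0 < h + wl blue k A + k ∧ ∀ A0 A1, A = A0 ++ A1 → h + wl blue k A0 ≤ 0 := by
  intro l
  induction l with
  | nil => intro h h0 h1; simp at h1; omega
  | cons p l ih =>
    intro h h0 h1
    rw [wl_cons] at h1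
    by_cases hp : h + wt blue k p ≤ 0
    · obtain ⟨A, x, A', rfl, hx, hA, hA', hpre⟩ := ih (h + wt blue k p) hp (by linarith)
      refine ⟨p :: A, x, A', rfl, hx, by rw [wl_cons]; linarith, by rw [wl_cons]; linarith, ?_⟩
      intro A0 A1 hA0
      cases A0 with
      | nil => simpa using h0
      | cons y A0 =>
        simp only [List.cons_append, List.cons.injEq] at hA0
        obtain ⟨rfl, hA0⟩ := hA0
        have := hpre A0 A1 hA0
        rw [wl_cons]; linarith
    · have hr : blue p := by
        by_contra hb; rw [wt_red hb] at hp; omega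
      rw [wt_blue hr] at hp
      refine ⟨[], p, l, rfl, hr, by simpa using h0, by simp; omega, ?_⟩
      intro A0 A1 hA
      have : A0 = [] := by
        cases A0 with
        | nil => rfl
        | cons => simp at hA
      subst this; simpa using h0

/-- First hit of level `-1`; the prefix before it, if nonempty, ends with a red point. -/
theorem hit_one {blue : Pt → Prop} {k : ℕ} (hk : 2 ≤ k) {l : List Pt} (h : wl blue k l < 0) :
    ∃ A x A', l = A ++ x :: A' ∧ ¬ blue x ∧ wl blue k A = 0 ∧
      ∀ A0 z, A = A0 ++ [z] → ¬ blue z := by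
  obtain ⟨A, x, A', hl, hx, hA, hpre⟩ := first_down blue k l 0 le_rfl (by simpa using h)
  refine ⟨A, x, A', hl, hx, by simpa using hA, ?_⟩
  intro A0 z hz hb
  have h1 := hpre A0 [z] hz
  rw [hz, wl_append, wl_cons, wt_blue hb] at hA
  simp at hA h1; omega

theorem hit_two {blue : Pt → Prop} {k : ℕ} (hk : 2 ≤ k) {l : List Pt} (h : wl blue k l = -2) :
    ∃ A x y A', l = A ++ x :: y :: A' ∧ ¬ blue x ∧ ¬ blue y ∧ wl blue k A = 0 ∧
      wl blue k A' = 0 := by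
  obtain ⟨A, y, A', hl, hy, hA, hpre⟩ := first_down blue k l 1 (by norm_num) (by omega)
  rcases List.eq_nil_or_concat A with rfl | ⟨A0, x, rfl⟩
  · simp at hA
  rw [List.concat_eq_append] at *
  have h1 := hpre A0 [x] rfl
  have hx : ¬ blue x := by
    intro hb
    rw [wl_append, wl_cons, wt_blue hb] at hA
    simp at hA; omega
  simp [wt_red hx] at hA
  refine ⟨A0, x, y, A', by simpa using hl, hx, hy, by omega, ?_⟩
  rw [hl] at h
  simp [wt_red hx, wt_red hy] at h
  omega

/-- First transition to positive level. -/
theorem transition {blue : Pt → Prop} {k : ℕ} (hk : 2 ≤ k) {y z : Pt} {m : List Pt}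
    (hy : ¬ blue y) (hz : ¬ blue z) {l : List Pt} (hly : l.head? = some y) (hlz : l = m ++ [z])
    (h : wl blue k l = 0) :
    ∃ A c A', l = A ++ c :: A' ∧ blue c ∧ wl blue k A ≤ 0 ∧ 0 < wl blue k A + k ∧
      (wl blue k A = 0 → ∃ A0 d, A = A0 ++ [d] ∧ blue d) := by
  have hm : wl blue k m = 1 := by
    rw [hlz] at h; simp [wt_red hz] at h; omega
  obtain ⟨A, c, A', hl, hc, hA, hA', hpre⟩ := first_up blue k m 0 le_rfl (by omega)
  refine ⟨A, c, A' ++ [z], by rw [hlz, hl]; simp, hc, by simpa using hA, by simpa using hA', ?_⟩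
  intro h0
  rcases List.eq_nil_or_concat A with rfl | ⟨A0, d, rfl⟩
  · exfalso
    rw [hlz, hl] at hly
    simp at hly
    exact hy (hly ▸ hc)
  · rw [List.concat_eq_append] at *
    refine ⟨A0, d, rfl, ?_⟩
    by_contra hd
    have h1 := hpre A0 [d] rfl
    simp [wt_red hd] at h0 h1
    omega

/-- Main property: extreme red root. -/
def P5 (U : Set Pt) (blue : Pt → Prop) (k : ℕ) (S : Finset Pt) : Prop :=
  (S : Set Pt) ⊆ U → ws blue k S = -1 → ∀ r ∈ S, ¬ blue r → HExt r S → ∀ w,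
    ∃ E, Tr blue k S E ∧ dg E r ≤ 2 ∧ (¬ blue w → dg E w ≤ 2)

/-- Main property, variant where the root sees an extreme blue point. -/
def P5a (U : Set Pt) (blue : Pt → Prop) (k : ℕ) (S : Finset Pt) : Prop :=
  (S : Set Pt) ⊆ U → ws blue k S = -1 → ∀ r ∈ S, ∀ q ∈ S, ¬ blue r → blue q →
    ∀ (ε : ℝ) (a b : Pt), odet a b q = 0 → ε * odet a b r ≤ 0 →
    (∀ s ∈ S, s ≠ r → s ≠ q → 0 < ε * odet a b s) → ∀ w,
    ∃ E, Tr blue k S E ∧ dg E r ≤ 1 ∧ (¬ blue w → dg E w ≤ 2)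

theorem HExt.of_line_gen {a b q : Pt} {S : Finset Pt} (ε : ℝ) (h0 : odet a b q = 0)
    (h : ∀ s ∈ S, s ≠ q → 0 < ε * odet a b s) : HExt q S := by
  refine ⟨-ε * (b.2 - a.2), ε * (b.1 - a.1), fun s hs hne => ?_⟩
  have := h s hs hne
  have e : odet a b s = odet a b s - odet a b q := by rw [h0]; ring
  rw [e] at this
  unfold odet at this
  linarith

theorem cap_red {blue : Pt → Prop} {k : ℕ} {v : Pt} (h : ¬ blue v) : cap blue k v = 3 := by
  simp [cap, h]
theorem cap_blue {blue : Pt → Prop} {k : ℕ} {v : Pt} (h : blue v) : cap blue k v = k + 1 := by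
  simp [cap, h]

theorem sorted_nodup {q : Pt} {ε : ℝ} {l : List Pt}
    (h : l.Pairwise (fun a b => 0 < ε * odet q a b)) : l.Nodup := by
  refine h.imp ?_
  rintro a b hab rfl
  simp at hab

theorem sorted_cut {q x : Pt} {ε : ℝ} {A A' : List Pt}
    (h : (A ++ x :: A').Pairwise (fun a b => 0 < ε * odet q a b)) :
    (∀ a ∈ A, 0 < ε * odet q a x) ∧ (∀ b ∈ A', 0 < ε * odet q x b) ∧
      A.Pairwise (fun a b => 0 < ε * odet q a b) ∧ A'.Pairwise (fun a b => 0 < ε * odet q a b) := by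
  rw [List.pairwise_append, List.pairwise_cons] at h
  exact ⟨fun a ha => h.2.2 a ha x (by simp), h.2.1.1, h.1, h.2.1.2⟩

theorem piece {U : Set Pt} (hU : GP U) {blue : Pt → Prop} {k n : ℕ}
    (IH : ∀ T : Finset Pt, T.card < n → P5 U blue k T ∧ P5a U blue k T)
    (T : Finset Pt) (hTn : T.card < n) (hT : (T : Set Pt) ⊆ U) {q : Pt} (hqU : q ∈ U)
    (hqT : q ∉ T) (hq : blue q) (hw : ws blue k T = -1) {x : Pt} (hxT : x ∈ T)
    (hx : ¬ blue x) (ε : ℝ) (hs : ∀ t ∈ T, t ≠ x → 0 < ε * odet q x t) (w : Pt) :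
    ∃ E, Tr blue k (insert q T) E ∧ dg E q ≤ 1 ∧ (¬ blue w → dg E w ≤ 2) := by
  have hxe : HExt x T := HExt.of_line ε hs
  have hxq : x ≠ q := fun h => hqT (h ▸ hxT)
  obtain ⟨ed, edd⟩ := Tr.edge blue k hx hq
  have hins : ({x, q} ∪ T : Finset Pt) = insert q T := by
    ext p; simp only [Finset.mem_union, Finset.mem_insert, Finset.mem_singleton]
    constructor
    · rintro ((rfl | rfl) | h)
      · exact Or.inr hxT
      · exact Or.inl rfl
      · exact Or.inr h
    · rintro (rfl | h)
      · exact Or.inl (Or.inr rfl)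
      · exact Or.inr h
  have hxqU : (({x, q} : Finset Pt) : Set Pt) ⊆ U := by
    intro p hp
    simp only [Finset.coe_insert, Finset.coe_singleton, Set.mem_insert_iff,
      Set.mem_singleton_iff] at hp
    rcases hp with rfl | rfl
    · exact hT hxT
    · exact hqU
  -- generic gluing of the edge at x
  have gl : ∀ E, Tr blue k T E → dg E x ≤ 2 →
      Tr blue k (insert q T) ({(x, q)} ∪ E) ∧ dg ({(x, q)} ∪ E) q ≤ 1 ∧
      dg ({(x, q)} ∪ E) x ≤ 1 + dg E x ∧ (∀ v, v ≠ x → v ≠ q → dg ({(x, q)} ∪ E) v ≤ dg E v) := by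
    intro E hE hd
    obtain ⟨g1, g2⟩ := ed.glue hU hE hxqU ε q x x (by simp) hxT (by simp)
      (by intro s hs; simp only [Finset.mem_insert, Finset.mem_singleton] at hs
          rcases hs with rfl | rfl <;> simp) hs
      (by rw [cap_red hx]; have := edd x; omega)
    rw [hins] at g1
    refine ⟨g1, ?_, ?_, ?_⟩
    · exact (hE.1.dg_union_left hqT).trans (edd q)
    · exact (dg_union _ _ _).trans (by have := edd x; omega)
    · intro v hv hv'
      exact ed.1.dg_union_right (by simp [hv, hv'])
  by_cases hwx : w = x
  · subst hwx
    by_cases hT1 : T = {w}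
    · subst hT1
      refine ⟨{(w, q)}, ?_, edd q, fun _ => (edd w).trans (by norm_num)⟩
      rw [Finset.pair_comm] at ed; exact ed
    · obtain ⟨y, hy, hyw⟩ : ∃ y ∈ T, y ≠ w := by
        by_contra hcon
        push Not at hcon
        exact hT1 (Finset.eq_singleton_iff_unique_mem.2 ⟨hxT, hcon⟩)
      have hε : ε ≠ 0 := by
        rintro rfl
        have := hs y hy hyw; simp at this
      obtain ⟨l, hl1, hl2, hl3⟩ := exists_sorted hU w (hT hxT) (-ε) (neg_ne_zero.2 hε) (T.erase w)
        (fun p hp => hT (Finset.mem_of_mem_erase hp)) (by simp)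
        (hxe.mono (Finset.erase_subset _ _))
      have hmem : ∀ s, s ∈ l ↔ s ≠ w ∧ s ∈ T := by
        intro s; rw [← List.mem_toFinset, hl2, Finset.mem_erase]
      cases l with
      | nil => exact absurd ((hmem y).2 ⟨hyw, hy⟩) (by simp)
      | cons v l =>
        obtain ⟨hvw, hvT⟩ := (hmem v).1 (by simp)
        rw [List.pairwise_cons] at hl3
        have hv1 : ∀ t ∈ T, t ≠ w → t ≠ v → 0 < -ε * odet w v t := by
          intro t ht htw htv
          have : t ∈ v :: l := (hmem t).2 ⟨htw, ht⟩
          rcases List.mem_cons.1 this with h | h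
          · exact absurd h htv
          · exact hl3.1 t h
        have hv2 : -ε * odet w v q < 0 := by
          have := hs v hvT hvw
          rw [odet_rot w v q |>.symm, odet_rot v q w |>.symm]
          linarith
        by_cases hvb : blue v
        · obtain ⟨E, hE, hE1, hE2⟩ := (IH T hTn).2 hT hw w hxT v hvT hx hvb (-ε) w v (by simp)
            (by simp) hv1 w
          obtain ⟨g1, g2, g3, g4⟩ := gl E hE (by omega)
          exact ⟨_, g1, g2, fun _ => by omega⟩
        · obtain ⟨E, hE, hE1, hE2⟩ := (IH T hTn).1 hT hw w hxT hx hxe v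
          obtain ⟨ed', edd'⟩ := Tr.edge blue k hvb hq
          obtain ⟨g1, g2⟩ := hE.glue hU ed' hT ε w v v hvT (by simp) (by simp)
            (by intro s hs'
                by_cases h1 : s = w
                · subst h1; simp
                by_cases h2 : s = v
                · subst h2; simp
                have := hv1 s hs' h1 h2
                linarith)
            (by intro s hs' hsv
                simp only [Finset.mem_insert, Finset.mem_singleton] at hs'
                rcases hs' with h | h
                · exact absurd h hsv
                · subst h; linarith)
            (by rw [cap_red hvb]; have := edd' v; have := hE2 hvb; omega)
          have hins' : (T ∪ {v, q} : Finset Pt) = insert q T := by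
            ext p; simp only [Finset.mem_union, Finset.mem_insert, Finset.mem_singleton]
            constructor
            · rintro (h | rfl | rfl)
              · exact Or.inr h
              · exact Or.inr hvT
              · exact Or.inl rfl
            · rintro (rfl | h)
              · exact Or.inr (Or.inr rfl)
              · exact Or.inl h
          rw [hins'] at g1
          refine ⟨_, g1, (hE.1.dg_union_right hqT).trans (edd' q), fun _ => ?_⟩
          exact g2 w hvw.symm 2 hE1 ((edd' w).trans (by norm_num))
  · obtain ⟨E, hE, hE1, hE2⟩ := (IH T hTn).1 hT hw x hxT hx hxe w
    obtain ⟨g1, g2, g3, g4⟩ := gl E hE hE1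
    refine ⟨_, g1, g2, fun hwr => (g4 w hwx ?_).trans (hE2 hwr)⟩
    rintro rfl; exact hwr hq


theorem pieceL {U : Set Pt} (hU : GP U) {blue : Pt → Prop} {k n : ℕ}
    (IH : ∀ T : Finset Pt, T.card < n → P5 U blue k T ∧ P5a U blue k T)
    (l : List Pt) (hnd : l.Nodup) (hln : l.length < n) (hl : ∀ p ∈ l, p ∈ U) {q : Pt} (hqU : q ∈ U)
    (hql : q ∉ l) (hq : blue q) (hw : wl blue k l = -1) {x : Pt} (hxT : x ∈ l)
    (hx : ¬ blue x) (ε : ℝ) (hs : ∀ t ∈ l, t ≠ x → 0 < ε * odet q x t) (w : Pt) :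
    ∃ E, Tr blue k (insert q l.toFinset) E ∧ dg E q ≤ 1 ∧ (¬ blue w → dg E w ≤ 2) := by
  refine piece hU IH l.toFinset ?_ ?_ hqU (by simpa using hql) hq ?_ (x := x) (by simpa using hxT)
    hx ε ?_ w
  · rw [List.toFinset_card_of_nodup hnd]; exact hln
  · intro p hp; exact hl p (by simpa using hp)
  · rw [ws_toFinset _ _ hnd]; exact hw
  · intro t ht; exact hs t (by simpa using ht)

theorem joinq {U : Set Pt} (hU : GP U) {blue : Pt → Prop} {k : ℕ} {A C : Finset Pt} {q x : Pt}
    (hAU : (A : Set Pt) ⊆ U) (hqU : q ∈ U) (hq : blue q) {E F : Finset (Pt × Pt)}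
    (hE : Tr blue k (insert q A) E) (hF : Tr blue k (insert q C) F) (ε : ℝ)
    (hA : ∀ a ∈ A, ε * odet q x a ≤ 0) (hC : ∀ c ∈ C, 0 < ε * odet q x c) {i j : ℕ} (w : Pt)
    (hi : dg E q ≤ i) (hj : dg F q ≤ j) (hij : i + j ≤ k + 1)
    (hwE : ¬ blue w → dg E w ≤ 2) (hwF : ¬ blue w → dg F w ≤ 2) :
    ∃ G, Tr blue k (insert q (A ∪ C)) G ∧ dg G q ≤ i + j ∧ (¬ blue w → dg G w ≤ 2) := by
  obtain ⟨g1, g2⟩ := hE.glue hU hF (by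
      intro p hp
      rw [Finset.coe_insert] at hp
      rcases hp with rfl | hp
      · exact hqU
      · exact hAU hp) ε q x q (by simp) (by simp) (by simp)
    (by intro s hs
        rcases Finset.mem_insert.1 hs with rfl | hs
        · simp
        · exact hA s hs)
    (by intro s hs hne
        rcases Finset.mem_insert.1 hs with rfl | hs
        · exact absurd rfl hne
        · exact hC s hs)
    (by rw [cap_blue hq]; omega)
  have : (insert q A ∪ insert q C : Finset Pt) = insert q (A ∪ C) := by
    ext p; simp only [Finset.mem_union, Finset.mem_insert]; tauto
  rw [this] at g1
  refine ⟨_, g1, (dg_union _ _ _).trans (by omega), fun h => g2 w ?_ 2 (hwE h) (hwF h)⟩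
  rintro rfl; exact h hq

theorem P1 {U : Set Pt} (hU : GP U) {blue : Pt → Prop} {k n : ℕ} (hk : 2 ≤ k)
    (IH : ∀ T : Finset Pt, T.card < n → P5 U blue k T ∧ P5a U blue k T)
    {q : Pt} (hqU : q ∈ U) (hq : blue q) (ε : ℝ) (w : Pt) (i : ℕ) (hi : 2 ≤ i) :
    i ≤ k + 1 → ∀ l : List Pt, l.Pairwise (fun a b => 0 < ε * odet q a b) → l.length < n →
    (∀ p ∈ l, p ∈ U) → q ∉ l → wl blue k l = -(i : ℤ) →
    ∃ E, Tr blue k (insert q l.toFinset) E ∧ dg E q ≤ i ∧ (¬ blue w → dg E w ≤ 2) := by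
  induction i, hi using Nat.le_induction with
  | base =>
    intro _ l hl hln hlU hql hwl
    obtain ⟨A, x, y, A', rfl, hx, hy, hA, hA'⟩ := hit_two hk (by simpa using hwl)
    obtain ⟨c1, c2, c3, c4⟩ := sorted_cut hl
    have hyA : (y :: A').Nodup := sorted_nodup c4
    have hAx : (A ++ [x]).Nodup :=
      (sorted_nodup hl).sublist (by simp)
    rw [List.pairwise_cons] at c4
    simp only [List.length_append, List.length_cons] at hln
    obtain ⟨E, hE, hE1, hE2⟩ := pieceL hU IH (A ++ [x]) hAx (by simp; omega)
      (fun p hp => hlU p (by clear * - hp; simp at hp ⊢; tauto)) hqU (by clear * - hql; simp at hql ⊢; tauto) hq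
      (by rw [wl_append, wl_cons, wl_nil, wt_red hx, hA]; norm_num) (x := x) (by simp) hx (-ε)
      (by intro t ht htx
          have := c1 t (by simpa [htx] using ht)
          rw [odet_swap]; linarith) w
    obtain ⟨F, hF, hF1, hF2⟩ := pieceL hU IH (y :: A') hyA (by simp; omega)
      (fun p hp => hlU p (by clear * - hp; simp at hp ⊢; tauto)) hqU (by clear * - hql; simp at hql ⊢; tauto) hq
      (by rw [wl_cons, wt_red hy, hA']; norm_num) (x := y) (by simp) hy ε
      (by intro t ht htx
          exact c4.1 t (by simpa [htx] using ht)) w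
    obtain ⟨G, hG, hG1, hG2⟩ := joinq hU (x := x) (by
        intro p hp; exact hlU p (by clear * - hp; simp at hp ⊢; tauto)) hqU hq hE hF ε
      (by intro a ha
          simp only [List.toFinset_append, Finset.mem_union, List.mem_toFinset,
            List.mem_singleton] at ha
          rcases ha with ha | rfl
          · have := c1 a ha; rw [odet_swap]; linarith
          · simp)
      (by intro c hc; exact c2 c (by simpa using hc)) w hE1 hF1 (by omega) hE2 hF2
    refine ⟨G, ?_, hG1, hG2⟩
    have : (A ++ [x]).toFinset ∪ (y :: A').toFinset = (A ++ x :: y :: A').toFinset := by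
      ext p; simp; try tauto
    rw [← this]; exact hG
  | succ i hi ih =>
    intro hik l hl hln hlU hql hwl
    obtain ⟨A, x, A', rfl, hx, hA, -⟩ := hit_one (l := l) hk (by rw [hwl]; push_cast; omega)
    obtain ⟨c1, c2, c3, c4⟩ := sorted_cut hl
    have hAx : (A ++ [x]).Nodup :=
      (sorted_nodup hl).sublist (by simp)
    simp only [List.length_append, List.length_cons] at hln
    obtain ⟨E, hE, hE1, hE2⟩ := pieceL hU IH (A ++ [x]) hAx (by simp; omega)
      (fun p hp => hlU p (by clear * - hp; simp at hp ⊢; tauto)) hqU (by clear * - hql; simp at hql ⊢; tauto) hq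
      (by rw [wl_append, wl_cons, wl_nil, wt_red hx, hA]; norm_num) (x := x) (by simp) hx (-ε)
      (by intro t ht htx
          have := c1 t (by simpa [htx] using ht)
          rw [odet_swap]; linarith) w
    obtain ⟨F, hF, hF1, hF2⟩ := ih (by omega) A' c4 (by omega)
      (fun p hp => hlU p (by clear * - hp; simp at hp ⊢; tauto)) (by clear * - hql; simp at hql ⊢; tauto)
      (by rw [wl_append, wl_cons, wt_red hx, hA] at hwl; push_cast at hwl; linarith)
    obtain ⟨G, hG, hG1, hG2⟩ := joinq hU (x := x) (by
        intro p hp; exact hlU p (by clear * - hp; simp at hp ⊢; tauto)) hqU hq hE hF ε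
      (by intro a ha
          simp only [List.toFinset_append, Finset.mem_union, List.mem_toFinset,
            List.mem_singleton] at ha
          rcases ha with ha | ha
          · have := c1 a ha; rw [odet_swap]; linarith
          · subst ha; simp)
      (by intro c hc; exact c2 c (by simpa using hc)) w hE1 hF1 (by omega) hE2 hF2
    refine ⟨G, ?_, by omega, hG2⟩
    have : (A ++ [x]).toFinset ∪ A'.toFinset = (A ++ x :: A').toFinset := by
      ext p; simp; try tauto
    rw [← this]; exact hG

theorem P5a_step {U : Set Pt} (hU : GP U) {blue : Pt → Prop} {k : ℕ} (hk : 2 ≤ k)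
    (S : Finset Pt)
    (IH : ∀ T : Finset Pt, T.card < S.card → P5 U blue k T ∧ P5a U blue k T) :
    P5a U blue k S := by
  intro hSU hw r hr q hqS hrr hq ε a b h0 h1 h2 w
  have hrq : r ≠ q := fun h => hrr (h ▸ hq)
  set T := (S.erase r).erase q with hT
  have hTm : ∀ p, p ∈ T ↔ p ≠ q ∧ p ≠ r ∧ p ∈ S := by
    intro p; simp [hT]
  have hqr : q ∈ S.erase r := by simp [hrq.symm, hqS]
  have hwT : ws blue k T = -(k : ℤ) := by
    have e1 : ws blue k (S.erase r) + wt blue k r = ws blue k S :=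
      Finset.sum_erase_add _ _ hr
    have e2 : ws blue k T + wt blue k q = ws blue k (S.erase r) :=
      Finset.sum_erase_add _ _ hqr
    rw [wt_red hrr] at e1
    rw [wt_blue hq] at e2
    linarith
  have hTc : T.card < S.card :=
    (Finset.card_lt_card (Finset.erase_ssubset hqr)).trans
      (Finset.card_lt_card (Finset.erase_ssubset hr))
  have hTU : (T : Set Pt) ⊆ U := fun p hp => hSU ((hTm p).1 hp).2.2
  have hTl : ∀ s ∈ T, 0 < ε * odet a b s := fun s hs =>
    h2 s ((hTm s).1 hs).2.2 ((hTm s).1 hs).2.1 ((hTm s).1 hs).1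
  obtain ⟨l, l1, l2, l3⟩ := exists_sorted hU q (hSU hqS) 1 one_ne_zero T hTU (by simp [hT])
    (HExt.of_line_gen ε h0 (fun s hs _ => hTl s hs))
  obtain ⟨E, hE, hE1, hE2⟩ := P1 hU hk IH (hSU hqS) hq 1 w k hk (by omega) l l3
    (by rw [← List.toFinset_card_of_nodup l1, l2]; exact hTc)
    (fun p hp => hTU (by rw [← l2]; simpa using hp))
    (by rw [← List.mem_toFinset, l2]; simp [hT])
    (by rw [← ws_toFinset _ _ l1, l2, hwT])
  rw [l2] at hE
  obtain ⟨ed, edd⟩ := Tr.edge blue k hrr hq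
  obtain ⟨g1, g2⟩ := ed.glue hU hE
    (by intro p hp
        simp only [Finset.coe_insert, Finset.coe_singleton, Set.mem_insert_iff,
          Set.mem_singleton_iff] at hp
        rcases hp with rfl | rfl
        · exact hSU hr
        · exact hSU hqS) ε a b q (by simp) (by simp) h0
    (by intro s hs
        simp only [Finset.mem_insert, Finset.mem_singleton] at hs
        rcases hs with rfl | rfl
        · exact h1
        · rw [h0]; simp)
    (by intro s hs hne
        rcases Finset.mem_insert.1 hs with h | h
        · exact absurd h hne
        · exact hTl s h)
    (by rw [cap_blue hq]; have := edd q; omega)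
  have hS : ({r, q} ∪ insert q T : Finset Pt) = S := by
    ext p; simp only [Finset.mem_union, Finset.mem_insert, Finset.mem_singleton, hTm]
    constructor
    · rintro ((rfl | rfl) | rfl | h) <;> tauto
    · tauto
  rw [hS] at g1
  refine ⟨_, g1, ?_, fun h => g2 w ?_ 2 ((edd w).trans (by norm_num)) (hE2 h)⟩
  · refine (hE.1.dg_union_left ?_).trans (edd r)
    simp [hTm, hrq]
  · rintro rfl; exact h hq


/-- A tree on `c` and one side. -/
def NSd (blue : Pt → Prop) (k : ℕ) (c : Pt) (M : Finset Pt) (j : ℕ) (w : Pt) : Prop :=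
  ∃ E, Tr blue k (insert c M) E ∧ dg E c ≤ j ∧ (¬ blue w → dg E w ≤ 2)

/-- A tree on `r`, `c` and a set `M`. -/
def FullP (blue : Pt → Prop) (k : ℕ) (r c : Pt) (M : Finset Pt) (a b : ℕ) (w : Pt) : Prop :=
  ∃ E, Tr blue k (insert r (insert c M)) E ∧ dg E r ≤ a ∧ dg E c ≤ b ∧ (¬ blue w → dg E w ≤ 2)

/-- A side split in a part attached to `r` and a part attached to `c`. -/
structure Stuck (blue : Pt → Prop) (k : ℕ) (r c : Pt) (M : Finset Pt) (w : Pt)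
    (P Q : Finset Pt) (x : Pt) (δ : ℝ) : Prop where
  un : P ∪ Q = M
  rs : 0 < δ * odet c x r
  ps : ∀ p ∈ P, 0 < δ * odet c x p
  qs : ∀ p ∈ Q, δ * odet c x p ≤ 0
  e1 : ∃ E, Tr blue k (insert r P) E ∧ dg E r ≤ 1 ∧ (¬ blue w → dg E w ≤ 2)
  e2 : ∃ E, Tr blue k (insert c Q) E ∧ dg E c ≤ 1 ∧ (¬ blue w → dg E w ≤ 2)
  b : w ∉ P → FullP blue k r c M 1 2 w

theorem ins_sub {U : Set Pt} {r : Pt} {M : Finset Pt} (hr : r ∈ U) (hM : (M : Set Pt) ⊆ U) :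
    ((insert r M : Finset Pt) : Set Pt) ⊆ U := by
  rw [Finset.coe_insert]
  exact Set.insert_subset hr hM

theorem add_ns {U : Set Pt} (hU : GP U) {blue : Pt → Prop} {k : ℕ} {r c : Pt} (hrU : r ∈ U)
    (hcU : c ∈ U) (hr : ¬ blue r) (hc : blue c) {M M' : Finset Pt} (hM : (M : Set Pt) ⊆ U)
    {a b j : ℕ} {w : Pt} (h1 : FullP blue k r c M a b w) (h2 : NSd blue k c M' j w) (ε : ℝ)
    (s1 : ∀ m ∈ M, ε * odet c r m ≤ 0) (s2 : ∀ m ∈ M', 0 < ε * odet c r m)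
    (hbj : b + j ≤ k + 1) : FullP blue k r c (M ∪ M') a (b + j) w := by
  obtain ⟨E, hE, e1, e2, e3⟩ := h1
  obtain ⟨F, hF, f1, f2⟩ := h2
  have hrc : r ≠ c := fun h => hr (h ▸ hc)
  have hrM : r ∉ insert c M' := by
    intro h
    rcases Finset.mem_insert.1 h with h | h
    · exact hrc h
    · have := s2 r h; simp at this
  obtain ⟨g1, g2⟩ := hE.glue hU hF (ins_sub hrU (ins_sub hcU hM)) ε c r c (by simp) (by simp)
    (by simp)
    (by intro s hs
        rcases Finset.mem_insert.1 hs with rfl | hs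
        · simp
        rcases Finset.mem_insert.1 hs with rfl | hs
        · simp
        exact s1 s hs)
    (by intro s hs hne
        rcases Finset.mem_insert.1 hs with rfl | hs
        · exact absurd rfl hne
        exact s2 s hs)
    (by rw [cap_blue hc]; omega)
  have hset : insert r (insert c M) ∪ insert c M' = insert r (insert c (M ∪ M')) := by
    clear * -; ext p; simp only [Finset.mem_union, Finset.mem_insert]; tauto
  rw [hset] at g1
  refine ⟨_, g1, (hF.1.dg_union_left hrM).trans e1, (dg_union _ _ _).trans (by omega), fun h => ?_⟩
  exact g2 w (fun e => h (e ▸ hc)) 2 (e3 h) (f2 h)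

theorem stuck_join {U : Set Pt} (hU : GP U) {blue : Pt → Prop} {k : ℕ} (hk : 2 ≤ k) {r c : Pt}
    (hcU : c ∈ U) (hr : ¬ blue r) (hc : blue c) {P Q : Finset Pt} (hQ : (Q : Set Pt) ⊆ U)
    {a : ℕ} {w x : Pt} (δ : ℝ) (h1 : FullP blue k r c P a 1 w) (h2 : NSd blue k c Q 1 w)
    (rs : 0 < δ * odet c x r) (ps : ∀ p ∈ P, 0 < δ * odet c x p)
    (qs : ∀ p ∈ Q, δ * odet c x p ≤ 0) : FullP blue k r c (P ∪ Q) a 2 w := by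
  obtain ⟨E, hE, e1, e2, e3⟩ := h1
  obtain ⟨F, hF, f1, f2⟩ := h2
  have hrc : r ≠ c := fun h => hr (h ▸ hc)
  have hrM : r ∉ insert c Q := by
    intro h
    rcases Finset.mem_insert.1 h with h | h
    · exact hrc h
    · have := qs r h; linarith
  obtain ⟨g1, g2⟩ := hF.glue hU hE (ins_sub hcU hQ) δ c x c (by simp) (by simp)
    (by simp)
    (by intro s hs
        rcases Finset.mem_insert.1 hs with rfl | hs
        · simp
        exact qs s hs)
    (by intro s hs hne
        rcases Finset.mem_insert.1 hs with rfl | hs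
        · exact rs
        rcases Finset.mem_insert.1 hs with rfl | hs
        · exact absurd rfl hne
        exact ps s hs)
    (by rw [cap_blue hc]; omega)
  have hset : insert c Q ∪ insert r (insert c P) = insert r (insert c (P ∪ Q)) := by
    clear * -; ext p; simp only [Finset.mem_union, Finset.mem_insert]; tauto
  rw [hset] at g1
  refine ⟨_, g1, (hF.1.dg_union_right hrM).trans e1, (dg_union _ _ _).trans (by omega), fun h => ?_⟩
  exact g2 w (fun e => h (e ▸ hc)) 2 (f2 h) (e3 h)

theorem full_edge {blue : Pt → Prop} {k : ℕ} {r c : Pt} (hr : ¬ blue r) (hc : blue c) (w : Pt) :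
    FullP blue k r c ∅ 1 1 w := by
  obtain ⟨ed, edd⟩ := Tr.edge blue k hr hc
  exact ⟨_, ed, edd r, edd c, fun _ => (edd w).trans (by norm_num)⟩

/-- Adding a tree at `r`. -/
theorem add_r {U : Set Pt} (hU : GP U) {blue : Pt → Prop} {k : ℕ} {r c : Pt} (hrU : r ∈ U)
    (hcU : c ∈ U) (hr : ¬ blue r) (hc : blue c) {M P : Finset Pt} (hM : (M : Set Pt) ⊆ U)
    {b : ℕ} {w : Pt} {E F : Finset (Pt × Pt)} (hE : Tr blue k (insert r (insert c M)) E)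
    (hF : Tr blue k (insert r P) F) (er : dg E r ≤ 1) (ec : dg E c ≤ b) (fr : dg F r ≤ 1)
    (ew : ¬ blue w → dg E w ≤ 2) (fw : ¬ blue w → dg F w ≤ 2) (ε : ℝ)
    (s1 : ∀ m ∈ M, ε * odet c r m ≤ 0) (s2 : ∀ m ∈ P, 0 < ε * odet c r m) :
    Tr blue k (insert r (insert c (M ∪ P))) (E ∪ F) ∧ dg (E ∪ F) r ≤ 2 ∧ dg (E ∪ F) c ≤ b ∧
      (¬ blue w → dg (E ∪ F) w ≤ 2) := by
  have hrc : r ≠ c := fun h => hr (h ▸ hc)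
  have hcP : c ∉ insert r P := by
    intro h
    rcases Finset.mem_insert.1 h with h | h
    · exact hrc h.symm
    · have := s2 c h; simp at this
  obtain ⟨g1, g2⟩ := hE.glue hU hF (ins_sub hrU (ins_sub hcU hM)) ε c r r (by simp) (by simp)
    (by simp)
    (by intro s hs
        rcases Finset.mem_insert.1 hs with rfl | hs
        · simp
        rcases Finset.mem_insert.1 hs with rfl | hs
        · simp
        exact s1 s hs)
    (by intro s hs hne
        rcases Finset.mem_insert.1 hs with rfl | hs
        · exact absurd rfl hne
        exact s2 s hs)
    (by rw [cap_red hr]; omega)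
  have hset : insert r (insert c M) ∪ insert r P = insert r (insert c (M ∪ P)) := by
    clear * -; ext p; simp only [Finset.mem_union, Finset.mem_insert]; tauto
  rw [hset] at g1
  have hr2 : dg (E ∪ F) r ≤ 2 := (dg_union _ _ _).trans (by omega)
  refine ⟨g1, hr2, (hF.1.dg_union_left hcP).trans ec, fun h => ?_⟩
  by_cases hwr : w = r
  · rw [hwr]; exact hr2
  · exact g2 w hwr 2 (ew h) (fw h)

theorem stuckA {U : Set Pt} (hU : GP U) {blue : Pt → Prop} {k : ℕ} (hk : 2 ≤ k) {r c : Pt}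
    (hrU : r ∈ U) (hcU : c ∈ U) (hr : ¬ blue r) (hc : blue c) {M P Q : Finset Pt}
    (hM : (M : Set Pt) ⊆ U) {w x : Pt} {δ : ℝ} (h : Stuck blue k r c M w P Q x δ)
    (ε : ℝ) (s : ∀ m ∈ M, 0 < ε * odet c r m) : FullP blue k r c M 2 2 w := by
  obtain ⟨un, rs, ps, qs, ⟨E, hE, e1, e2⟩, h2, -⟩ := h
  subst un
  obtain ⟨F, hF, f1, f2, f3⟩ := full_edge (k := k) hr hc w
  obtain ⟨g1, g2, g3, g4⟩ := add_r hU hrU hcU hr hc (by simp) hF hE f1 f2 e1 f3 e2 ε (by simp)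
    (fun m hm => s m (by simp [hm]))
  rw [Finset.empty_union] at g1
  exact stuck_join hU hk hcU hr hc (fun p hp => hM (by clear * - hp; simp at hp ⊢; tauto)) δ
    ⟨_, g1, g2, g3, g4⟩ h2 rs ps qs

theorem add_stuck {U : Set Pt} (hU : GP U) {blue : Pt → Prop} {k : ℕ} (hk : 2 ≤ k) {r c : Pt}
    (hrU : r ∈ U) (hcU : c ∈ U) (hr : ¬ blue r) (hc : blue c) {M M' P Q : Finset Pt}
    (hM : (M : Set Pt) ⊆ U) (hM' : (M' : Set Pt) ⊆ U) {w x : Pt} {δ : ℝ}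
    (h1 : FullP blue k r c M 1 2 w)
    (h : Stuck blue k r c M' w P Q x δ)
    (ε : ℝ) (s1 : ∀ m ∈ M, ε * odet c r m ≤ 0) (s2 : ∀ m ∈ M', 0 < ε * odet c r m) :
    FullP blue k r c (M ∪ M') 2 3 w := by
  obtain ⟨un, rs, ps, qs, ⟨F, hF, f1, f2⟩, ⟨G, hG, d1, d2⟩, -⟩ := h
  subst un
  obtain ⟨E, hE, e1, e2, e3⟩ := h1
  have hPs : ∀ m ∈ P, 0 < ε * odet c r m := fun m hm => s2 m (by simp [hm])
  have hQs : ∀ m ∈ Q, 0 < ε * odet c r m := fun m hm => s2 m (by simp [hm])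
  have hQU : (Q : Set Pt) ⊆ U := fun p hp => hM' (by clear * - hp; simp at hp ⊢; tauto)
  obtain ⟨g1, g2, g3, g4⟩ := add_r hU hrU hcU hr hc hM hE hF e1 e2 f1 e3 f2 ε s1 hPs
  have hrc : r ≠ c := fun h => hr (h ▸ hc)
  have nc1 := hE.1.ncross hU hG.1 (ins_sub hrU (ins_sub hcU hM)) ε c r c hcU (by simp)
    (by intro s hs
        rcases Finset.mem_insert.1 hs with rfl | hs
        · simp
        rcases Finset.mem_insert.1 hs with rfl | hs
        · simp
        exact s1 s hs)
    (by intro s hs hne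
        rcases Finset.mem_insert.1 hs with rfl | hs
        · exact absurd rfl hne
        exact hQs s hs)
  have nc2 := hG.1.ncross hU hF.1 (ins_sub hcU hQU) δ c x c hcU (by simp)
    (by intro s hs
        rcases Finset.mem_insert.1 hs with rfl | hs
        · simp
        exact qs s hs)
    (by intro s hs hne
        rcases Finset.mem_insert.1 hs with rfl | hs
        · exact rs
        exact ps s hs)
  have hdis : ∀ v, v ∈ insert r (insert c (M ∪ P)) → v ∈ insert c Q → v = c := by
    intro v hv hv'
    rcases Finset.mem_insert.1 hv' with h | h
    · exact h
    exfalso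
    rcases Finset.mem_insert.1 hv with rfl | hv
    · have := qs v h; linarith
    rcases Finset.mem_insert.1 hv with rfl | hv
    · have := hQs v h; simp at this
    rcases Finset.mem_union.1 hv with hv | hv
    · have := hQs v h; have := s1 v hv; linarith
    · have := qs v h; have := ps v hv; linarith
  have hT := g1.union hG (z := c) (by simp) (by simp)
    (by intro e he f hf
        rcases Finset.mem_union.1 he with he | he
        · exact nc1 e he f hf
        · exact (nc2 f hf e he).symm)
    (by intro v hv hv'
        rw [hdis v hv hv', cap_blue hc]; omega)
  have hset : insert r (insert c (M ∪ P)) ∪ insert c Q = insert r (insert c (M ∪ (P ∪ Q))) := by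
    clear * -; ext p; simp only [Finset.mem_union, Finset.mem_insert]; tauto
  rw [hset] at hT
  refine ⟨_, hT, ?_, ?_, ?_⟩
  · refine (hG.1.dg_union_left ?_).trans g2
    intro h
    exact hrc (hdis r (by simp) h)
  · exact (dg_union _ _ _).trans (by omega)
  · intro hw
    by_cases h : w ∈ insert c Q
    · refine (g1.1.dg_union_right ?_).trans (d2 hw)
      intro h'
      exact hw ((hdis w h' h) ▸ hc)
    · exact (hG.1.dg_union_left h).trans (g4 hw)

theorem side {U : Set Pt} (hU : GP U) {blue : Pt → Prop} {k n : ℕ} (hk : 2 ≤ k)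
    (IH : ∀ T : Finset Pt, T.card < n → P5 U blue k T ∧ P5a U blue k T)
    {r c : Pt} (hrU : r ∈ U) (hcU : c ∈ U) (hr : ¬ blue r) (hc : blue c)
    {M : Finset Pt} (hM : (M : Set Pt) ⊆ U) (hMn : M.card + 2 ≤ n) (ε : ℝ)
    (s : ∀ m ∈ M, 0 < ε * odet c r m) (j : ℕ) (hj : 1 ≤ j) (hjk : j ≤ k)
    (hw : ws blue k M = -(j : ℤ)) (w : Pt) :
    NSd blue k c M j w ∨ (j = 1 ∧ ∃ P Q x δ, Stuck blue k r c M w P Q x δ) := by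
  have hcM : c ∉ M := by
    intro h; have := s c h; simp at this
  have hrM : r ∉ M := by
    intro h; have := s r h; simp at this
  have hrc : r ≠ c := fun h => hr (h ▸ hc)
  have hMne : M.Nonempty := by
    rw [Finset.nonempty_iff_ne_empty]; rintro rfl
    simp [ws] at hw; omega
  obtain ⟨m0, hm0⟩ := hMne
  have hε : ε ≠ 0 := by
    rintro rfl
    have := s m0 hm0; simp at this
  obtain ⟨l, l1, l2, l3⟩ := exists_sorted hU c hcU ε hε M hM hcM
    (HExt.of_line (q := r) (-ε) (fun t ht _ => by rw [odet_swap']; linarith [s t ht]))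
  have hmem : ∀ p, p ∈ l ↔ p ∈ M := by intro p; rw [← l2]; simp
  have hlen : l.length = M.card := by rw [← l2, List.toFinset_card_of_nodup l1]
  have hwl : wl blue k l = -(j : ℤ) := by rw [← ws_toFinset _ _ l1, l2, hw]
  have hlU : ∀ p ∈ l, p ∈ U := fun p hp => hM ((hmem p).1 hp)
  have hcl : c ∉ l := fun h => hcM ((hmem c).1 h)
  by_cases hj2 : 2 ≤ j
  · left
    obtain ⟨E, hE, h1, h2⟩ := P1 hU hk IH hcU hc ε w j hj2 (by omega) l l3 (by omega) hlU hcl hwl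
    rw [l2] at hE
    exact ⟨E, hE, h1, h2⟩
  have hj1 : j = 1 := by omega
  subst hj1
  obtain ⟨P, x, S', hl, hx, hP, hPl⟩ := hit_one (l := l) hk (by rw [hwl]; norm_num)
  cases P with
  | nil =>
    left
    rw [List.nil_append] at hl
    subst hl
    rw [List.pairwise_cons] at l3
    obtain ⟨E, hE, h1, h2⟩ := pieceL hU IH (x :: S') l1 (by omega) hlU hcU hcl hc
      (by simpa using hwl) (x := x) (by simp) hx ε
      (fun t ht htx => l3.1 t (by simpa [htx] using ht)) w
    rw [l2] at hE
    exact ⟨E, hE, h1, h2⟩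
  | cons p1 P0 =>
    by_cases hp1 : ¬ blue p1
    · left
      rw [List.cons_append] at hl
      subst hl
      rw [List.pairwise_cons] at l3
      obtain ⟨E, hE, h1, h2⟩ := pieceL hU IH _ l1 (by omega) hlU hcU hcl hc
        (by simpa using hwl) (x := p1) (by simp) hp1 ε
        (fun t ht htx => l3.1 t (by simpa [htx] using ht)) w
      rw [l2] at hE
      exact ⟨E, hE, h1, h2⟩
    · right
      refine ⟨rfl, ?_⟩
      push Not at hp1
      generalize hPP : p1 :: P0 = P at *
      subst hl
      obtain ⟨c1, c2, c3, c4⟩ := sorted_cut l3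
      have hPM : ∀ p ∈ P, p ∈ M := fun p hp => (hmem p).1 (by simp [hp])
      have hSM : ∀ p ∈ x :: S', p ∈ M := fun p hp =>
        (hmem p).1 (List.mem_append_right _ hp)
      have hxM : x ∈ M := hSM x (by simp)
      have hPnd : P.Nodup := sorted_nodup c3
      have hSnd : (x :: S').Nodup := l1.sublist (List.sublist_append_right _ _)
      rw [List.length_append, List.length_cons] at hlen
      have hrP : r ∉ P.toFinset := fun h => hrM (hPM r (by simpa using h))
      have hcP : c ∉ P.toFinset := fun h => hcM (hPM c (by simpa using h))
      have hPU : (P.toFinset : Set Pt) ⊆ U := fun p hp => hM (hPM p (by simpa using hp))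
      have hp1P : p1 ∈ P := by rw [← hPP]; simp
      have hPpos : ∀ p ∈ P, p ≠ p1 → 0 < ε * odet c p1 p := by
        intro p hp hne
        rw [← hPP] at c3 hp
        rw [List.pairwise_cons] at c3
        exact c3.1 p (by simpa [hne] using hp)
      have hwS : wl blue k (x :: S') = -1 := by
        rw [wl_append, hP] at hwl; simpa using hwl
      -- trees on r and P
      have tree1 : ∀ w', ∃ E, Tr blue k (insert r P.toFinset) E ∧ dg E r ≤ 1 ∧
          (¬ blue w' → dg E w' ≤ 2) := by
        intro w'
        refine (IH (insert r P.toFinset) ?_).2 (ins_sub hrU hPU) ?_ r (by simp) p1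
          (by simp [hp1P]) hr hp1 ε c p1 (by simp) ?_ ?_ w'
        · rw [Finset.card_insert_of_notMem hrP, List.toFinset_card_of_nodup hPnd]; omega
        · unfold ws
          rw [Finset.sum_insert hrP, wt_red hr]
          have := ws_toFinset blue k hPnd
          unfold ws at this
          rw [this, hP]; norm_num
        · rw [odet_swap]; linarith [s p1 (hPM p1 hp1P)]
        · intro t ht htr htp
          exact hPpos t (by simpa [htr] using ht) htp
      have tree2 : NSd blue k c (x :: S').toFinset 1 w := by
        refine pieceL hU IH (x :: S') hSnd (by simp; omega) (fun p hp => hM (hSM p hp)) hcU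
          (fun h => hcM (hSM c h)) hc hwS (x := x) (by simp) hx ε ?_ w
        intro t ht htx
        exact c2 t (by simpa [htx] using ht)
      have hrs : 0 < -ε * odet c x r := by rw [odet_swap]; linarith [s x hxM]
      have hps : ∀ p ∈ P.toFinset, 0 < -ε * odet c x p := by
        intro p hp
        have := c1 p (by simpa using hp)
        rw [odet_swap]; linarith
      have hqs : ∀ p ∈ (x :: S').toFinset, -ε * odet c x p ≤ 0 := by
        intro p hp
        rw [List.mem_toFinset] at hp
        rcases List.mem_cons.1 hp with rfl | hp
        · simp
        · linarith [c2 p hp]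
      have hun : P.toFinset ∪ (x :: S').toFinset = M := by
        rw [← l2, List.toFinset_append]
      refine ⟨P.toFinset, (x :: S').toFinset, x, -ε, hun, hrs, hps, hqs, tree1 w, tree2, ?_⟩
      intro hwP
      obtain ⟨P1', w1, hP1⟩ : ∃ P1' w1, P = P1' ++ [w1] := by
        rcases List.eq_nil_or_concat P with h | ⟨L, b, h⟩
        · rw [h] at hp1P; simp at hp1P
        · exact ⟨L, b, by simpa using h⟩
      have hw1 : ¬ blue w1 := hPl _ _ hP1
      have hw1P : w1 ∈ P := by rw [hP1]; simp
      have hw1s : ∀ p ∈ P, p ≠ w1 → 0 < -ε * odet c w1 p := by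
        intro p hp hne
        rw [hP1] at hp c3
        have := (sorted_cut c3).1 p (by simpa [hne] using hp)
        rw [odet_swap]; linarith
      obtain ⟨E, hE, e1, e2⟩ := tree1 w1
      obtain ⟨ed, edd⟩ := Tr.edge blue k hw1 hc
      have hw1r : r ≠ w1 := fun h => hrP (by rw [h]; simpa using hw1P)
      have hww1 : w ≠ w1 := fun h => hwP (by rw [h]; simpa using hw1P)
      obtain ⟨g1, g2⟩ := ed.glue hU hE
        (by intro p hp
            simp only [Finset.coe_insert, Finset.coe_singleton, Set.mem_insert_iff,
              Set.mem_singleton_iff] at hp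
            rcases hp with rfl | rfl
            · exact hM (hPM _ hw1P)
            · exact hcU) (-ε) c w1 w1 (by simp) (by simp [hw1P]) (by simp)
        (by intro t ht
            simp only [Finset.mem_insert, Finset.mem_singleton] at ht
            rcases ht with rfl | rfl <;> simp)
        (by intro t ht hne
            rcases Finset.mem_insert.1 ht with rfl | ht
            · rw [odet_swap]; linarith [s w1 (hPM _ hw1P)]
            · exact hw1s t (by simpa using ht) hne)
        (by rw [cap_red hw1]; have := edd w1; have := e2 hw1; omega)
      have hset : {w1, c} ∪ insert r P.toFinset = insert r (insert c P.toFinset) := by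
        have : w1 ∈ P.toFinset := by simpa using hw1P
        clear * - this
        ext p; simp only [Finset.mem_union, Finset.mem_insert, Finset.mem_singleton]
        constructor
        · rintro ((rfl | rfl) | rfl | h) <;> tauto
        · tauto
      rw [hset] at g1
      have hr1 : dg ({(w1, c)} ∪ E) r ≤ 1 :=
        (ed.1.dg_union_right (by simp [hw1r, hrc])).trans e1
      have hfull : FullP blue k r c P.toFinset 1 1 w := by
        refine ⟨_, g1, hr1, ?_, ?_⟩
        · refine (hE.1.dg_union_left ?_).trans (edd c)
          rw [Finset.mem_insert]
          rintro (h | h)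
          · exact hrc h.symm
          · exact hcP h
        · intro hwr
          by_cases h : w = r
          · rw [h]; omega
          · refine (hE.1.dg_union_left ?_).trans ((edd w).trans (by norm_num))
            rw [Finset.mem_insert]; tauto
      rw [← hun]
      exact stuck_join hU hk hcU hr hc
        (fun p hp => hM (hSM p (by simpa using hp))) (-ε) hfull tree2 hrs hps hqs


theorem P5_step {U : Set Pt} (hU : GP U) {blue : Pt → Prop} {k : ℕ} (hk : 2 ≤ k)
    (S : Finset Pt)
    (IH : ∀ T : Finset Pt, T.card < S.card → P5 U blue k T ∧ P5a U blue k T)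
    (hS : P5a U blue k S) : P5 U blue k S := by
  intro hSU hw r hr hrr hext w
  have hrU : r ∈ U := hSU hr
  obtain ⟨l, l1, l2, l3⟩ := exists_sorted hU r hrU 1 one_ne_zero (S.erase r)
    (fun p hp => hSU (Finset.mem_of_mem_erase hp)) (by simp) (hext.mono (Finset.erase_subset _ _))
  have hmem : ∀ p, p ∈ l ↔ p ≠ r ∧ p ∈ S := by
    intro p; rw [← List.mem_toFinset, l2, Finset.mem_erase]
  have hrl : r ∉ l := fun h => ((hmem r).1 h).1 rfl
  have hlU : ∀ p ∈ l, p ∈ U := fun p hp => hSU ((hmem p).1 hp).2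
  have hSl : S = insert r l.toFinset := by rw [l2, Finset.insert_erase hr]
  have hcard : S.card = l.length + 1 := by
    rw [hSl, Finset.card_insert_of_notMem (by simpa using hrl), List.toFinset_card_of_nodup l1]
  have hwl : wl blue k l = 0 := by
    rw [← ws_toFinset _ _ l1, l2]
    have e1 : ws blue k (S.erase r) + wt blue k r = ws blue k S :=
      Finset.sum_erase_add _ _ hr
    rw [wt_red hrr] at e1; linarith
  rcases List.eq_nil_or_concat l with hl0 | ⟨m, z, hlz⟩
  · subst hl0
    have : S = {r} := by rw [hSl]; simp
    rw [this]
    obtain ⟨h1, h2⟩ := Tr.single blue k r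
    exact ⟨∅, h1, by rw [h2]; omega, fun _ => by rw [h2]; omega⟩
  obtain ⟨y, l', hly⟩ : ∃ y l', l = y :: l' := by
    cases l with
    | nil => simp at hlz
    | cons y l' => exact ⟨y, l', rfl⟩
  have hlz' : l = m ++ [z] := by simpa using hlz
  have hyl : y ∈ l := by rw [hly]; simp
  have hzl : z ∈ l := by rw [hlz']; simp
  by_cases hy : blue y
  · obtain ⟨E, h1, h2, h3⟩ := hS hSU hw r hr y ((hmem y).1 hyl).2 hrr hy 1 r y (by simp) (by simp)
      (by intro t ht htr hty
          have : t ∈ l := (hmem t).2 ⟨htr, ht⟩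
          rw [hly] at this l3
          rw [List.pairwise_cons] at l3
          exact l3.1 t (by simpa [hty] using this)) w
    exact ⟨E, h1, by omega, h3⟩
  by_cases hz : blue z
  · obtain ⟨E, h1, h2, h3⟩ := hS hSU hw r hr z ((hmem z).1 hzl).2 hrr hz (-1) r z (by simp) (by simp)
      (by intro t ht htr hty
          have : t ∈ l := (hmem t).2 ⟨htr, ht⟩
          rw [hlz'] at this l3
          have := (sorted_cut l3).1 t (by simpa [hty] using this)
          rw [odet_swap]; linarith) w
    exact ⟨E, h1, by omega, h3⟩
  obtain ⟨A, c, A', hl, hc, hA1, hA2, hA3⟩ := transition hk hy hz (by rw [hly]; simp) hlz' hwl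
  clear hly hlz hlz' hyl hzl
  subst hl
  obtain ⟨c1, c2, c3, c4⟩ := sorted_cut l3
  have hAnd : A.Nodup := sorted_nodup c3
  have hAnd' : A'.Nodup := sorted_nodup c4
  have hcAnd : (c :: A').Nodup := l1.sublist (List.sublist_append_right _ _)
  have hcU : c ∈ U := hlU c (by simp)
  have hrA : r ∉ A := fun h => hrl (by simp [h])
  have hrc : r ≠ c := fun h => hrr (h ▸ hc)
  have hrA' : r ∉ c :: A' := fun h => hrl (List.mem_append_right _ h)
  have hAU : (A.toFinset : Set Pt) ⊆ U := fun p hp =>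
    hlU p (List.mem_append_left _ (by simpa using hp))
  have hcAU : ((c :: A').toFinset : Set Pt) ⊆ U := fun p hp =>
    hlU p (List.mem_append_right _ (by simpa using hp))
  have hAU' : (A'.toFinset : Set Pt) ⊆ U := fun p hp =>
    hcAU (by clear * - hp; simp at hp ⊢; tauto)
  rw [List.length_append, List.length_cons] at hcard
  have hwA' : wl blue k A + k + wl blue k A' = 0 := by
    rw [wl_append, wl_cons, wt_blue hc] at hwl; linarith
  by_cases hA0 : wl blue k A = 0
  · obtain ⟨A0, d, hAd, hd⟩ := hA3 hA0
    have hdA : d ∈ A := by rw [hAd]; simp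
    have hApos : 0 < A.length := List.length_pos_of_mem hdA
    have hds : ∀ t ∈ A, t ≠ d → 0 < -1 * odet r d t := by
      intro t ht htd
      rw [hAd] at ht c3
      have := (sorted_cut c3).1 t (by simpa [htd] using ht)
      rw [odet_swap]; linarith
    have hds' : ∀ t ∈ c :: A', 0 < 1 * odet r d t := by
      intro t ht
      rw [List.pairwise_append] at l3
      exact l3.2.2 d hdA t ht
    obtain ⟨E, hE, e1, e2⟩ := (IH (insert r A.toFinset) (by
        rw [Finset.card_insert_of_notMem (by simpa using hrA), List.toFinset_card_of_nodup hAnd]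
        omega)).2 (ins_sub hrU hAU) (by
        have := ws_toFinset blue k hAnd
        unfold ws at this ⊢
        rw [Finset.sum_insert (by simpa using hrA), wt_red hrr, this, hA0]; norm_num)
      r (by simp) d (by simp [hdA]) hrr hd (-1) r d (by simp) (by simp)
      (by intro t ht htr htd
          exact hds t (by simpa [htr] using ht) htd) w
    obtain ⟨F, hF, f1, f2⟩ := (IH (insert r (c :: A').toFinset) (by
        rw [Finset.card_insert_of_notMem (by simpa using hrA'),
          List.toFinset_card_of_nodup hcAnd, List.length_cons]
        omega)).2 (ins_sub hrU hcAU) (by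
        have := ws_toFinset blue k hcAnd
        unfold ws at this ⊢
        rw [Finset.sum_insert (by simpa using hrA'), wt_red hrr, this, wl_cons, wt_blue hc]
        linarith)
      r (by simp) c (by simp) hrr hc 1 r c (by simp) (by simp)
      (by intro t ht htr htd
          exact c2 t (by simpa [htr, htd] using ht)) w
    obtain ⟨g1, g2⟩ := hE.glue hU hF (ins_sub hrU hAU) 1 r d r (by simp) (by simp) (by simp)
      (by intro t ht
          rcases Finset.mem_insert.1 ht with rfl | ht
          · simp
          by_cases htd : t = d
          · subst htd; simp
          · linarith [hds t (by simpa using ht) htd])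
      (by intro t ht hne
          rcases Finset.mem_insert.1 ht with rfl | ht
          · exact absurd rfl hne
          · exact hds' t (by simpa using ht))
      (by rw [cap_red hrr]; omega)
    have hset : insert r A.toFinset ∪ insert r (c :: A').toFinset = S := by
      rw [hSl, List.toFinset_append]
      clear * -
      ext p; simp only [Finset.mem_union, Finset.mem_insert]; tauto
    rw [hset] at g1
    have hr2 : dg (E ∪ F) r ≤ 2 := (dg_union _ _ _).trans (by omega)
    refine ⟨_, g1, hr2, fun h => ?_⟩
    by_cases hwr : w = r
    · rw [hwr]; exact hr2
    · exact g2 w hwr 2 (e2 h) (f2 h)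
  · obtain ⟨i, hi⟩ : ∃ i : ℕ, wl blue k A = -(i : ℤ) := ⟨(wl blue k A).natAbs, by omega⟩
    have hi1 : 1 ≤ i := by omega
    have hik : i + 1 ≤ k := by omega
    have sA : ∀ m ∈ A.toFinset, 0 < (1 : ℝ) * odet c r m := by
      intro m hm
      have := c1 m (by simpa using hm)
      rw [← odet_rot c r m, ]; exact this
    have sA' : ∀ m ∈ A'.toFinset, 0 < (-1 : ℝ) * odet c r m := by
      intro m hm
      have := c2 m (by simpa using hm)
      rw [odet_swap']; linarith
    have nA : ∀ m ∈ A.toFinset, (-1 : ℝ) * odet c r m ≤ 0 := fun m hm => by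
      linarith [sA m hm]
    have nA' : ∀ m ∈ A'.toFinset, (1 : ℝ) * odet c r m ≤ 0 := fun m hm => by
      linarith [sA' m hm]
    suffices h : ∃ a b, a ≤ 2 ∧ FullP blue k r c (A.toFinset ∪ A'.toFinset) a b w by
      obtain ⟨a, b, ha, E, hE, e1, -, e3⟩ := h
      have hset : insert r (insert c (A.toFinset ∪ A'.toFinset)) = S := by
        rw [hSl, List.toFinset_append, List.toFinset_cons]
        clear * -
        ext p; simp only [Finset.mem_union, Finset.mem_insert]; tauto
      rw [hset] at hE
      exact ⟨E, hE, by omega, e3⟩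
    have sd := side hU hk IH hrU hcU hrr hc hAU
      (by rw [List.toFinset_card_of_nodup hAnd]; omega) 1 sA i hi1 (by omega)
      (by rw [ws_toFinset _ _ hAnd, hi]) w
    have sd' := side hU hk IH hrU hcU hrr hc hAU'
      (by rw [List.toFinset_card_of_nodup hAnd']; omega) (-1) sA' (k - i) (by omega) (by omega)
      (by rw [ws_toFinset _ _ hAnd']; omega) w
    rcases sd with n1 | ⟨i1, P, Q, x, δ, t1⟩ <;> rcases sd' with n2 | ⟨i2, P', Q', x', δ', t2⟩
    · have f0 := full_edge (k := k) hrr hc w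
      have f1 := add_ns hU hrU hcU hrr hc (by simp) f0 n1 1 (by simp) sA (by omega)
      rw [Finset.empty_union] at f1
      exact ⟨_, _, by norm_num, add_ns hU hrU hcU hrr hc hAU f1 n2 (-1) nA sA' (by omega)⟩
    · have f1 := stuckA hU hk hrU hcU hrr hc hAU' t2 (-1) sA'
      rw [Finset.union_comm]
      exact ⟨_, _, le_rfl, add_ns hU hrU hcU hrr hc hAU' f1 n1 1 nA' sA (by omega)⟩
    · have f1 := stuckA hU hk hrU hcU hrr hc hAU t1 1 sA
      exact ⟨_, _, le_rfl, add_ns hU hrU hcU hrr hc hAU f1 n2 (-1) nA sA' (by omega)⟩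
    · by_cases hwP : w ∈ P
      · have hwP' : w ∉ P' := by
          intro h
          have h1 : w ∈ A.toFinset := t1.un ▸ Finset.mem_union_left _ hwP
          have h2 : w ∈ A'.toFinset := t2.un ▸ Finset.mem_union_left _ h
          linarith [sA w h1, sA' w h2]
        rw [Finset.union_comm]
        exact ⟨_, _, le_rfl, add_stuck hU hk hrU hcU hrr hc hAU' hAU (t2.b hwP') t1 1 nA' sA⟩
      · exact ⟨_, _, le_rfl, add_stuck hU hk hrU hcU hrr hc hAU hAU' (t1.b hwP) t2 (-1) nA sA'⟩

theorem P5_all {U : Set Pt} (hU : GP U) {blue : Pt → Prop} {k : ℕ} (hk : 2 ≤ k) :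
    ∀ n (S : Finset Pt), S.card = n → P5 U blue k S ∧ P5a U blue k S := by
  intro n
  induction n using Nat.strong_induction_on with
  | _ n ih =>
    rintro S rfl
    have IH : ∀ T : Finset Pt, T.card < S.card → P5 U blue k T ∧ P5a U blue k T :=
      fun T hT => ih _ hT T rfl
    have h := P5a_step hU hk S IH
    exact ⟨P5_step hU hk S IH h, h⟩


theorem gp_of_genPos {U : Set Pt} (h : GenPos U) : GP U := by
  intro a ha b hb c hc hab hac hbc h0
  refine h a ha b hb c hc hab hac hbc ?_
  rw [collinear_iff_of_mem (p₀ := a) (by simp)]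
  refine ⟨b - a, ?_⟩
  unfold odet at h0
  intro p hp
  simp only [Set.mem_insert_iff, Set.mem_singleton_iff] at hp
  rcases hp with rfl | rfl | rfl
  · exact ⟨0, by simp⟩
  · exact ⟨1, by simp⟩
  · by_cases h1 : b.1 - a.1 = 0
    · have h2 : b.2 - a.2 ≠ 0 := by
        intro h2
        exact hab (Prod.ext (by linarith) (by linarith))
      refine ⟨(p.2 - a.2) / (b.2 - a.2), ?_⟩
      have h3 : p.1 - a.1 = 0 := by
        rw [h1] at h0
        have : (b.2 - a.2) * (p.1 - a.1) = 0 := by linarith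
        exact (mul_eq_zero.1 this).resolve_left h2
      ext
      · simp [h1]; linarith
      · simp [div_mul_cancel₀ _ h2]
    · refine ⟨(p.1 - a.1) / (b.1 - a.1), ?_⟩
      ext
      · simp [div_mul_cancel₀ _ h1]
      · simp
        field_simp
        linarith

theorem hExt_of_hull {S : Finset Pt} {r : Pt}
    (h : r ∉ convexHull ℝ ((S : Set Pt) \ {r})) : HExt r S := by
  have hfin : ((S : Set Pt) \ {r}).Finite := S.finite_toSet.subset Set.diff_subset
  obtain ⟨f, u, h1, h2⟩ := geometric_hahn_banach_point_closed (convex_convexHull ℝ _)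
    (hfin.isClosed_convexHull ℝ) h
  have hf : ∀ p : Pt, f p = f (1, 0) * p.1 + f (0, 1) * p.2 := by
    intro p
    have : p = p.1 • ((1, 0) : Pt) + p.2 • ((0, 1) : Pt) := by ext <;> simp
    conv_lhs => rw [this, map_add, map_smul, map_smul]
    simp only [smul_eq_mul]; ring
  refine ⟨f (1, 0), f (0, 1), fun s hs hne => ?_⟩
  have h3 := h2 s (subset_convexHull ℝ _ ⟨hs, hne⟩)
  rw [hf s] at h3
  rw [hf r] at h1
  linarith

theorem edges_le {blue : Pt → Prop} {k : ℕ} {S B : Finset Pt} {E : Finset (Pt × Pt)}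
    (h : Tr blue k S E) (hB : ∀ p ∈ S, blue p → p ∈ B) (hB' : ∀ p ∈ B, blue p) :
    E.card ≤ (k + 1) * B.card := by
  rw [Finset.card_eq_sum_card_fiberwise (f := Prod.snd) (t := B) (fun e he =>
    hB _ (h.1.mem e he).2.1 (h.1.mem e he).2.2.2)]
  rw [mul_comm]
  refine Finset.sum_le_card_nsmul _ _ _ (fun b hb => ?_)
  have := h.2 b
  rw [cap_blue (hB' b hb)] at this
  refine le_trans (Finset.card_le_card ?_) this
  intro e he
  simp only [Finset.mem_filter] at he ⊢
  exact ⟨he.1, Or.inr he.2⟩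


/-- correctness of `proc2`. If `|R| = k|B| + 1` with `k ≥ 2`,
`|B| ≥ 1`, `R ∪ B` in general position, and `r ∈ R` is a vertex of the convex hull of
`R ∪ B`, then there is a plane bichromatic tree on `R ∪ B` of maximum degree at most
`k + 1` in which `r` has degree `1` or `2` and every other red vertex has degree at
most `3`. -/
theorem statement_11 (R B : Finset Pt) (hdisj : Disjoint R B)
    (hgp : GenPos (↑(R ∪ B) : Set Pt)) (k : ℕ) (hk : 2 ≤ k) (hB : 1 ≤ B.card)
    (hcard : R.card = k * B.card + 1)
    (r : Pt) (hrR : r ∈ R)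
    (hhull : r ∉ convexHull ℝ ((↑(R ∪ B) : Set Pt) \ {r})) :
    ∃ G : SimpleGraph {x : Pt // x ∈ R ∪ B},
      PlaneBichromTree R B G ∧ (∀ v, deg G v ≤ k + 1) ∧
      (deg G ⟨r, Finset.mem_union_left B hrR⟩ = 1 ∨
        deg G ⟨r, Finset.mem_union_left B hrR⟩ = 2) ∧
      ∀ v : {x : Pt // x ∈ R ∪ B}, v.1 ∈ R → v.1 ≠ r → deg G v ≤ 3 := by
  have hU := gp_of_genPos hgp
  obtain ⟨E, hE, hEr, -⟩ := (P5_all (blue := fun p => p ∈ B) hU hk _ (R ∪ B) rfl).1 le_rfl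
    (by
      unfold ws
      rw [Finset.sum_union hdisj, Finset.sum_congr (g := fun _ => (-1 : ℤ)) rfl
        (fun p hp => wt_red (Finset.disjoint_left.1 hdisj hp)),
        Finset.sum_congr (s₁ := B) (g := fun _ => (k : ℤ)) rfl (fun p hp => wt_blue hp)]
      simp only [Finset.sum_const, nsmul_eq_mul]
      rw [hcard]; push_cast; ring)
    r (Finset.mem_union_left B hrR) (Finset.disjoint_left.1 hdisj hrR) (hExt_of_hull hhull) r
  have hmem := hE.1.mem
  have hRB : ∀ p, p ∈ R ∪ B → p ∉ B → p ∈ R := by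
    intro p hp hpB
    exact (Finset.mem_union.1 hp).resolve_right hpB
  let G : SimpleGraph {x : Pt // x ∈ R ∪ B} :=
    { Adj := fun u v => (u.1, v.1) ∈ E ∨ (v.1, u.1) ∈ E
      symm := ⟨fun u v h => h.symm⟩
      loopless := ⟨fun u h => by
        rcases h with h | h <;> exact (hmem _ h).2.2.1 (hmem _ h).2.2.2⟩ }
  have hadj : ∀ u v, G.Adj u v ↔ ((u.1, v.1) ∈ E ∨ (v.1, u.1) ∈ E) := fun u v => Iff.rfl
  have hne : Nonempty {x : Pt // x ∈ R ∪ B} := ⟨⟨r, Finset.mem_union_left B hrR⟩⟩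
  have hreach : ∀ a b : Pt, Relation.EqvGen (fun a b => (a, b) ∈ E) a b →
      a = b ∨ ∃ (ha : a ∈ R ∪ B) (hb : b ∈ R ∪ B), G.Reachable ⟨a, ha⟩ ⟨b, hb⟩ := by
    intro a b h
    induction h with
    | rel a b h =>
      exact Or.inr ⟨(hmem _ h).1, (hmem _ h).2.1, SimpleGraph.Adj.reachable (Or.inl h)⟩
    | refl a => exact Or.inl rfl
    | symm a b _ ih =>
      rcases ih with rfl | ⟨ha, hb, h⟩
      · exact Or.inl rfl
      · exact Or.inr ⟨hb, ha, h.symm⟩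
    | trans a b c _ _ ih1 ih2 =>
      rcases ih1 with rfl | ⟨ha, hb, h⟩
      · exact ih2
      rcases ih2 with rfl | ⟨hb', hc, h'⟩
      · exact Or.inr ⟨ha, hb, h⟩
      · exact Or.inr ⟨ha, hc, h.trans h'⟩
  have hconn : G.Connected := by
    refine (SimpleGraph.connected_iff _).2 ⟨?_, hne⟩
    rintro ⟨u, hu⟩ ⟨v, hv⟩
    rcases hreach u v (hE.1.conn u hu v hv) with h | ⟨_, _, h⟩
    · subst h; exact SimpleGraph.Reachable.refl _
    · exact h
  have hVc : Nat.card {x : Pt // x ∈ R ∪ B} = (k + 1) * B.card + 1 := by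
    rw [Nat.card_eq_fintype_card, Fintype.card_coe, Finset.card_union_of_disjoint hdisj, hcard]
    ring
  have hEc : E.card ≤ (k + 1) * B.card := edges_le hE (fun p _ h => h) (fun p h => h)
  have hGE : Nat.card G.edgeSet ≤ E.card := by
    let g : {e // e ∈ E} → Sym2 {x : Pt // x ∈ R ∪ B} := fun e =>
      s(⟨e.1.1, (hmem _ e.2).1⟩, ⟨e.1.2, (hmem _ e.2).2.1⟩)
    have hsub : G.edgeSet ⊆ Set.range g := by
      intro e
      induction e using Sym2.ind with
      | _ u v =>
        intro h
        rw [SimpleGraph.mem_edgeSet, hadj] at h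
        rcases h with h | h
        · exact ⟨⟨_, h⟩, rfl⟩
        · exact ⟨⟨_, h⟩, Sym2.eq_swap⟩
    calc Nat.card G.edgeSet ≤ Nat.card (Set.range g) :=
          Nat.card_mono (Set.finite_range g) hsub
      _ ≤ Nat.card {e // e ∈ E} := Finite.card_range_le g
      _ = E.card := by rw [Nat.card_eq_fintype_card, Fintype.card_coe]
  have htree : G.IsTree := by
    rw [SimpleGraph.isTree_iff_connected_and_card]
    refine ⟨hconn, ?_⟩
    have := hconn.card_vert_le_card_edgeSet_add_one
    omega
  have hdeg : ∀ v, deg G v ≤ dg E v.1 := by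
    intro v
    unfold deg dg
    rw [← Set.ncard_image_of_injective (G.neighborSet v) Subtype.val_injective]
    have hsub : Subtype.val '' G.neighborSet v ⊆
        (((E.filter (fun e => e.1 = v.1 ∨ e.2 = v.1)).image
          (fun e => if e.1 = v.1 then e.2 else e.1) : Finset Pt) : Set Pt) := by
      rintro _ ⟨u, hu, rfl⟩
      rw [SimpleGraph.mem_neighborSet, hadj] at hu
      rw [Finset.mem_coe, Finset.mem_image]
      rcases hu with hu | hu
      · exact ⟨_, Finset.mem_filter.2 ⟨hu, Or.inl rfl⟩, by simp⟩
      · refine ⟨_, Finset.mem_filter.2 ⟨hu, Or.inr rfl⟩, ?_⟩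
        have hne : u.1 ≠ v.1 := by
          intro h
          have := hmem _ hu
          simp only [h] at this
          exact this.2.2.1 this.2.2.2
        simp only [if_neg hne]
    refine (Set.ncard_le_ncard hsub (Finset.finite_toSet _)).trans ?_
    rw [Set.ncard_coe_finset]
    exact Finset.card_image_le
  have hpos : 1 ≤ deg G ⟨r, Finset.mem_union_left B hrR⟩ := by
    obtain ⟨b, hb⟩ := Finset.card_pos.1 (show 0 < B.card by omega)
    have hbr : (⟨r, Finset.mem_union_left B hrR⟩ : {x : Pt // x ∈ R ∪ B}) ≠
        ⟨b, Finset.mem_union_right R hb⟩ := by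
      intro h
      have h' : r = b := congrArg Subtype.val h
      exact Finset.disjoint_left.1 hdisj hrR (h' ▸ hb)
    have : Nontrivial {x : Pt // x ∈ R ∪ B} := ⟨_, _, hbr⟩
    have := hconn.preconnected.degree_pos_of_nontrivial ⟨r, Finset.mem_union_left B hrR⟩
    rw [SimpleGraph.degree_pos_iff_exists_adj] at this
    obtain ⟨w, hw⟩ := this
    unfold deg
    exact (Set.ncard_pos (Set.toFinite _)).2 ⟨w, hw⟩
  refine ⟨G, ⟨htree, ?_, ?_⟩, ?_, ?_, ?_⟩
  · intro u v h
    rcases h with h | h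
    · exact Or.inl ⟨hRB _ u.2 (hmem _ h).2.2.1, (hmem _ h).2.2.2⟩
    · exact Or.inr ⟨(hmem _ h).2.2.2, hRB _ v.2 (hmem _ h).2.2.1⟩
  · intro u v x y huv hxy hne p hp hp'
    rcases huv with h | h <;> rcases hxy with h' | h'
    · refine hE.1.nc _ h _ h' ?_ p hp hp'
      intro he
      have h1 : u = x := Subtype.ext (congrArg Prod.fst he)
      have h2 : v = y := Subtype.ext (congrArg Prod.snd he)
      exact hne (by rw [h1, h2])
    · rw [segment_symm ℝ x.1 y.1] at hp'
      have := hE.1.nc _ h _ h' (by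
        intro he
        have h1 : u = y := Subtype.ext (congrArg Prod.fst he)
        have h2 : v = x := Subtype.ext (congrArg Prod.snd he)
        exact hne (by rw [h1, h2, Sym2.eq_swap])) p hp hp'
      exact ⟨this.1, this.2.symm⟩
    · rw [segment_symm ℝ u.1 v.1] at hp
      have := hE.1.nc _ h _ h' (by
        intro he
        have h1 : v = x := Subtype.ext (congrArg Prod.fst he)
        have h2 : u = y := Subtype.ext (congrArg Prod.snd he)
        exact hne (by rw [h1, h2, Sym2.eq_swap])) p hp hp'
      exact ⟨this.1.symm, this.2⟩
    · rw [segment_symm ℝ u.1 v.1] at hp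
      rw [segment_symm ℝ x.1 y.1] at hp'
      have := hE.1.nc _ h _ h' (by
        intro he
        have h1 : v = y := Subtype.ext (congrArg Prod.fst he)
        have h2 : u = x := Subtype.ext (congrArg Prod.snd he)
        exact hne (by rw [h1, h2])) p hp hp'
      exact ⟨this.1.symm, this.2.symm⟩
  · intro v
    refine (hdeg v).trans ((hE.2 v.1).trans ?_)
    unfold cap; split_ifs <;> omega
  · have := (hdeg ⟨r, Finset.mem_union_left B hrR⟩).trans hEr
    omega
  · intro v hv _
    refine (hdeg v).trans ((hE.2 v.1).trans ?_)
    exact (cap_red (Finset.disjoint_left.1 hdisj hv)).le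
end
end
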